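/- arXiv:0704.2560 — 2 statements merged into one kernel-verified Lean document; each statement's English description precedes it below -/
import Mathlib

section
/- (Key renormalization estimate for occupied planar crossings.) Let d ≥ 7. There exist a positive constant c₅ depending only on d, a constant c = c(d), and a threshold c(L₀) with the following property. Suppose L₀ ≥ c and 0 ≤ u ≤ c(L₀), and assume that there exists a vacant-set law Q_u at level u. Then c₅·ℓ_n²·q_n(u) ≤ L_n^{−1/2} for all n ≥ 0. -/
open MeasureTheory
open scoped ENNReal

abbrev Zd (d : ℕ) := Fin d → ℤ

/-- Nearest-neighbor adjacency on `ℤ^d`. -/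
def adj {d : ℕ} (x y : Zd d) : Prop := (∑ i, (x i - y i).natAbs) = 1

instance {d : ℕ} (x y : Zd d) : Decidable (adj x y) := by
  unfold adj; infer_instance

/-- `P` is the family of laws of simple random walk on `ℤ^d`, characterized by its
finite-dimensional (cylinder) distributions. -/
def IsSRW (d : ℕ) (P : Zd d → Measure (ℕ → Zd d)) : Prop :=
  (∀ x, IsProbabilityMeasure (P x)) ∧
  ∀ (x : Zd d) (N : ℕ) (γ : ℕ → Zd d), γ 0 = x →
    P x {w | ∀ k ≤ N, w k = γ k} =
      if ∀ k < N, adj (γ (k + 1)) (γ k) then ((2 * d : ℝ≥0∞))⁻¹ ^ N else 0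

/-- The event `{H̃_K = ∞}`. -/
def escSet (d : ℕ) (K : Finset (Zd d)) : Set (ℕ → Zd d) :=
  {ω | ∀ n : ℕ, 1 ≤ n → ω n ∉ K}

/-- The equilibrium measure `e_K`. -/
noncomputable def eqm (d : ℕ) (P : Zd d → Measure (ℕ → Zd d)) (K : Finset (Zd d))
    (x : Zd d) : ℝ≥0∞ :=
  if x ∈ K then P x (escSet d K) else 0

/-- The capacity `cap(K) = Σ_x e_K(x)`. -/
noncomputable def capa (d : ℕ) (P : Zd d → Measure (ℕ → Zd d)) (K : Finset (Zd d)) : ℝ≥0∞ :=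
  ∑ x ∈ K, eqm d P K x

/-- `Q` is a vacant-set law at level `u`:
`Q[Y_z = 1 for z ∈ K] = exp(−u·cap(K))` for every finite `K`. -/
def IsVacantLaw (d : ℕ) (P : Zd d → Measure (ℕ → Zd d)) (u : ℝ)
    (Q : Measure (Zd d → Bool)) : Prop :=
  IsProbabilityMeasure Q ∧
  ∀ K : Finset (Zd d),
    Q {ω | ∀ z ∈ K, ω z = true} = ENNReal.ofReal (Real.exp (-(u * (capa d P K).toReal)))

/-- `*`-adjacency on `ℤ^d`: `|x − y|_∞ = 1`. -/
def adjStar {d : ℕ} (x y : Zd d) : Prop :=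
  x ≠ y ∧ ∀ i, (x i - y i).natAbs ≤ 1

/-- The length scales `L_n` of Section 3: `L_{n+1} = ℓ_n L_n`, `ℓ_n = 100⌊L_n^a⌋`,
`a = 1/(100d)`. -/
noncomputable def Lscale (d L0 : ℕ) : ℕ → ℕ
  | 0 => L0
  | n + 1 => (100 * ⌊(Lscale d L0 n : ℝ) ^ ((1 : ℝ) / (100 * d))⌋₊) * Lscale d L0 n

/-- `ℓ_n = 100⌊L_n^a⌋`. -/
noncomputable def ellScale (d L0 n : ℕ) : ℕ :=
  100 * ⌊(Lscale d L0 n : ℝ) ^ ((1 : ℝ) / (100 * d))⌋₊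

/-- The copy of `ℤ²` inside `ℤ^d`: points whose coordinates of index `≥ 2` vanish. -/
def planar (d : ℕ) : Set (Zd d) := {z | ∀ j : Fin d, 2 ≤ (j : ℕ) → z j = 0}

/-- The planar box `D_{n,(i₁,i₂)} = (i L_n + [0,L_n)²) ∩ ℤ²` inside `ℤ² ⊆ ℤ^d`. -/
def boxD (d L0 n : ℕ) (i1 i2 : ℤ) : Set (Zd d) :=
  {z | z ∈ planar d ∧ ∀ j : Fin d,
    ((j : ℕ) = 0 → i1 * (Lscale d L0 n : ℤ) ≤ z j ∧ z j < (i1 + 1) * (Lscale d L0 n : ℤ)) ∧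
    ((j : ℕ) = 1 → i2 * (Lscale d L0 n : ℤ) ≤ z j ∧ z j < (i2 + 1) * (Lscale d L0 n : ℤ))}

/-- `D̃_{n,(i₁,i₂)}`, the union of `D_{n,(i₁,i₂)}` and its `*`-neighboring planar boxes. -/
def boxDtil (d L0 n : ℕ) (i1 i2 : ℤ) : Set (Zd d) :=
  {z | z ∈ planar d ∧ ∀ j : Fin d,
    ((j : ℕ) = 0 → (i1 - 1) * (Lscale d L0 n : ℤ) ≤ z j ∧ z j < (i1 + 2) * (Lscale d L0 n : ℤ)) ∧
    ((j : ℕ) = 1 → (i2 - 1) * (Lscale d L0 n : ℤ) ≤ z j ∧ z j < (i2 + 2) * (Lscale d L0 n : ℤ))}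

/-- `Ṽ_{n,(i₁,i₂)}`, the relative interior boundary of `D̃_{n,(i₁,i₂)}` in `ℤ²`. -/
def boxVtil (d L0 n : ℕ) (i1 i2 : ℤ) : Set (Zd d) :=
  {z ∈ boxDtil d L0 n i1 i2 | ∃ y ∈ planar d, adj y z ∧ y ∉ boxDtil d L0 n i1 i2}

/-- The occupied crossing event `B^u_{n,(i₁,i₂)}`: a `*`-nearest-neighbor path of
occupied sites (`Y = 0`) inside `D̃` joining `D` to `Ṽ`. -/
def crossStarEvent (d L0 n : ℕ) (i1 i2 : ℤ) : Set (Zd d → Bool) :=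
  {ω | ∃ (len : ℕ) (γ : ℕ → Zd d),
      γ 0 ∈ boxD d L0 n i1 i2 ∧ γ len ∈ boxVtil d L0 n i1 i2 ∧
      (∀ k ≤ len, γ k ∈ boxDtil d L0 n i1 i2 ∧ ω (γ k) = false) ∧
      ∀ k < len, adjStar (γ (k + 1)) (γ k)}

lemma pair_ineq (v : ℝ) (hv : v ^ 2 ≤ 1 / 100) :
    (1 + v) ^ (-(23 / 10) : ℝ) + (1 - v) ^ (-(23 / 10) : ℝ) ≤ 2 + 8 * v ^ 2 := by
  have h1 : |v| ≤ 1 / 10 := by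
    apply abs_le_of_sq_le_sq' _ (by norm_num) |> abs_le.mpr; linarith
  obtain ⟨ha, hb⟩ := abs_le.mp h1
  have key : ∀ t : ℝ, -(1/10) ≤ t → (1 + t) ^ (23 / 10 : ℝ) ≤ (1 + t) ^ 2 * (1 + 3 / 10 * t) := by
    intro t ht
    have hp : 0 < 1 + t := by linarith
    rw [show (23 / 10 : ℝ) = (2 : ℕ) + 3 / 10 by norm_num, Real.rpow_add hp, Real.rpow_natCast]
    gcongr
    exact rpow_one_add_le_one_add_mul_self (by linarith) (by norm_num) (by norm_num)
  have hB : 1 - 23 / 10 * v ^ 2 ≤ (1 - v ^ 2) ^ (23 / 10 : ℝ) := by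
    have := one_add_mul_self_le_rpow_one_add (s := - v ^ 2) (by linarith) (p := 23/10) (by norm_num)
    rw [← sub_eq_add_neg] at this
    linarith
  have hprod : (1 - v ^ 2) ^ (23 / 10 : ℝ) = (1 + v) ^ (23 / 10 : ℝ) * (1 - v) ^ (23 / 10 : ℝ) := by
    rw [← Real.mul_rpow (by linarith) (by linarith)]; congr 1; ring
  have p1 : 0 < (1 + v) ^ (23 / 10 : ℝ) := Real.rpow_pos_of_pos (by linarith) _
  have p2 : 0 < (1 - v) ^ (23 / 10 : ℝ) := Real.rpow_pos_of_pos (by linarith) _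
  rw [Real.rpow_neg (by linarith), Real.rpow_neg (by linarith)]
  have k1 := key v (by linarith)
  have k2 := key (-v) (by linarith)
  rw [← sub_eq_add_neg] at k2
  have : ((1 + v) ^ (23 / 10 : ℝ))⁻¹ + ((1 - v) ^ (23 / 10 : ℝ))⁻¹
      = ((1 + v) ^ (23 / 10 : ℝ) + (1 - v) ^ (23 / 10 : ℝ)) / (1 - v ^ 2) ^ (23 / 10 : ℝ) := by
    rw [hprod]; field_simp; ring
  rw [this, div_le_iff₀ (by rw [hprod]; positivity)]
  have hs : (1 + v) ^ (23 / 10 : ℝ) + (1 - v) ^ (23 / 10 : ℝ) ≤ 2 + 32 / 10 * v ^ 2 := by nlinarith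
  have : (2 + 8 * v ^ 2) * (1 - 23 / 10 * v ^ 2) ≤ (2 + 8 * v ^ 2) * (1 - v ^ 2) ^ (23 / 10 : ℝ) := by
    gcongr
  nlinarith [sq_nonneg v, mul_nonneg (sq_nonneg v) (sub_nonneg.mpr hv)]

abbrev Dir (d : ℕ) := Fin d × Bool

def stp {d : ℕ} (a : Dir d) : Zd d := Pi.single a.1 (if a.2 then 1 else -1)

lemma adj_stp {d : ℕ} (x : Zd d) (a : Dir d) : adj (x + stp a) x := by
  unfold adj stp
  rw [Finset.sum_eq_single a.1]
  · rcases a with ⟨i, b⟩; cases b <;> simp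
  · intro b _ hb; simp [Pi.single_eq_of_ne hb]
  · simp

noncomputable def nsq {d : ℕ} (x : Zd d) : ℝ := ∑ i, (x i : ℝ) ^ 2

noncomputable def ff {d : ℕ} (x : Zd d) : ℝ := (nsq x + 400) ^ (-(23 / 10) : ℝ)

lemma nsq_nonneg {d : ℕ} (x : Zd d) : 0 ≤ nsq x := Finset.sum_nonneg fun _ _ => sq_nonneg _

lemma nsq_stp {d : ℕ} (x : Zd d) (i : Fin d) (b : Bool) :
    nsq (x + stp (i, b)) = nsq x + 1 + 2 * (x i) * (if b then 1 else -1) := by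
  unfold nsq stp
  rw [← Finset.add_sum_erase _ _ (Finset.mem_univ i), ← Finset.add_sum_erase _ _ (Finset.mem_univ i)]
  have : ∑ j ∈ Finset.univ.erase i, (((x + (Pi.single i (if b then 1 else -1) : Zd d)) j : ℤ) : ℝ) ^ 2
      = ∑ j ∈ Finset.univ.erase i, (x j : ℝ) ^ 2 := by
    apply Finset.sum_congr rfl
    intro j hj
    simp [Pi.single_eq_of_ne (Finset.ne_of_mem_erase hj)]
  simp only at this ⊢
  rw [this]
  cases b <;> simp <;> ring

lemma ff_super {d : ℕ} (hd : 7 ≤ d) (x : Zd d) :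
    (∑ a : Dir d, ff (x + stp a)) ≤ (2 * d) * ff x := by
  have hd' : (7 : ℝ) ≤ d := by exact_mod_cast hd
  rw [Fintype.sum_prod_type]
  set R := nsq x + 400 with hR
  have hR0 : 400 ≤ R := by have := nsq_nonneg x; linarith
  set A := R + 1 with hA
  have hA0 : 0 < A := by linarith
  have hone : ∀ i : Fin d, ∑ b : Bool, ff (x + stp (i, b))
      ≤ A ^ (-(23 / 10) : ℝ) * (2 + 8 * (2 * x i / A) ^ 2) := by
    intro i
    have hxi : (x i : ℝ) ^ 2 ≤ nsq x :=
      Finset.single_le_sum (f := fun i => (x i : ℝ) ^ 2) (fun _ _ => sq_nonneg _) (Finset.mem_univ i)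
    have hv : (2 * x i / A) ^ 2 ≤ 1 / 100 := by
      rw [div_pow, div_le_div_iff₀ (by positivity) (by norm_num)]
      nlinarith
    have hv' : |2 * x i / A| ≤ 1 / 10 := by
      apply abs_le_of_sq_le_sq' _ (by norm_num) |> abs_le.mpr; linarith
    obtain ⟨h1, h2⟩ := abs_le.mp hv'
    have := pair_ineq _ hv
    rw [Fintype.sum_bool]
    unfold ff
    rw [nsq_stp, nsq_stp]
    have e1 : nsq x + 1 + 2 * (x i) * (if true then 1 else -1) + 400 = A * (1 + 2 * x i / A) := by
      simp only [if_true]; field_simp; rw [hA, hR]; ring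
    have e2 : nsq x + 1 + 2 * (x i) * (if false then 1 else -1) + 400 = A * (1 - 2 * x i / A) := by
      simp only [Bool.false_eq_true, if_false]; field_simp; rw [hA, hR]; ring
    rw [e1, e2, Real.mul_rpow hA0.le (by linarith), Real.mul_rpow hA0.le (by linarith), ← mul_add]
    gcongr
  refine (Finset.sum_le_sum fun i _ => hone i).trans ?_
  rw [← Finset.mul_sum, Finset.sum_add_distrib, ← Finset.mul_sum]
  have e3 : ∑ i : Fin d, (2 * x i / A : ℝ) ^ 2 = 4 * nsq x / A ^ 2 := by
    unfold nsq; rw [Finset.mul_sum, Finset.sum_div]; apply Finset.sum_congr rfl; intros; ring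
  rw [e3]
  simp only [Finset.sum_const, Finset.card_univ, Fintype.card_fin, nsmul_eq_mul]
  have e4 : 4 * nsq x / A ^ 2 ≤ 4 / A := by
    rw [div_le_div_iff₀ (by positivity) hA0]; nlinarith [nsq_nonneg x]
  have hBern : A ^ (-(23 / 10) : ℝ) * (1 + 23 / 10 / R) ≤ ff x := by
    have hRp : 0 < R := by linarith
    have := one_add_mul_self_le_rpow_one_add (s := 1 / R) (by have : 0 < 1 / R := by positivity
                                                              linarith) (p := 23/10) (by norm_num)
    have h5 : (1 + 1 / R) = A / R := by field_simp; rw [hA]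
    rw [h5, Real.div_rpow hA0.le hRp.le] at this
    unfold ff
    rw [← hR, Real.rpow_neg hA0.le, Real.rpow_neg hRp.le]
    have hp : 0 < A ^ (23 / 10 : ℝ) := Real.rpow_pos_of_pos hA0 _
    calc _ = (A ^ (23 / 10 : ℝ))⁻¹ * (1 + 23 / 10 * (1 / R)) := by ring
      _ ≤ (A ^ (23 / 10 : ℝ))⁻¹ * (A ^ (23 / 10 : ℝ) / R ^ (23 / 10 : ℝ)) := by gcongr
      _ = _ := by field_simp
  have hp : 0 < A ^ (-(23 / 10) : ℝ) := Real.rpow_pos_of_pos hA0 _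
  have h6 : d * 2 + 8 * (4 * nsq x / A ^ 2) ≤ 2 * d * (1 + 23 / 10 / R) := by
    have : 23 / 10 / A ≤ 23 / 10 / R := by gcongr; linarith
    have h7 : 32 / A ≤ 2 * d * (23 / 10 / A) := by
      rw [← sub_nonneg]
      have : 2 * d * (23 / 10 / A) - 32 / A = (d * (46 / 10) - 32) / A := by field_simp; ring
      rw [this]; apply div_nonneg _ hA0.le; linarith
    have h8 : 8 * (4 / A) = 32 / A := by ring
    have h9 : (2 * d : ℝ) * (23 / 10 / A) ≤ 2 * d * (23 / 10 / R) := by gcongr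
    linarith
  calc _ ≤ A ^ (-(23 / 10) : ℝ) * (2 * d * (1 + 23 / 10 / R)) := by gcongr
    _ = 2 * d * (A ^ (-(23 / 10) : ℝ) * (1 + 23 / 10 / R)) := by ring
    _ ≤ _ := by gcongr
def pos {d N : ℕ} (s : Fin N → Dir d) (k : ℕ) : Zd d :=
  ∑ i : Fin N, if (i : ℕ) < k then stp (s i) else 0

lemma pos_zero {d N : ℕ} (s : Fin N → Dir d) : pos s 0 = 0 := by simp [pos]

lemma pos_succ {d N : ℕ} (s : Fin N → Dir d) (k : ℕ) (hk : k < N) :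
    pos s (k + 1) = pos s k + stp (s ⟨k, hk⟩) := by
  unfold pos
  rw [← sub_eq_iff_eq_add', ← Finset.sum_sub_distrib, Finset.sum_eq_single ⟨k, hk⟩]
  · simp
  · intro b _ hb
    have : (b : ℕ) ≠ k := fun h => hb (Fin.ext h)
    by_cases h : (b : ℕ) < k
    · simp [h, Nat.lt_succ_of_lt h]
    · have : ¬ (b : ℕ) < k + 1 := by omega
      simp [h, this]
  · simp

lemma pos_cons {d N : ℕ} (a : Dir d) (s : Fin N → Dir d) (k : ℕ) :
    pos (Fin.cons a s : Fin (N + 1) → Dir d) (k + 1) = stp a + pos s k := by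
  unfold pos
  rw [Fin.sum_univ_succ]
  simp

lemma stp_inj {d : ℕ} : Function.Injective (stp : Dir d → Zd d) := by
  rintro ⟨i, b⟩ ⟨j, c⟩ h
  unfold stp at h
  have hij : i = j := by
    by_contra hne
    have := congrFun h i
    simp only [Pi.single_eq_same, Pi.single_eq_of_ne hne] at this
    revert this; cases b <;> simp
  subst hij
  have := congrFun h i
  simp only [Pi.single_eq_same] at this
  revert this; cases b <;> cases c <;> simp

lemma pos_inj {d N : ℕ} {s t : Fin N → Dir d} (h : ∀ k ≤ N, pos s k = pos t k) : s = t := by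
  funext ⟨k, hk⟩
  have h1 := h (k + 1) hk
  rw [pos_succ _ _ hk, pos_succ _ _ hk, h k hk.le] at h1
  exact stp_inj (add_left_cancel h1)

lemma card_dir (d N : ℕ) : Fintype.card (Fin N → Dir d) = (2 * d) ^ N := by
  simp [mul_comm]

open Classical in
lemma srw_finite {d : ℕ} (hd : 0 < d) {P : Zd d → Measure (ℕ → Zd d)} (hP : IsSRW d P) (x : Zd d) (N : ℕ)
    (A : Set (ℕ → Zd d)) (hA : ∀ w w', (∀ k ≤ N, w k = w' k) → w ∈ A → w' ∈ A) :
    (P x A).toReal = ((Finset.univ.filter fun s : Fin N → Dir d => (fun k => x + pos s k) ∈ A).card : ℝ)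
      / (2 * d) ^ N := by
  have := hP.1 x
  let C : (Fin N → Dir d) → Set (ℕ → Zd d) := fun s => {w | ∀ k ≤ N, w k = x + pos s k}
  have hCm : ∀ s, MeasurableSet (C s) := by
    intro s
    have : C s = ⋂ k ∈ Finset.range (N + 1), (fun w : ℕ → Zd d => w k) ⁻¹' {x + pos s k} := by
      ext w; simp [C]
    rw [this]
    exact Finset.measurableSet_biInter _ fun k _ => measurable_pi_apply k (measurableSet_singleton _)
  have hCP : ∀ s, P x (C s) = ((2 * d : ℝ≥0∞))⁻¹ ^ N := by
    intro s
    have := hP.2 x N (fun k => x + pos s k) (by simp [pos_zero])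
    rw [if_pos] at this
    · exact this
    · intro k hk
      rw [pos_succ _ _ hk, ← add_assoc]
      exact adj_stp _ _
  have hCd : Pairwise (Function.onFun Disjoint C) := by
    intro s t hst
    rw [Function.onFun, Set.disjoint_left]
    intro w hs ht
    apply hst
    apply pos_inj
    intro k hk
    have := (hs k hk).symm.trans (ht k hk)
    exact add_left_cancel this
  have h0 : (2 * d : ℝ≥0∞) ≠ 0 := by simp; omega
  have hT : (2 * d : ℝ≥0∞) ≠ ⊤ := by finiteness
  have hU : P x (⋃ s, C s) = 1 := by
    rw [measure_iUnion hCd hCm, tsum_fintype]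
    simp only [hCP, Finset.sum_const, Finset.card_univ, card_dir, nsmul_eq_mul]
    push_cast
    rw [← mul_pow, ENNReal.mul_inv_cancel h0 hT, one_pow]
  have hUc : P x (⋃ s, C s)ᶜ = 0 := by
    rw [measure_compl (MeasurableSet.iUnion hCm) (by finiteness), hU]; simp
  have hAe : P x A = P x (⋃ s ∈ (Finset.univ.filter fun s : Fin N → Dir d => (fun k => x + pos s k) ∈ A), C s) := by
    have hh : A ∩ (⋃ s, C s) = ⋃ s ∈ (Finset.univ.filter fun s : Fin N → Dir d => (fun k => x + pos s k) ∈ A), C s := by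
      ext w
      simp only [Set.mem_inter_iff, Set.mem_iUnion, Finset.mem_filter, Finset.mem_univ, true_and, exists_prop]
      constructor
      · rintro ⟨hw, s, hs⟩
        exact ⟨s, hA w _ hs hw, hs⟩
      · rintro ⟨s, hs, hw⟩
        exact ⟨hA _ w (fun k hk => (hw k hk).symm) hs, s, hw⟩
    rw [← hh]
    exact (measure_inter_conull hUc).symm
  rw [hAe, measure_biUnion_finset (fun s _ t _ h => hCd h) (fun s _ => hCm s)]
  simp only [hCP, Finset.sum_const, nsmul_eq_mul]
  rw [ENNReal.toReal_mul, ENNReal.toReal_pow, ENNReal.toReal_inv]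
  have h2 : ((2 * d : ℝ≥0∞)).toReal = 2 * d := by simp
  rw [h2, inv_pow, ENNReal.toReal_natCast, div_eq_mul_inv]

open Classical in
lemma hit_bound {d : ℕ} (hd : 7 ≤ d) (N : ℕ) (x : Zd d) :
    ((Finset.univ.filter fun s : Fin N → Dir d => ∃ k ≤ N, x + pos s k = 0).card : ℝ) * ff (0 : Zd d)
      ≤ (2 * d) ^ N * ff x := by
  have ffpos : ∀ y : Zd d, 0 < ff y := fun y =>
    Real.rpow_pos_of_pos (by have := nsq_nonneg y; linarith) _
  induction N generalizing x with
  | zero =>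
    by_cases hx : x = 0
    · subst hx; simp [pos_zero]
    · simp [pos_zero, hx]; exact (ffpos x).le
  | succ N ih =>
    by_cases hx : x = 0
    · subst hx
      gcongr
      · exact (ffpos _).le
      · refine (Nat.cast_le.mpr (Finset.card_le_univ _)).trans ?_
        rw [card_dir]; push_cast; rfl
    · have hcard : (Finset.univ.filter fun s : Fin (N + 1) → Dir d => ∃ k ≤ N + 1, x + pos s k = 0).card
          = ∑ a : Dir d, (Finset.univ.filter fun s : Fin N → Dir d => ∃ k ≤ N, (x + stp a) + pos s k = 0).card := by
        simp only [Finset.card_filter]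
        rw [← (Fin.consEquiv (fun _ : Fin (N + 1) => Dir d)).sum_comp, Fintype.sum_prod_type]
        refine Finset.sum_congr rfl fun a _ => Finset.sum_congr rfl fun s _ => ?_
        congr 1
        apply propext
        simp only [Fin.consEquiv, Equiv.coe_fn_mk]
        constructor
        · rintro ⟨k, hk, h⟩
          cases k with
          | zero => simp [pos_zero] at h; exact absurd h hx
          | succ k => rw [pos_cons, ← add_assoc] at h; exact ⟨k, by omega, h⟩
        · rintro ⟨k, hk, h⟩
          exact ⟨k + 1, by omega, by rw [pos_cons, ← add_assoc]; exact h⟩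
      rw [hcard]
      push_cast
      rw [Finset.sum_mul]
      calc _ ≤ ∑ a : Dir d, (2 * d : ℝ) ^ N * ff (x + stp a) := Finset.sum_le_sum fun a _ => ih _
        _ = (2 * d : ℝ) ^ N * ∑ a : Dir d, ff (x + stp a) := by rw [Finset.mul_sum]
        _ ≤ (2 * d : ℝ) ^ N * (2 * d * ff x) := by gcongr; exact ff_super hd x
        _ = _ := by ring
def avoidSet {d : ℕ} (S : Finset (Zd d)) (k : ℕ) : Set (ℕ → Zd d) :=
  {w | ∀ j, 1 ≤ j → j ≤ k → w j ∉ S}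

lemma measurable_avoid {d : ℕ} (S : Finset (Zd d)) (k : ℕ) : MeasurableSet (avoidSet S k) := by
  have : avoidSet S k = ⋂ j, ⋂ (_ : 1 ≤ j), ⋂ (_ : j ≤ k), (fun w : ℕ → Zd d => w j) ⁻¹' (S : Set (Zd d))ᶜ := by
    ext w; simp [avoidSet]
  rw [this]
  exact MeasurableSet.iInter fun j => MeasurableSet.iInter fun _ => MeasurableSet.iInter fun _ =>
    measurable_pi_apply j (Finset.measurableSet S).compl

lemma esc_tendsto {d : ℕ} {P : Zd d → Measure (ℕ → Zd d)} (hP : IsSRW d P) (S : Finset (Zd d)) (y : Zd d) :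
    Filter.Tendsto (fun k => (P y (avoidSet S k)).toReal) Filter.atTop (nhds (P y (escSet d S)).toReal) := by
  have := hP.1 y
  have he : escSet d S = ⋂ k, avoidSet S k := by
    ext w; simp only [escSet, avoidSet, Set.mem_iInter, Set.mem_ofPred_eq]
    exact ⟨fun h k j hj _ => h j hj, fun h j hj => h j j hj le_rfl⟩
  rw [he]
  refine (ENNReal.tendsto_toReal (by finiteness)).comp ?_
  apply tendsto_measure_iInter_atTop (fun k => (measurable_avoid S k).nullMeasurableSet)
  · intro k l hkl w hw j hj hjk
    exact hw j hj (hjk.trans hkl)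
  · exact ⟨0, by finiteness⟩

lemma capa_real {d : ℕ} {P : Zd d → Measure (ℕ → Zd d)} (hP : IsSRW d P) (S : Finset (Zd d)) :
    (capa d P S).toReal = ∑ y ∈ S, (P y (escSet d S)).toReal := by
  unfold capa
  rw [ENNReal.toReal_sum]
  · exact Finset.sum_congr rfl fun y hy => by simp [eqm, hy]
  · intro y hy
    have := hP.1 y
    simp [eqm, hy]

def negD {d : ℕ} (a : Dir d) : Dir d := (a.1, !a.2)

lemma stp_neg {d : ℕ} (a : Dir d) : stp (negD a) = - stp a := by
  rcases a with ⟨i, b⟩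
  cases b <;> simp [stp, negD, ← Pi.single_neg]

def revS {d N : ℕ} (k : ℕ) (s : Fin N → Dir d) : Fin N → Dir d := fun i =>
  if h : (i : ℕ) < k ∧ k ≤ N then negD (s ⟨k - 1 - i, by omega⟩) else s i

lemma revS_revS {d N : ℕ} (k : ℕ) (s : Fin N → Dir d) : revS k (revS k s) = s := by
  funext i
  unfold revS
  by_cases h : (i : ℕ) < k ∧ k ≤ N
  · have h2 : k - 1 - (i : ℕ) < k := by omega
    have h3 : k - 1 - (k - 1 - (i : ℕ)) = i := by omega
    simp [h, h2, h3, negD]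
  · simp [h]

lemma pos_revS {d N : ℕ} (k : ℕ) (hk : k ≤ N) (s : Fin N → Dir d) (j : ℕ) (hj : j ≤ k) :
    pos (revS k s) j = pos s (k - j) - pos s k := by
  induction j with
  | zero => simp [pos_zero]
  | succ j ih =>
    have hj' : j < k := hj
    rw [pos_succ _ _ (by omega : j < N), ih hj'.le]
    have e : k - j = (k - (j + 1)) + 1 := by omega
    rw [e, pos_succ _ _ (by omega)]
    have : revS k s ⟨j, by omega⟩ = negD (s ⟨k - (j + 1), by omega⟩) := by
      unfold revS
      rw [dif_pos ⟨hj', hk⟩]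
      congr 3
      simp only; omega
    rw [this, stp_neg]
    abel

open Classical in
lemma rev_count {d N : ℕ} (S : Finset (Zd d)) (y : Zd d) (k : ℕ) (hk : k ≤ N) :
    (Finset.univ.filter fun s : Fin N → Dir d => (fun k => y + pos s k) ∈ avoidSet S k).card
     = (Finset.univ.filter fun s : Fin N → Dir d => ∀ j < k, y - pos s k + pos s j ∉ S).card := by
  apply Finset.card_nbij' (revS k) (revS k)
  · intro s hs
    replace hs := (Finset.mem_filter.mp hs).2
    refine Finset.mem_filter.mpr ⟨Finset.mem_univ _, ?_⟩
    intro j hj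
    have : y + pos s (k - j) ∉ S := hs (k - j) (by omega) (by omega)
    rw [pos_revS k hk s k le_rfl, pos_revS k hk s j hj.le]
    simp only [Nat.sub_self, pos_zero]
    convert this using 1
    abel
  · intro s hs
    replace hs := (Finset.mem_filter.mp hs).2
    refine Finset.mem_filter.mpr ⟨Finset.mem_univ _, ?_⟩
    intro j hj hjk
    have := hs (k - j) (by omega)
    show y + pos (revS k s) j ∉ S
    rw [pos_revS k hk s j hjk]
    convert this using 1
    abel
  · intro s _; exact revS_revS k s
  · intro s _; exact revS_revS k s

open Classical in
noncomputable def Bset {d : ℕ} (K : Finset (Zd d)) (p : ℕ → Zd d) (N : ℕ) : Finset (Zd d) :=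
  ((Finset.range N) ×ˢ K).image fun q => q.2 - p q.1

open Classical in
lemma count_hit {d : ℕ} (K S : Finset (Zd d)) (hS : S ⊆ K) (p : ℕ → Zd d) (N : ℕ) :
    ∑ k ∈ Finset.range N, ∑ y ∈ S, (if ∀ j < k, y - p k + p j ∉ S then 1 else 0)
      = ((Bset K p N).filter fun x => ∃ k < N, x + p k ∈ S).card := by
  rw [← Finset.sum_product', ← Finset.card_filter]
  apply Finset.card_bij (fun q _ => q.2 - p q.1)
  · rintro ⟨k, y⟩ h
    simp only [Finset.mem_filter, Finset.mem_product, Finset.mem_range] at h ⊢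
    refine ⟨Finset.mem_image.mpr ⟨(k, y), ?_, rfl⟩, k, h.1.1, by simpa using h.1.2⟩
    simp [h.1.1, hS h.1.2]
  · have key : ∀ k y k' y', y ∈ S → (∀ j < k', y' - p k' + p j ∉ S) → y - p k = y' - p k' → ¬ k < k' := by
      intro k y k' y' hy h he hlt
      apply h k hlt
      rw [← he]; simpa using hy
    rintro ⟨k, y⟩ h ⟨k', y'⟩ h' he
    simp only [Finset.mem_filter, Finset.mem_product, Finset.mem_range] at h h' he
    have h1 := key k y k' y' h.1.2 h'.2 he
    have h2 := key k' y' k y h'.1.2 h.2 he.symm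
    have h3 : k = k' := by omega
    subst h3
    simpa using he
  · intro x hx
    simp only [Finset.mem_filter] at hx
    obtain ⟨-, hx⟩ := hx
    have hf := Nat.find_spec hx
    refine ⟨(Nat.find hx, x + p (Nat.find hx)), ?_, by simp⟩
    simp only [Finset.mem_filter, Finset.mem_product, Finset.mem_range]
    refine ⟨hf, fun j hj hjS => Nat.find_min hx hj ⟨hj.trans hf.1, ?_⟩⟩
    simpa using hjS

open Classical in
noncomputable def trc {d : ℕ} (K : Finset (Zd d)) (p : ℕ → Zd d) (N : ℕ) (x : Zd d) : Finset (Zd d) :=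
  K.filter fun y => ∃ k < N, x + p k = y

open Classical in
lemma count_trc {d : ℕ} (K S : Finset (Zd d)) (hS : S ⊆ K) (p : ℕ → Zd d) (N : ℕ) :
    ((Bset K p N).filter fun x => ∃ k < N, x + p k ∈ S).card
     = ∑ T : {T // T ∈ K.powerset}, if Disjoint T.1 S then 0 else
        ((Bset K p N).filter fun x => trc K p N x = T.1).card := by
  have hiff : ∀ x, (∃ k < N, x + p k ∈ S) ↔ ¬ Disjoint (trc K p N x) S := by
    intro x
    rw [Finset.not_disjoint_iff]
    constructor
    · rintro ⟨k, hk, h⟩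
      exact ⟨_, Finset.mem_filter.mpr ⟨hS h, k, hk, rfl⟩, h⟩
    · rintro ⟨y, hy, h⟩
      obtain ⟨-, k, hk, rfl⟩ := Finset.mem_filter.mp hy
      exact ⟨k, hk, h⟩
  rw [Finset.sum_coe_sort K.powerset (fun T => if Disjoint T S then 0 else
        ((Bset K p N).filter fun x => trc K p N x = T).card)]
  rw [Finset.card_eq_sum_card_fiberwise (f := trc K p N) (t := K.powerset)]
  · refine Finset.sum_congr rfl fun T _ => ?_
    rw [Finset.filter_filter]
    split_ifs with h
    · rw [Finset.card_eq_zero, Finset.filter_eq_empty_iff]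
      rintro x - ⟨h1, rfl⟩
      exact (hiff x).mp h1 h
    · congr 1
      apply Finset.filter_congr
      intro x _
      constructor
      · exact fun h => h.2
      · rintro rfl; exact ⟨(hiff x).mpr h, rfl⟩
  · intro x _
    exact Finset.mem_powerset.mpr (Finset.filter_subset _ _)

open Classical in
noncomputable def mN {d : ℕ} (K : Finset (Zd d)) (N : ℕ) (T : {T // T ∈ K.powerset}) : ℝ :=
  (N : ℝ)⁻¹ * ((∑ s : Fin N → Dir d, (((Bset K (pos s) N).filter fun x => trc K (pos s) N x = T.1).card : ℝ))
    / (2 * d) ^ N)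

open Classical in
lemma capN_eq {d : ℕ} (hd : 0 < d) {P : Zd d → Measure (ℕ → Zd d)} (hP : IsSRW d P)
    (K S : Finset (Zd d)) (hS : S ⊆ K) (N : ℕ) :
    (N : ℝ)⁻¹ * ∑ k ∈ Finset.range N, ∑ y ∈ S, (P y (avoidSet S k)).toReal
     = ∑ T, if Disjoint T.1 S then 0 else mN K N T := by
  have h1 : ∀ k ∈ Finset.range N, ∀ y ∈ S, (P y (avoidSet S k)).toReal
      = (∑ s : Fin N → Dir d, ((if ∀ j < k, y - pos s k + pos s j ∉ S then 1 else 0 : ℕ) : ℝ)) / (2 * d) ^ N := by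
    intro k hk y hy
    have hk := Finset.mem_range.mp hk
    rw [srw_finite hd hP y N (avoidSet S k), rev_count S y k hk.le, Finset.card_filter]
    · push_cast; rfl
    · intro w w' h hw j hj hjk
      rw [← h j (by omega)]
      exact hw j hj hjk
  rw [Finset.sum_congr rfl fun k hk => Finset.sum_congr rfl (h1 k hk)]
  have h2 : ∀ s : Fin N → Dir d, (∑ T : {T // T ∈ K.powerset}, if Disjoint T.1 S then (0 : ℝ) else
        (((Bset K (pos s) N).filter fun x => trc K (pos s) N x = T.1).card : ℝ))
      = ∑ k ∈ Finset.range N, ∑ y ∈ S, ((if ∀ j < k, y - pos s k + pos s j ∉ S then 1 else 0 : ℕ) : ℝ) := by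
    intro s
    have := (count_hit K S hS (pos s) N).trans (count_trc K S hS (pos s) N)
    rw [← @Nat.cast_inj ℝ] at this
    push_cast at this ⊢
    exact this.symm
  have h3 : ∑ T : {T // T ∈ K.powerset}, (if Disjoint T.1 S then 0 else mN K N T)
     = (N : ℝ)⁻¹ * ((∑ s : Fin N → Dir d, ∑ T : {T // T ∈ K.powerset}, if Disjoint T.1 S then (0 : ℝ) else
        (((Bset K (pos s) N).filter fun x => trc K (pos s) N x = T.1).card : ℝ)) / (2 * d) ^ N) := by
    rw [Finset.sum_comm, Finset.sum_div, Finset.mul_sum]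
    refine Finset.sum_congr rfl fun T _ => ?_
    split_ifs
    · simp
    · rfl
  rw [h3, Finset.sum_congr rfl fun s _ => h2 s]
  congr 1
  simp only [← Finset.sum_div]
  congr 1
  symm
  rw [Finset.sum_comm]
  exact Finset.sum_congr rfl fun k _ => Finset.sum_comm

open Classical in
lemma mN_bound {d : ℕ} (hd : 0 < d) (K : Finset (Zd d)) (N : ℕ) (T : {T // T ∈ K.powerset}) :
    mN K N T ∈ Set.Icc (0 : ℝ) K.card := by
  unfold mN
  constructor
  · positivity
  · have h1 : ∀ s : Fin N → Dir d, (((Bset K (pos s) N).filter fun x => trc K (pos s) N x = T.1).card : ℝ)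
        ≤ N * K.card := by
      intro s
      have : ((Bset K (pos s) N).filter fun x => trc K (pos s) N x = T.1).card ≤ N * K.card := by
        refine (Finset.card_filter_le _ _).trans (Finset.card_image_le.trans ?_)
        simp
      exact_mod_cast this
    have hd' : (0 : ℝ) < d := by exact_mod_cast hd
    calc _ ≤ (N : ℝ)⁻¹ * ((∑ s : Fin N → Dir d, (N * K.card : ℝ)) / (2 * d) ^ N) := by
            gcongr with s; exact h1 s
      _ = (N : ℝ)⁻¹ * (N * K.card) := by
            rw [Finset.sum_const, Finset.card_univ, card_dir, nsmul_eq_mul]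
            push_cast
            field_simp
      _ ≤ _ := by
            rcases Nat.eq_zero_or_pos N with rfl | h
            · simp
            · have : (N : ℝ) ≠ 0 := by positivity
              rw [inv_mul_cancel_left₀ this]

open Classical in
lemma cap_rep {d : ℕ} (hd : 0 < d) {P : Zd d → Measure (ℕ → Zd d)} (hP : IsSRW d P)
    (K : Finset (Zd d)) :
    ∃ m : {T // T ∈ K.powerset} → ℝ, (∀ T, 0 ≤ m T) ∧ ∀ S ⊆ K,
      (capa d P S).toReal = ∑ T, if Disjoint T.1 S then 0 else m T := by
  have hc : IsCompact (Set.pi Set.univ fun _ : {T // T ∈ K.powerset} => Set.Icc (0 : ℝ) K.card) :=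
    isCompact_univ_pi fun _ => isCompact_Icc
  obtain ⟨m, hm, φ, hφ, hlim⟩ := hc.tendsto_subseq (x := mN K) (fun N T _ => mN_bound hd K N T)
  refine ⟨m, fun T => (hm T (Set.mem_univ _)).1, fun S hS => ?_⟩
  have h1 : Filter.Tendsto (fun N : ℕ => (N : ℝ)⁻¹ * ∑ k ∈ Finset.range N, ∑ y ∈ S, (P y (avoidSet S k)).toReal)
      Filter.atTop (nhds (capa d P S).toReal) := by
    rw [capa_real hP]
    exact Filter.Tendsto.cesaro (tendsto_finsetSum _ fun y _ => esc_tendsto hP S y)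
  have h2 := h1.comp hφ.tendsto_atTop
  refine tendsto_nhds_unique h2 ?_
  have h3 : ((fun N : ℕ => (N : ℝ)⁻¹ * ∑ k ∈ Finset.range N, ∑ y ∈ S, (P y (avoidSet S k)).toReal) ∘ φ)
     = fun N => ∑ T, if Disjoint T.1 S then 0 else mN K (φ N) T := by
    funext N; exact capN_eq hd hP K S hS (φ N)
  rw [h3]
  apply tendsto_finsetSum
  intro T _
  split_ifs
  · exact tendsto_const_nhds
  · exact (tendsto_pi_nhds.mp hlim) T
lemma ff_pos {d : ℕ} (y : Zd d) : 0 < ff y :=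
  Real.rpow_pos_of_pos (by have := nsq_nonneg y; linarith) _

open Classical in
lemma hit_prob {d : ℕ} (hd : 7 ≤ d) {P : Zd d → Measure (ℕ → Zd d)} (hP : IsSRW d P) (x z : Zd d) (N : ℕ) :
    (P x {w | ∃ k ≤ N, w k = z}).toReal ≤ ff (x - z) / ff (0 : Zd d) := by
  obtain ⟨A, hA⟩ : ∃ A : Set (ℕ → Zd d), A = {w | ∃ k ≤ N, w k = z} := ⟨_, rfl⟩
  have hA' : ∀ w, w ∈ A ↔ ∃ k ≤ N, w k = z := fun w => by rw [hA]; rfl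
  rw [← hA, srw_finite (by omega) hP x N A]
  · have := hit_bound hd N (x - z)
    have hd' : (0 : ℝ) < d := by exact_mod_cast (by omega : 0 < d)
    rw [div_le_div_iff₀ (by positivity) (ff_pos _), mul_comm (ff _)]
    refine le_trans (le_of_eq ?_) this
    congr 2
    apply congrArg Finset.card
    ext s
    rw [Finset.mem_filter, Finset.mem_filter]
    refine and_congr_right fun _ => ?_
    rw [hA']
    refine exists_congr fun k => and_congr_right fun _ => ?_
    rw [← sub_eq_zero]
    constructor <;> intro h <;> rw [← h] <;> abel
  · intro w w' h
    rw [hA', hA']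
    rintro ⟨k, hk, rfl⟩
    exact ⟨k, hk, (h k hk).symm⟩

open Classical in
lemma esc_diff {d : ℕ} (hd : 7 ≤ d) {P : Zd d → Measure (ℕ → Zd d)} (hP : IsSRW d P)
    (K1 K2 : Finset (Zd d)) (x : Zd d) :
    (P x (escSet d K1)).toReal ≤ (P x (escSet d (K1 ∪ K2))).toReal + ∑ z ∈ K2, ff (x - z) / ff (0 : Zd d) := by
  have := hP.1 x
  refine le_of_tendsto_of_tendsto' (esc_tendsto hP K1 x) ((esc_tendsto hP (K1 ∪ K2) x).add_const _) fun k => ?_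
  have hsub : avoidSet K1 k ⊆ avoidSet (K1 ∪ K2) k ∪ ⋃ z ∈ K2, {w | ∃ j ≤ k, w j = z} := by
    intro w hw
    by_cases h : ∃ j ≤ k, w j ∈ K2
    · right
      obtain ⟨j, hj, h⟩ := h
      simp only [Set.mem_iUnion]
      exact ⟨w j, h, j, hj, rfl⟩
    · left
      intro j hj hjk hh
      rcases Finset.mem_union.mp hh with h1 | h2
      · exact hw j hj hjk h1
      · exact h ⟨j, hjk, h2⟩
  have h1 : P x (avoidSet K1 k) ≤ P x (avoidSet (K1 ∪ K2) k) + ∑ z ∈ K2, P x {w | ∃ j ≤ k, w j = z} :=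
    (measure_mono hsub).trans ((measure_union_le _ _).trans (by gcongr; exact measure_biUnion_finset_le _ _))
  have hfin : ∑ z ∈ K2, P x {w | ∃ j ≤ k, w j = z} ≠ ⊤ := by
    rw [ENNReal.sum_ne_top]; intro z _; finiteness
  have h2 := ENNReal.toReal_mono (by finiteness) h1
  rw [ENNReal.toReal_add (by finiteness) hfin, ENNReal.toReal_sum (by intro z _; finiteness)] at h2
  refine h2.trans ?_
  gcongr with z hz
  exact hit_prob hd hP x z k

open Classical in
lemma cap_diff {d : ℕ} (hd : 7 ≤ d) {P : Zd d → Measure (ℕ → Zd d)} (hP : IsSRW d P)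
    (K1 K2 : Finset (Zd d)) (hdis : Disjoint K1 K2) (b : ℝ)
    (hb : ∀ x ∈ K1, ∀ z ∈ K2, ff (x - z) / ff (0 : Zd d) ≤ b ∧ ff (z - x) / ff (0 : Zd d) ≤ b) :
    (capa d P K1).toReal + (capa d P K2).toReal ≤ (capa d P (K1 ∪ K2)).toReal
      + 2 * (K1.card * K2.card * b) := by
  rw [capa_real hP, capa_real hP, capa_real hP, Finset.sum_union hdis]
  have h1 : ∑ y ∈ K1, (P y (escSet d K1)).toReal ≤
      ∑ y ∈ K1, (P y (escSet d (K1 ∪ K2))).toReal + K1.card * (K2.card * b) := by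
    rw [← nsmul_eq_mul (K1.card), ← Finset.sum_const, ← Finset.sum_add_distrib]
    refine Finset.sum_le_sum fun x hx => (esc_diff hd hP K1 K2 x).trans ?_
    gcongr
    rw [← nsmul_eq_mul]
    exact Finset.sum_le_card_nsmul _ _ _ fun z hz => (hb x hx z hz).1
  have h2 : ∑ y ∈ K2, (P y (escSet d K2)).toReal ≤
      ∑ y ∈ K2, (P y (escSet d (K1 ∪ K2))).toReal + K2.card * (K1.card * b) := by
    rw [← nsmul_eq_mul (K2.card), ← Finset.sum_const, ← Finset.sum_add_distrib]
    refine Finset.sum_le_sum fun x hx => (esc_diff hd hP K2 K1 x).trans ?_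
    rw [Finset.union_comm]
    gcongr
    rw [← nsmul_eq_mul]
    exact Finset.sum_le_card_nsmul _ _ _ fun z hz => (hb z hz x hx).2
  linarith

open Classical in
lemma both_bound {d : ℕ} (hd : 7 ≤ d) {P : Zd d → Measure (ℕ → Zd d)} (hP : IsSRW d P)
    (K1 K2 : Finset (Zd d)) (hdis : Disjoint K1 K2) (b : ℝ)
    (hb : ∀ x ∈ K1, ∀ z ∈ K2, ff (x - z) / ff (0 : Zd d) ≤ b ∧ ff (z - x) / ff (0 : Zd d) ≤ b) :
    ∃ m : {T // T ∈ (K1 ∪ K2).powerset} → ℝ, (∀ T, 0 ≤ m T) ∧ (∀ S ⊆ K1 ∪ K2,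
      (capa d P S).toReal = ∑ T, if Disjoint T.1 S then 0 else m T) ∧
      (∑ T, if ¬ Disjoint T.1 K1 ∧ ¬ Disjoint T.1 K2 then m T else 0) ≤ 2 * (K1.card * K2.card * b) := by
  obtain ⟨m, hm, h⟩ := cap_rep (by omega) hP (K1 ∪ K2)
  refine ⟨m, hm, h, ?_⟩
  have h1 := cap_diff hd hP K1 K2 hdis b hb
  rw [h _ Finset.subset_union_left, h _ Finset.subset_union_right, h _ (Finset.Subset.refl _)] at h1
  have h2 : (∑ T, if ¬ Disjoint T.1 K1 ∧ ¬ Disjoint T.1 K2 then m T else 0)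
    = (∑ T, if Disjoint T.1 K1 then 0 else m T) + (∑ T, if Disjoint T.1 K2 then 0 else m T)
      - (∑ T, if Disjoint T.1 (K1 ∪ K2) then 0 else m T) := by
    rw [← Finset.sum_add_distrib, ← Finset.sum_sub_distrib]
    refine Finset.sum_congr rfl fun T _ => ?_
    by_cases a : Disjoint T.1 K1 <;> by_cases b : Disjoint T.1 K2 <;> simp [a, b, Finset.disjoint_union_right]
  linarith
open Classical in
noncomputable def Yc {V ι : Type*} (T : ι → Finset V) (J : Finset ι) (b : ι → Bool) (z : V) : Bool :=
  decide (∀ i ∈ J, b i = true → z ∉ T i)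

noncomputable def bern (a : ℝ) : Measure Bool :=
  ENNReal.ofReal (1 - Real.exp (-a)) • Measure.dirac true + ENNReal.ofReal (Real.exp (-a)) • Measure.dirac false

lemma bern_prob {a : ℝ} (ha : 0 ≤ a) : IsProbabilityMeasure (bern a) := by
  constructor
  have : Real.exp (-a) ≤ 1 := Real.exp_le_one_iff.mpr (by linarith)
  simp [bern]
  rw [← ENNReal.ofReal_add (by linarith) (Real.exp_pos _).le]
  simp

lemma bern_false (a : ℝ) : bern a {false} = ENNReal.ofReal (Real.exp (-a)) := by
  simp [bern]

lemma bern_true (a : ℝ) : bern a {true} ≤ ENNReal.ofReal a := by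
  simp [bern]
  apply ENNReal.ofReal_le_ofReal
  have := Real.add_one_le_exp (-a)
  linarith

lemma law_eq {V Ω : Type*} [MeasurableSpace Ω] (K : Finset V) (Q : Measure (V → Bool)) [IsProbabilityMeasure Q]
    (μ : Measure Ω) [IsProbabilityMeasure μ] (Y : Ω → V → Bool) (hY : Measurable Y)
    (h : ∀ S ⊆ K, Q {ω | ∀ z ∈ S, ω z = true} = μ {b | ∀ z ∈ S, Y b z = true})
    (A : Set (V → Bool)) (hA : ∀ ω ω', (∀ z ∈ K, ω z = ω' z) → ω ∈ A → ω' ∈ A) :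
    Q A = μ (Y ⁻¹' A) := by
  classical
  let r : (V → Bool) → (K → Bool) := fun ω z => ω z
  have hr : Measurable r := measurable_pi_lambda _ fun z => measurable_pi_apply _
  have hA' : A = r ⁻¹' (r '' A) := by
    ext ω
    constructor
    · exact fun h => ⟨ω, h, rfl⟩
    · rintro ⟨ω', hω', he⟩
      exact hA ω' ω (fun z hz => congrFun he ⟨z, hz⟩) hω'
  have hms : MeasurableSet (r '' A) := (Set.toFinite _).measurableSet
  let C : Set (Set (K → Bool)) := {s | ∃ S : Finset K, s = {f | ∀ z ∈ S, f z = true}}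
  have hCms : ∀ S : Finset K, MeasurableSet {f : K → Bool | ∀ z ∈ S, f z = true} :=
    fun S => (Set.toFinite _).measurableSet
  have heq : Q.map r = μ.map (r ∘ Y) := by
    have : IsProbabilityMeasure (Q.map r) := Measure.isProbabilityMeasure_map hr.aemeasurable
    have : IsProbabilityMeasure (μ.map (r ∘ Y)) := Measure.isProbabilityMeasure_map (hr.comp hY).aemeasurable
    refine ext_of_generate_finite C ?_ ?_ ?_ ?_
    · apply le_antisymm
      · refine iSup_le fun z => ?_
        rw [← measurable_iff_comap_le]
        have hz : @MeasurableSet _ (MeasurableSpace.generateFrom C) {f : K → Bool | f z = true} := by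
          apply MeasurableSpace.measurableSet_generateFrom
          exact ⟨{z}, by simp⟩
        refine @measurable_to_bool _ (MeasurableSpace.generateFrom C) _ ?_
        exact hz
      · apply MeasurableSpace.generateFrom_le
        rintro s ⟨S, rfl⟩
        exact hCms S
    · rintro s ⟨S, rfl⟩ t ⟨S', rfl⟩ -
      refine ⟨S ∪ S', ?_⟩
      ext f
      simp only [Set.mem_inter_iff, Set.mem_ofPred_eq, Finset.mem_union]
      exact ⟨fun h z hz => hz.elim (h.1 z) (h.2 z), fun h => ⟨fun z hz => h z (Or.inl hz), fun z hz => h z (Or.inr hz)⟩⟩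
    · rintro s ⟨S, rfl⟩
      rw [Measure.map_apply hr (hCms S), Measure.map_apply (hr.comp hY) (hCms S)]
      have := h (S.image Subtype.val) (by
        intro z hz; obtain ⟨w, -, rfl⟩ := Finset.mem_image.mp hz; exact w.2)
      convert this using 2
      · ext ω; simp [r]
      · ext ω; simp [r]
    · simp
  calc Q A = Q.map r (r '' A) := by rw [Measure.map_apply hr hms, ← hA']
    _ = μ.map (r ∘ Y) (r '' A) := by rw [heq]
    _ = μ (Y ⁻¹' A) := by
      rw [Measure.map_apply (hr.comp hY) hms, Set.preimage_comp, ← hA']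

open Classical in
lemma decor {V ι : Type*} [Fintype ι] (Q : Measure (V → Bool)) [IsProbabilityMeasure Q] (K1 K2 : Finset V)
    (T : ι → Finset V) (m : ι → ℝ) (hm : ∀ i, 0 ≤ m i)
    (hQ : ∀ S ⊆ K1 ∪ K2, Q {ω | ∀ z ∈ S, ω z = true}
      = ENNReal.ofReal (Real.exp (-∑ i, if Disjoint (T i) S then 0 else m i)))
    (A1 A2 : Set (V → Bool))
    (h1 : ∀ ω ω', ω ∈ A1 → (∀ z ∈ K1, ω z = false → ω' z = false) → ω' ∈ A1)
    (h2 : ∀ ω ω', ω ∈ A2 → (∀ z ∈ K2, ω z = false → ω' z = false) → ω' ∈ A2) :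
    Q (A1 ∩ A2) ≤ Q A1 * Q A2
      + ENNReal.ofReal (∑ i, if ¬ Disjoint (T i) K1 ∧ ¬ Disjoint (T i) K2 then m i else 0) := by
  have : ∀ i, IsProbabilityMeasure (bern (m i)) := fun i => bern_prob (hm i)
  let μ : Measure (ι → Bool) := Measure.pi fun i => bern (m i)
  let Y := Yc T (Finset.univ : Finset ι)
  have hY : Measurable Y := measurable_of_finite _
  have hlaw : ∀ S ⊆ K1 ∪ K2, Q {ω | ∀ z ∈ S, ω z = true} = μ {b | ∀ z ∈ S, Y b z = true} := by
    intro S hS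
    rw [hQ S hS]
    have : {b | ∀ z ∈ S, Y b z = true} = Set.pi Set.univ
        (fun i => if Disjoint (T i) S then (Set.univ : Set Bool) else {false}) := by
      ext b
      simp only [Y, Yc, Set.mem_ofPred_eq, decide_eq_true_eq, Set.mem_pi, Set.mem_univ, true_implies, Finset.mem_univ]
      constructor
      · intro h i
        split_ifs with hd
        · trivial
        · obtain ⟨z, hz, hzS⟩ := Finset.not_disjoint_iff.mp hd
          have := h z hzS i
          by_contra hb
          have hb' : b i = true := by simpa using hb
          exact this hb' hz
      · intro h z hz i hb hzT
        have := h i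
        rw [if_neg (Finset.not_disjoint_iff.mpr ⟨z, hzT, hz⟩)] at this
        simp [hb] at this
    rw [this, Measure.pi_pi, ← Finset.sum_neg_distrib, Real.exp_sum,
      ENNReal.ofReal_prod_of_nonneg (fun _ _ => (Real.exp_pos _).le)]
    refine Finset.prod_congr rfl fun i _ => ?_
    split_ifs
    · rw [measure_univ]; simp
    · rw [bern_false]
  have hdep1 : ∀ ω ω', (∀ z ∈ K1 ∪ K2, ω z = ω' z) → ω ∈ A1 → ω' ∈ A1 := fun ω ω' h hω =>
    h1 ω ω' hω fun z hz hf => by rw [← h z (Finset.mem_union_left _ hz)]; exact hf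
  have hdep2 : ∀ ω ω', (∀ z ∈ K1 ∪ K2, ω z = ω' z) → ω ∈ A2 → ω' ∈ A2 := fun ω ω' h hω =>
    h2 ω ω' hω fun z hz hf => by rw [← h z (Finset.mem_union_right _ hz)]; exact hf
  rw [law_eq _ Q μ Y hY hlaw A1 hdep1, law_eq _ Q μ Y hY hlaw A2 hdep2,
    law_eq _ Q μ Y hY hlaw (A1 ∩ A2) (fun ω ω' h hω => ⟨hdep1 ω ω' h hω.1, hdep2 ω ω' h hω.2⟩)]
  let J1 : Finset ι := Finset.univ.filter fun i => Disjoint (T i) K2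
  let J2 : Finset ι := Finset.univ.filter fun i => ¬ Disjoint (T i) K2 ∧ Disjoint (T i) K1
  let J12 : Finset ι := Finset.univ.filter fun i => ¬ Disjoint (T i) K1 ∧ ¬ Disjoint (T i) K2
  have hJ : Disjoint J1 J2 := by
    rw [Finset.disjoint_left]
    intro i hi hi'
    exact (Finset.mem_filter.mp hi').2.1 (Finset.mem_filter.mp hi).2
  have hsub : Y ⁻¹' (A1 ∩ A2) ⊆ (Yc T J1 ⁻¹' A1 ∩ Yc T J2 ⁻¹' A2) ∪ ⋃ i ∈ J12, {b : ι → Bool | b i = true} := by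
    intro b hb
    by_cases hE : ∃ i ∈ J12, b i = true
    · right
      simp only [Set.mem_iUnion]
      obtain ⟨i, hi, h⟩ := hE
      exact ⟨i, hi, h⟩
    · left
      push Not at hE
      refine ⟨h1 _ _ hb.1 ?_, h2 _ _ hb.2 ?_⟩
      · intro z hz hf
        simp only [Y, Yc, decide_eq_false_iff_not, not_forall, Finset.mem_univ, true_implies] at hf ⊢
        obtain ⟨i, hi, hzi⟩ := hf
        refine ⟨i, ?_, ?_⟩
        · by_contra hh
          have : i ∈ J12 := by
            simp only [J1, J12, Finset.mem_filter, Finset.mem_univ, true_and] at hh ⊢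
            refine ⟨Finset.not_disjoint_iff.mpr ⟨z, by simpa using hzi, hz⟩, hh⟩
          exact hE i this hi
        · exact ⟨hi, hzi⟩
      · intro z hz hf
        simp only [Y, Yc, decide_eq_false_iff_not, not_forall, Finset.mem_univ, true_implies] at hf ⊢
        obtain ⟨i, hi, hzi⟩ := hf
        refine ⟨i, ?_, ?_⟩
        · by_contra hh
          have hd2 : ¬ Disjoint (T i) K2 := Finset.not_disjoint_iff.mpr ⟨z, by simpa using hzi, hz⟩
          have : i ∈ J12 := by
            simp only [J2, J12, Finset.mem_filter, Finset.mem_univ, true_and] at hh ⊢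
            tauto
          exact hE i this hi
        · exact ⟨hi, hzi⟩
  have hmono : ∀ J b z, Yc T J b z = false → Y b z = false := by
    intro J b z hf
    simp only [Y, Yc, decide_eq_false_iff_not, not_forall, Finset.mem_univ, true_implies] at hf ⊢
    obtain ⟨i, _, hi, hzi⟩ := hf
    exact ⟨i, hi, hzi⟩
  have hind : μ (Yc T J1 ⁻¹' A1 ∩ Yc T J2 ⁻¹' A2) = μ (Yc T J1 ⁻¹' A1) * μ (Yc T J2 ⁻¹' A2) := by
    have hi : ProbabilityTheory.iIndepFun (fun (i : ι) (b : ι → Bool) => b i) μ := by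
      exact ProbabilityTheory.iIndepFun_pi (X := fun i => (id : Bool → Bool)) (fun i => aemeasurable_id)
    have hi2 := hi.indepFun_finset J1 J2 hJ (fun i => measurable_pi_apply i)
    have hpre : ∀ (J : Finset ι) (A : Set (V → Bool)), Yc T J ⁻¹' A =
        (fun (b : ι → Bool) (i : J) => b i) ⁻¹' ((fun (b : ι → Bool) (i : J) => b i) '' (Yc T J ⁻¹' A)) := by
      intro J A
      ext b
      constructor
      · exact fun h => ⟨b, h, rfl⟩
      · rintro ⟨b', hb', he⟩
        have : Yc T J b = Yc T J b' := by
          funext z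
          unfold Yc
          congr 1
          apply propext
          refine forall_congr' fun i => forall_congr' fun hi => ?_
          have : b' i = b i := congrFun he ⟨i, hi⟩
          rw [this]
        show Yc T J b ∈ A
        rw [this]; exact hb'
    rw [hpre J1 A1, hpre J2 A2]
    exact hi2.measure_inter_preimage_eq_mul _ _ (Set.toFinite _).measurableSet (Set.toFinite _).measurableSet
  calc μ (Y ⁻¹' (A1 ∩ A2)) ≤ _ := measure_mono hsub
    _ ≤ _ := measure_union_le _ _
    _ ≤ _ := by
      rw [hind]
      gcongr
      · intro b hb; exact h1 _ _ hb fun z _ hf => hmono J1 b z hf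
      · intro b hb; exact h2 _ _ hb fun z _ hf => hmono J2 b z hf
      · refine (measure_biUnion_finset_le _ _).trans ?_
        rw [ENNReal.ofReal_sum_of_nonneg (fun i _ => by split_ifs; exacts [hm i, le_rfl])]
        rw [Finset.sum_filter]
        refine Finset.sum_le_sum fun i _ => ?_
        split_ifs
        · have : {b : ι → Bool | b i = true} = (fun b : ι → Bool => b i) ⁻¹' {true} := by ext b; simp
          rw [this]
          have hmp := measurePreserving_eval (fun i => bern (m i)) i
          exact (hmp.measure_preimage (MeasurableSet.singleton true).nullMeasurableSet).trans_le (bern_true _)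
        · exact zero_le
def sel (i1 i2 : ℤ) (c : ℕ) : ℤ := if c = 0 then i1 else i2

lemma mem_boxD {d L0 n : ℕ} {i1 i2 : ℤ} {z : Zd d} : z ∈ boxD d L0 n i1 i2 ↔ z ∈ planar d ∧
    ∀ c : Fin d, (c : ℕ) < 2 → sel i1 i2 c * (Lscale d L0 n : ℤ) ≤ z c ∧ z c < (sel i1 i2 c + 1) * (Lscale d L0 n : ℤ) := by
  unfold boxD
  simp only [Set.mem_ofPred_eq]
  refine and_congr_right fun _ => forall_congr' fun c => ?_
  constructor
  · rintro ⟨h0, h1⟩ hc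
    rcases (by omega : (c : ℕ) = 0 ∨ (c : ℕ) = 1) with h | h
    · simpa [sel, h] using h0 h
    · simpa [sel, h] using h1 h
  · intro h
    refine ⟨fun hc => ?_, fun hc => ?_⟩
    · simpa [sel, hc] using h (by omega)
    · simpa [sel, hc] using h (by omega)

lemma mem_boxDtil {d L0 n : ℕ} {i1 i2 : ℤ} {z : Zd d} : z ∈ boxDtil d L0 n i1 i2 ↔ z ∈ planar d ∧
    ∀ c : Fin d, (c : ℕ) < 2 → (sel i1 i2 c - 1) * (Lscale d L0 n : ℤ) ≤ z c ∧ z c < (sel i1 i2 c + 2) * (Lscale d L0 n : ℤ) := by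
  unfold boxDtil
  simp only [Set.mem_ofPred_eq]
  refine and_congr_right fun _ => forall_congr' fun c => ?_
  constructor
  · rintro ⟨h0, h1⟩ hc
    rcases (by omega : (c : ℕ) = 0 ∨ (c : ℕ) = 1) with h | h
    · simpa [sel, h] using h0 h
    · simpa [sel, h] using h1 h
  · intro h
    refine ⟨fun hc => ?_, fun hc => ?_⟩
    · simpa [sel, hc] using h (by omega)
    · simpa [sel, hc] using h (by omega)

lemma boxD_sub {d L0 n : ℕ} {i1 i2 : ℤ} {z : Zd d} (h : z ∈ boxD d L0 n i1 i2) : z ∈ boxDtil d L0 n i1 i2 := by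
  rw [mem_boxD] at h
  rw [mem_boxDtil]
  refine ⟨h.1, fun c hc => ?_⟩
  have := h.2 c hc
  have hL : (0 : ℤ) ≤ Lscale d L0 n := by positivity
  constructor <;> nlinarith

lemma cross_of_path {d L0 n : ℕ} {j1 j2 : ℤ} (ω : Zd d → Bool) (len : ℕ) (γ : ℕ → Zd d)
    (h0 : γ 0 ∈ boxD d L0 n j1 j2) (hocc : ∀ k ≤ len, γ k ∈ planar d ∧ ω (γ k) = false)
    (hadj : ∀ k < len, adjStar (γ (k + 1)) (γ k)) (hout : ∃ k, k ≤ len ∧ γ k ∉ boxDtil d L0 n j1 j2) :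
    ω ∈ crossStarEvent d L0 n j1 j2 := by
  classical
  have hf := Nat.find_spec hout
  have hmin := fun {m} => Nat.find_min hout (m := m)
  obtain ⟨e, he⟩ : ∃ e, Nat.find hout = e + 1 := by
    apply Nat.exists_eq_succ_of_ne_zero
    intro h
    rw [h] at hf
    exact hf.2 (boxD_sub h0)
  rw [he] at hf hmin
  have hin : ∀ k ≤ e, γ k ∈ boxDtil d L0 n j1 j2 := by
    intro k hk
    have := hmin (m := k) (by omega)
    by_contra hh
    exact this ⟨by omega, hh⟩
  refine ⟨e, γ, h0, ⟨hin e le_rfl, ?_⟩, fun k hk => ⟨hin k hk, (hocc k (by omega)).2⟩, fun k hk => hadj k (by omega)⟩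
  have hD := mem_boxDtil.mp (hin e le_rfl)
  have hA := (hadj e (by omega)).2
  have : ∃ c : Fin d, ∃ hc : (c : ℕ) < 2, ¬ ((sel j1 j2 c - 1) * (Lscale d L0 n : ℤ) ≤ γ (e + 1) c ∧
      γ (e + 1) c < (sel j1 j2 c + 2) * (Lscale d L0 n : ℤ)) := by
    by_contra hcon
    push Not at hcon
    exact hf.2 (mem_boxDtil.mpr ⟨(hocc _ hf.1).1, fun c hc => ⟨(hcon c hc).1, (hcon c hc).2⟩⟩)
  obtain ⟨c, hc, hviol⟩ := this
  have hDc := hD.2 c hc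
  have hAc := hA c
  have hpl : ∀ b : Bool, γ e + stp (c, b) ∈ planar d := by
    intro b j hj
    have hne : j ≠ c := fun h => by subst h; omega
    have := hD.1 j hj
    simp [stp, Pi.single_eq_of_ne hne, this]
  by_cases hlow : (sel j1 j2 c - 1) * (Lscale d L0 n : ℤ) ≤ γ (e + 1) c
  · refine ⟨γ e + stp (c, true), hpl _, adj_stp _ _, fun hy => ?_⟩
    have := (mem_boxDtil.mp hy).2 c hc
    simp [stp] at this
    apply hviol
    refine ⟨hlow, ?_⟩
    omega
  · refine ⟨γ e + stp (c, false), hpl _, adj_stp _ _, fun hy => ?_⟩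
    have := (mem_boxDtil.mp hy).2 c hc
    simp [stp] at this
    omega

def farBox (d L0 n : ℕ) (p : (ℤ × ℤ) × (ℤ × ℤ)) : Prop :=
  ∀ x ∈ boxDtil d L0 n p.1.1 p.1.2, ∀ z ∈ boxDtil d L0 n p.2.1 p.2.2, ∃ c : Fin d,
    (Lscale d L0 (n + 1) : ℤ) ≤ 2 * |x c - z c|

lemma vtil_coord {d L0 n : ℕ} {i1 i2 : ℤ} {z : Zd d} (h : z ∈ boxVtil d L0 n i1 i2) :
    ∃ c : Fin d, (c : ℕ) < 2 ∧ (z c ≤ (sel i1 i2 c - 1) * (Lscale d L0 n : ℤ) ∨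
      (sel i1 i2 c + 2) * (Lscale d L0 n : ℤ) - 1 ≤ z c) := by
  obtain ⟨hz, y, hy, hadj, hyn⟩ := h
  by_contra hcon
  push Not at hcon
  apply hyn
  rw [mem_boxDtil]
  refine ⟨hy, fun c hc => ?_⟩
  have h1 := hcon c hc
  have h2 : (y c - z c).natAbs ≤ 1 := by
    rw [← hadj]
    exact Finset.single_le_sum (f := fun i => (y i - z i).natAbs) (fun _ _ => Nat.zero_le _) (Finset.mem_univ c)
  omega

lemma Lscale_succ (d L0 n : ℕ) : Lscale d L0 (n + 1) = ellScale d L0 n * Lscale d L0 n := rfl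

lemma geom {d L0 n : ℕ} (hd : 2 ≤ d) (hL : 0 < Lscale d L0 n) (hl : 8 ≤ ellScale d L0 n) (i1 i2 : ℤ)
    {ω : Zd d → Bool} (h : ω ∈ crossStarEvent d L0 (n + 1) i1 i2) :
    ∃ p : (ℤ × ℤ) × (ℤ × ℤ),
      p ∈ ((Finset.Ico (i1 * ellScale d L0 n) ((i1 + 1) * ellScale d L0 n) ×ˢ
            Finset.Ico (i2 * ellScale d L0 n) ((i2 + 1) * ellScale d L0 n)) ×ˢ
          (Finset.Ico ((i1 - 1) * ellScale d L0 n) ((i1 + 2) * ellScale d L0 n) ×ˢ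
            Finset.Ico ((i2 - 1) * ellScale d L0 n) ((i2 + 2) * ellScale d L0 n)) : Finset _)
      ∧ farBox d L0 n p ∧ ω ∈ crossStarEvent d L0 n p.1.1 p.1.2 ∩ crossStarEvent d L0 n p.2.1 p.2.2 := by
  obtain ⟨len, γ, h0, hV, hocc, hadj⟩ := h
  have hLz : (0 : ℤ) < Lscale d L0 n := by exact_mod_cast hL
  have hsucc : (Lscale d L0 (n + 1) : ℤ) = ellScale d L0 n * Lscale d L0 n := by
    rw [Lscale_succ]; push_cast; rfl
  have h8 : 8 * (Lscale d L0 n : ℤ) ≤ Lscale d L0 (n + 1) := by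
    rw [hsucc]
    have : (8 : ℤ) ≤ ellScale d L0 n := by exact_mod_cast hl
    nlinarith
  obtain ⟨c0, hc0, hvc⟩ := vtil_coord hV
  let a0 : Fin d := ⟨0, by omega⟩
  let a1 : Fin d := ⟨1, by omega⟩
  have hb0 := mem_boxD.mp h0
  have hbl := mem_boxDtil.mp hV.1
  -- index of a point
  have hself : ∀ z : Zd d, z ∈ planar d → ∀ c : Fin d, (c : ℕ) < 2 →
      sel (z a0 / Lscale d L0 n) (z a1 / Lscale d L0 n) c * (Lscale d L0 n : ℤ) ≤ z c ∧
      z c < (sel (z a0 / Lscale d L0 n) (z a1 / Lscale d L0 n) c + 1) * (Lscale d L0 n : ℤ) := by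
    intro z _ c hc
    have e : sel (z a0 / Lscale d L0 n) (z a1 / Lscale d L0 n) c = z c / Lscale d L0 n := by
      rcases (by omega : (c : ℕ) = 0 ∨ (c : ℕ) = 1) with h | h
      · have : c = a0 := Fin.ext h
        subst this; simp [sel, a0]
      · have : c = a1 := Fin.ext h
        subst this; simp [sel, a1]
    rw [e]
    exact ⟨Int.ediv_mul_le _ hLz.ne', Int.lt_ediv_add_one_mul_self _ hLz⟩
  have hclose : ∀ z : Zd d, z ∈ planar d → ∀ x ∈ boxDtil d L0 n (z a0 / Lscale d L0 n) (z a1 / Lscale d L0 n),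
      ∀ c : Fin d, (c : ℕ) < 2 → |x c - z c| < 2 * (Lscale d L0 n : ℤ) := by
    intro z hz x hx c hc
    have h1 := hself z hz c hc
    have h2 := (mem_boxDtil.mp hx).2 c hc
    rw [abs_lt]
    constructor <;> linarith
  have hfar0 : (Lscale d L0 (n + 1) : ℤ) ≤ |γ 0 c0 - γ len c0| := by
    have h1 := hb0.2 c0 hc0
    rw [le_abs]
    rcases hvc with h | h
    · left; linarith
    · right; linarith
  have hmemD : ∀ z : Zd d, z ∈ planar d → z ∈ boxD d L0 n (z a0 / Lscale d L0 n) (z a1 / Lscale d L0 n) :=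
    fun z hz => mem_boxD.mpr ⟨hz, hself z hz⟩
  refine ⟨((γ 0 a0 / Lscale d L0 n, γ 0 a1 / Lscale d L0 n), (γ len a0 / Lscale d L0 n, γ len a1 / Lscale d L0 n)),
    ?_, ?_, ?_, ?_⟩
  · have p0 := hb0.2 a0 (by simp [a0])
    have p1 := hb0.2 a1 (by simp [a1])
    have q0 := hbl.2 a0 (by simp [a0])
    have q1 := hbl.2 a1 (by simp [a1])
    simp only [sel, a0, a1, hsucc, if_true, one_ne_zero, if_false, ← mul_assoc] at p0 p1 q0 q1
    simp only [Finset.mem_product, Finset.mem_Ico, Int.le_ediv_iff_mul_le hLz, Int.ediv_lt_iff_lt_mul hLz]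
    exact ⟨⟨p0, p1⟩, q0, q1⟩
  · intro x hx z hz
    refine ⟨c0, ?_⟩
    have h1 := hclose _ hb0.1 x hx c0 hc0
    have h2 := hclose _ hbl.1 z hz c0 hc0
    have h3 : |γ 0 c0 - γ len c0| ≤ |x c0 - γ 0 c0| + |x c0 - z c0| + |z c0 - γ len c0| := by
      have e : γ 0 c0 - γ len c0 = -(x c0 - γ 0 c0) + (x c0 - z c0) + (z c0 - γ len c0) := by ring
      rw [e]
      refine (abs_add_le _ _).trans ?_
      gcongr
      refine (abs_add_le _ _).trans ?_
      rw [abs_neg]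
    linarith
  · refine cross_of_path ω len γ (hmemD _ hb0.1) (fun k hk => ⟨(mem_boxDtil.mp (hocc k hk).1).1, (hocc k hk).2⟩)
      hadj ⟨len, le_rfl, fun hx => ?_⟩
    have h1 := hclose _ hb0.1 _ hx c0 hc0
    rw [abs_sub_comm] at h1
    linarith
  · refine cross_of_path ω len (fun k => γ (len - k)) (by simpa using hmemD _ hbl.1)
      (fun k hk => ⟨(mem_boxDtil.mp (hocc _ (Nat.sub_le _ _)).1).1, (hocc _ (Nat.sub_le _ _)).2⟩)
      ?_ ⟨len, le_rfl, fun hx => ?_⟩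
    · intro k hk
      have := hadj (len - (k + 1)) (by omega)
      have e : len - (k + 1) + 1 = len - k := by omega
      rw [e] at this
      refine ⟨this.1.symm, fun i => ?_⟩
      have := this.2 i
      omega
    · simp only [Nat.sub_self] at hx
      have h1 := hclose _ hbl.1 _ hx c0 hc0
      linarith

open Classical in
noncomputable def Kbox (d L0 n : ℕ) (i1 i2 : ℤ) : Finset (Zd d) :=
  ((Finset.Ico ((i1 - 1) * (Lscale d L0 n : ℤ)) ((i1 + 2) * Lscale d L0 n)) ×ˢ
    (Finset.Ico ((i2 - 1) * (Lscale d L0 n : ℤ)) ((i2 + 2) * Lscale d L0 n))).image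
    fun q j => if (j : ℕ) = 0 then q.1 else if (j : ℕ) = 1 then q.2 else 0

lemma Kbox_card (d L0 n : ℕ) (i1 i2 : ℤ) : (Kbox d L0 n i1 i2).card ≤ 9 * (Lscale d L0 n) ^ 2 := by
  classical
  unfold Kbox
  refine Finset.card_image_le.trans ?_
  rw [Finset.card_product, Int.card_Ico, Int.card_Ico]
  have e1 : (i1 + 2) * (Lscale d L0 n : ℤ) - (i1 - 1) * Lscale d L0 n = ((3 * Lscale d L0 n : ℕ) : ℤ) := by
    push_cast; ring
  have e2 : (i2 + 2) * (Lscale d L0 n : ℤ) - (i2 - 1) * Lscale d L0 n = ((3 * Lscale d L0 n : ℕ) : ℤ) := by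
    push_cast; ring
  rw [e1, e2, Int.toNat_natCast]
  apply le_of_eq; ring

lemma mem_Kbox {d L0 n : ℕ} (hd : 2 ≤ d) {i1 i2 : ℤ} {z : Zd d} :
    z ∈ Kbox d L0 n i1 i2 ↔ z ∈ boxDtil d L0 n i1 i2 := by
  classical
  rw [mem_boxDtil]
  unfold Kbox
  simp only [Finset.mem_image, Finset.mem_product, Finset.mem_Ico, Prod.exists]
  constructor
  · rintro ⟨a, b, ⟨ha, hb⟩, rfl⟩
    refine ⟨fun j hj => ?_, fun c hc => ?_⟩
    · simp only
      rw [if_neg (by omega), if_neg (by omega)]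
    · rcases (by omega : (c : ℕ) = 0 ∨ (c : ℕ) = 1) with h | h
      · simpa [sel, h] using ha
      · simpa [sel, h] using hb
  · rintro ⟨hp, h⟩
    have h0 := h ⟨0, by omega⟩ (by simp)
    have h1 := h ⟨1, by omega⟩ (by simp)
    simp [sel] at h0 h1
    refine ⟨z ⟨0, by omega⟩, z ⟨1, by omega⟩, ⟨h0, h1⟩, ?_⟩
    funext j
    split_ifs with a b
    · congr 1; exact Fin.ext a.symm
    · congr 1; exact Fin.ext b.symm
    · exact (hp j (by omega)).symm
lemma ff_far {d : ℕ} (x : Zd d) (c : Fin d) (r : ℝ) (hr : 0 < r) (h : r ≤ 2 * |(x c : ℝ)|) :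
    ff x / ff (0 : Zd d) ≤ (1600 : ℝ) ^ (23 / 10 : ℝ) * r ^ (-(46 / 10) : ℝ) := by
  have hx : (x c : ℝ) ^ 2 ≤ nsq x :=
    Finset.single_le_sum (f := fun i => (x i : ℝ) ^ 2) (fun _ _ => sq_nonneg _) (Finset.mem_univ c)
  have h1 : r ^ 2 / 4 ≤ nsq x + 400 := by
    have : (x c : ℝ) ^ 2 = |(x c : ℝ)| ^ 2 := (sq_abs _).symm
    nlinarith
  have h2 : ff x ≤ (r ^ 2 / 4) ^ (-(23 / 10) : ℝ) := by
    unfold ff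
    exact Real.rpow_le_rpow_of_nonpos (by positivity) h1 (by norm_num)
  have h3 : ff (0 : Zd d) = (400 : ℝ) ^ (-(23 / 10) : ℝ) := by simp [ff, nsq]
  rw [h3]
  calc ff x / (400 : ℝ) ^ (-(23 / 10) : ℝ) ≤ (r ^ 2 / 4) ^ (-(23 / 10) : ℝ) / (400 : ℝ) ^ (-(23 / 10) : ℝ) := by
        gcongr
    _ = (r ^ 2 / 1600) ^ (-(23 / 10) : ℝ) := by
        rw [← Real.div_rpow (by positivity) (by norm_num)]; congr 1; ring
    _ = (1600 : ℝ) ^ (23 / 10 : ℝ) * (r ^ 2) ^ (-(23 / 10) : ℝ) := by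
        rw [Real.div_rpow (by positivity) (by norm_num), Real.rpow_neg (by norm_num : (0:ℝ) ≤ 1600), div_inv_eq_mul, mul_comm]
    _ = _ := by
        rw [← Real.rpow_natCast r 2, ← Real.rpow_mul hr.le]; norm_num

lemma cross_mono {d L0 n : ℕ} (hd : 2 ≤ d) (i1 i2 : ℤ) (ω ω' : Zd d → Bool) (h : ω ∈ crossStarEvent d L0 n i1 i2)
    (hh : ∀ z ∈ Kbox d L0 n i1 i2, ω z = false → ω' z = false) : ω' ∈ crossStarEvent d L0 n i1 i2 := by
  obtain ⟨len, γ, h0, hV, hocc, hadj⟩ := h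
  exact ⟨len, γ, h0, hV, fun k hk => ⟨(hocc k hk).1, hh _ ((mem_Kbox hd).mpr (hocc k hk).1) (hocc k hk).2⟩, hadj⟩

lemma decor_inst {V ι : Type*} [Fintype ι] [DecidableEq V] (Q : Measure (V → Bool)) [IsProbabilityMeasure Q] (K1 K2 : Finset V)
    (T : ι → Finset V) (m : ι → ℝ) (hm : ∀ i, 0 ≤ m i)
    (hQ : ∀ S ⊆ K1 ∪ K2, Q {ω | ∀ z ∈ S, ω z = true}
      = ENNReal.ofReal (Real.exp (-∑ i, if Disjoint (T i) S then 0 else m i)))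
    (A1 A2 : Set (V → Bool))
    (h1 : ∀ ω ω', ω ∈ A1 → (∀ z ∈ K1, ω z = false → ω' z = false) → ω' ∈ A1)
    (h2 : ∀ ω ω', ω ∈ A2 → (∀ z ∈ K2, ω z = false → ω' z = false) → ω' ∈ A2) :
    Q (A1 ∩ A2) ≤ Q A1 * Q A2
      + ENNReal.ofReal (∑ i, if ¬ Disjoint (T i) K1 ∧ ¬ Disjoint (T i) K2 then m i else 0) := by
  have := decor Q K1 K2 T m hm (by
    intro S hS
    convert hQ S (by convert hS)) A1 A2 h1 h2
  convert this

lemma arith_cards (x y b L : ℝ) (hx : 0 ≤ x) (hy : 0 ≤ y) (hb : 0 ≤ b) (c1 : x ≤ 9 * L ^ 2) (c2 : y ≤ 9 * L ^ 2) :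
    2 * (x * y * b) ≤ 162 * L ^ 4 * b := by
  have h : x * y ≤ (9 * L ^ 2) * (9 * L ^ 2) := mul_le_mul c1 c2 hy (by positivity)
  have := mul_le_mul_of_nonneg_right h hb
  nlinarith

set_option maxHeartbeats 1000000 in
lemma pair_bound {d L0 n : ℕ} (hd : 7 ≤ d) {P : Zd d → Measure (ℕ → Zd d)} (hP : IsSRW d P)
    {u : ℝ} (hu : 0 ≤ u) {Q : Measure (Zd d → Bool)} (hQ : IsVacantLaw d P u Q)
    (hL' : 0 < Lscale d L0 (n + 1)) (p : (ℤ × ℤ) × (ℤ × ℤ)) (hp : farBox d L0 n p) (q : ℝ)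
    (hq : ∀ j1 j2, (Q (crossStarEvent d L0 n j1 j2)).toReal ≤ q) :
    (Q (crossStarEvent d L0 n p.1.1 p.1.2 ∩ crossStarEvent d L0 n p.2.1 p.2.2)).toReal
      ≤ q ^ 2 + u * (162 * (Lscale d L0 n : ℝ) ^ 4 *
        ((1600 : ℝ) ^ (23 / 10 : ℝ) * (Lscale d L0 (n + 1) : ℝ) ^ (-(46 / 10) : ℝ))) := by
  have hd2 : 2 ≤ d := by omega
  have := hQ.1
  have hLr : (0 : ℝ) < Lscale d L0 (n + 1) := by exact_mod_cast hL'
  set K1 := Kbox d L0 n p.1.1 p.1.2 with hK1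
  set K2 := Kbox d L0 n p.2.1 p.2.2 with hK2
  set b := (1600 : ℝ) ^ (23 / 10 : ℝ) * (Lscale d L0 (n + 1) : ℝ) ^ (-(46 / 10) : ℝ) with hb
  have hb0 : 0 ≤ b := by positivity
  have hfar : ∀ x ∈ K1, ∀ z ∈ K2, ∃ c : Fin d, (Lscale d L0 (n + 1) : ℤ) ≤ 2 * |x c - z c| :=
    fun x hx z hz => hp x ((mem_Kbox hd2).mp hx) z ((mem_Kbox hd2).mp hz)
  have hdis : Disjoint K1 K2 := by
    rw [Finset.disjoint_left]
    intro x hx hz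
    obtain ⟨c, hc⟩ := hfar x hx x hz
    simp at hc
    omega
  obtain ⟨m, hm, hcap, hboth⟩ := both_bound hd hP K1 K2 hdis b (by
    intro x hx z hz
    obtain ⟨c, hc⟩ := hfar x hx z hz
    have hc' : (Lscale d L0 (n + 1) : ℝ) ≤ 2 * |((x c - z c : ℤ) : ℝ)| := by exact_mod_cast hc
    refine ⟨ff_far (x - z) c _ hLr hc', ff_far (z - x) c _ hLr ?_⟩
    refine hc'.trans_eq ?_
    rw [Pi.sub_apply]; push_cast; rw [abs_sub_comm])
  have hdec := decor_inst Q K1 K2 (fun T : {T // T ∈ (K1 ∪ K2).powerset} => T.1) (fun T => u * m T)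
    (fun T => mul_nonneg hu (hm T)) (by
      intro S hS
      rw [hQ.2 S, hcap S hS, Finset.mul_sum]
      refine congrArg (fun r : ℝ => ENNReal.ofReal (Real.exp (-r))) ?_
      refine Finset.sum_congr rfl fun T _ => ?_
      split_ifs <;> simp)
    (crossStarEvent d L0 n p.1.1 p.1.2) (crossStarEvent d L0 n p.2.1 p.2.2)
    (fun ω ω' => cross_mono hd2 _ _ ω ω') (fun ω ω' => cross_mono hd2 _ _ ω ω')
  have h1 := ENNReal.toReal_mono (by finiteness) hdec
  rw [ENNReal.toReal_add (by finiteness) (by finiteness), ENNReal.toReal_mul] at h1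
  refine h1.trans ?_
  rw [sq]
  have hq0 : 0 ≤ q := ENNReal.toReal_nonneg.trans (hq 0 0)
  have e : (∑ T : {T // T ∈ (K1 ∪ K2).powerset}, if ¬ Disjoint T.1 K1 ∧ ¬ Disjoint T.1 K2 then u * m T else 0)
     = u * ∑ T : {T // T ∈ (K1 ∪ K2).powerset}, if ¬ Disjoint T.1 K1 ∧ ¬ Disjoint T.1 K2 then m T else 0 := by
    rw [Finset.mul_sum]
    refine Finset.sum_congr rfl fun T _ => ?_
    split_ifs <;> simp
  rw [e]
  have hs0 : 0 ≤ ∑ T : {T // T ∈ (K1 ∪ K2).powerset}, if ¬ Disjoint T.1 K1 ∧ ¬ Disjoint T.1 K2 then m T else 0 :=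
    Finset.sum_nonneg fun T _ => by split_ifs; exacts [hm T, le_rfl]
  rw [ENNReal.toReal_ofReal (mul_nonneg hu hs0)]
  gcongr
  · exact hq _ _
  · exact hq _ _
  · refine hboth.trans ?_
    have c1 : (K1.card : ℝ) ≤ 9 * (Lscale d L0 n : ℝ) ^ 2 := by exact_mod_cast Kbox_card d L0 n _ _
    have c2 : (K2.card : ℝ) ≤ 9 * (Lscale d L0 n : ℝ) ^ 2 := by exact_mod_cast Kbox_card d L0 n _ _
    exact arith_cards _ _ _ _ (Nat.cast_nonneg _) (Nat.cast_nonneg _) hb0 c1 c2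

lemma step_bound {d L0 n : ℕ} (hd : 7 ≤ d) {P : Zd d → Measure (ℕ → Zd d)} (hP : IsSRW d P)
    {u : ℝ} (hu : 0 ≤ u) {Q : Measure (Zd d → Bool)} (hQ : IsVacantLaw d P u Q)
    (hL : 0 < Lscale d L0 n) (hl : 8 ≤ ellScale d L0 n) (q : ℝ)
    (hq : ∀ j1 j2, (Q (crossStarEvent d L0 n j1 j2)).toReal ≤ q) (i1 i2 : ℤ) :
    (Q (crossStarEvent d L0 (n + 1) i1 i2)).toReal
      ≤ 9 * (ellScale d L0 n : ℝ) ^ 4 * (q ^ 2 + u * (162 * (Lscale d L0 n : ℝ) ^ 4 *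
        ((1600 : ℝ) ^ (23 / 10 : ℝ) * (Lscale d L0 (n + 1) : ℝ) ^ (-(46 / 10) : ℝ)))) := by
  classical
  have := hQ.1
  have hL' : 0 < Lscale d L0 (n + 1) := by rw [Lscale_succ]; exact Nat.mul_pos (by omega) hL
  set R := (q ^ 2 + u * (162 * (Lscale d L0 n : ℝ) ^ 4 *
        ((1600 : ℝ) ^ (23 / 10 : ℝ) * (Lscale d L0 (n + 1) : ℝ) ^ (-(46 / 10) : ℝ)))) with hR
  have hR0 : 0 ≤ R := by positivity
  set F : Finset ((ℤ × ℤ) × (ℤ × ℤ)) := ((Finset.Ico (i1 * ellScale d L0 n) ((i1 + 1) * ellScale d L0 n) ×ˢ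
            Finset.Ico (i2 * ellScale d L0 n) ((i2 + 1) * ellScale d L0 n)) ×ˢ
          (Finset.Ico ((i1 - 1) * ellScale d L0 n) ((i1 + 2) * ellScale d L0 n) ×ˢ
            Finset.Ico ((i2 - 1) * ellScale d L0 n) ((i2 + 2) * ellScale d L0 n)) : Finset _) with hF
  have hcard : F.card = 9 * (ellScale d L0 n) ^ 4 := by
    have e1 : ∀ i : ℤ, ((i + 1) * (ellScale d L0 n : ℤ) - i * ellScale d L0 n).toNat = ellScale d L0 n := by
      intro i; rw [show (i + 1) * (ellScale d L0 n : ℤ) - i * ellScale d L0 n = ellScale d L0 n by ring]; simp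
    have e2 : ∀ i : ℤ, ((i + 2) * (ellScale d L0 n : ℤ) - (i - 1) * ellScale d L0 n).toNat = 3 * ellScale d L0 n := by
      intro i
      rw [show (i + 2) * (ellScale d L0 n : ℤ) - (i - 1) * ellScale d L0 n = ((3 * ellScale d L0 n : ℕ) : ℤ) by push_cast; ring,
        Int.toNat_natCast]
    rw [hF]
    simp only [Finset.card_product, Int.card_Ico, e1, e2]
    ring
  set G := F.filter (farBox d L0 n) with hG
  have hsub : crossStarEvent d L0 (n + 1) i1 i2 ⊆ ⋃ p ∈ G,
      (crossStarEvent d L0 n p.1.1 p.1.2 ∩ crossStarEvent d L0 n p.2.1 p.2.2) := by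
    intro ω hω
    obtain ⟨p, hpF, hpf, hpω⟩ := geom (by omega) hL hl i1 i2 hω
    simp only [Set.mem_iUnion]
    exact ⟨p, Finset.mem_filter.mpr ⟨hpF, hpf⟩, hpω⟩
  have h1 := (measure_mono hsub).trans (measure_biUnion_finset_le (μ := Q) G _)
  have hfin : ∀ p ∈ G, Q (crossStarEvent d L0 n p.1.1 p.1.2 ∩ crossStarEvent d L0 n p.2.1 p.2.2) ≠ ⊤ := by
    intro p _; finiteness
  have h2 := ENNReal.toReal_mono (by rw [ENNReal.sum_ne_top]; exact hfin) h1
  rw [ENNReal.toReal_sum hfin] at h2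
  refine h2.trans ((Finset.sum_le_card_nsmul _ _ R fun p hp =>
    pair_bound hd hP hu hQ hL' p (Finset.mem_filter.mp hp).2 q hq).trans ?_)
  rw [nsmul_eq_mul]
  gcongr
  have : G.card ≤ 9 * (ellScale d L0 n) ^ 4 := hcard ▸ Finset.card_filter_le _ _
  exact_mod_cast this

lemma base_bound {d L0 : ℕ} (hd : 7 ≤ d) {P : Zd d → Measure (ℕ → Zd d)} (hP : IsSRW d P)
    {u : ℝ} (hu : 0 ≤ u) {Q : Measure (Zd d → Bool)} (hQ : IsVacantLaw d P u Q) (i1 i2 : ℤ) :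
    (Q (crossStarEvent d L0 0 i1 i2)).toReal ≤ 9 * (L0 : ℝ) ^ 2 * u := by
  have := hQ.1
  have hsite : ∀ z : Zd d, Q {ω | ω z = false} ≤ ENNReal.ofReal u := by
    intro z
    have h1 := hQ.2 {z}
    have hc : (capa d P {z}).toReal ≤ 1 := by
      rw [capa_real hP, Finset.sum_singleton]
      have := hP.1 z
      exact measureReal_le_one
    have hset : {ω : Zd d → Bool | ω z = false} = {ω | ∀ y ∈ ({z} : Finset (Zd d)), ω y = true}ᶜ := by
      ext ω; simp
    have hms : MeasurableSet {ω : Zd d → Bool | ∀ y ∈ ({z} : Finset (Zd d)), ω y = true} := by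
      have : {ω : Zd d → Bool | ∀ y ∈ ({z} : Finset (Zd d)), ω y = true} = (fun ω : Zd d → Bool => ω z) ⁻¹' {true} := by
        ext ω; simp
      rw [this]
      exact measurable_pi_apply z (MeasurableSet.singleton _)
    rw [hset, prob_compl_eq_one_sub hms, h1, ← ENNReal.ofReal_one, ← ENNReal.ofReal_sub _ (Real.exp_pos _).le]
    apply ENNReal.ofReal_le_ofReal
    have := Real.add_one_le_exp (-(u * (capa d P {z}).toReal))
    nlinarith
  have hsub : crossStarEvent d L0 0 i1 i2 ⊆ ⋃ z ∈ Kbox d L0 0 i1 i2, {ω | ω z = false} := by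
    rintro ω ⟨len, γ, h0, hV, hocc, hadj⟩
    simp only [Set.mem_iUnion]
    exact ⟨γ 0, (mem_Kbox (by omega)).mpr (hocc 0 (Nat.zero_le _)).1, (hocc 0 (Nat.zero_le _)).2⟩
  have h1 := (measure_mono hsub).trans (measure_biUnion_finset_le (μ := Q) _ _)
  have h2 := h1.trans (Finset.sum_le_card_nsmul _ _ _ fun z _ => hsite z)
  have h3 := ENNReal.toReal_mono (by rw [nsmul_eq_mul]; finiteness) h2
  rw [nsmul_eq_mul, ENNReal.toReal_mul, ENNReal.toReal_ofReal hu, ENNReal.toReal_natCast] at h3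
  refine h3.trans ?_
  gcongr
  exact_mod_cast Kbox_card d L0 0 i1 i2

lemma arith_step (a L L' l' C : ℝ) (ha0 : 0 ≤ a) (ha : a ≤ 1 / 700) (hL : 1 ≤ L) (hLL : L ≤ L')
    (hL' : L' ≤ 100 * L ^ (1 + a)) (hl0 : 0 ≤ l') (hl' : l' ≤ 100 * L' ^ a) (hC : 0 ≤ C)
    (hbig : (9000000 + 14580000 * C) * L ^ (-(9 / 100) : ℝ) ≤ 1) :
    l' ^ 2 * (9 * L⁻¹ + 1458 * C * L' ^ (-(6 / 10) : ℝ)) ≤ L' ^ (-(1 / 2) : ℝ) := by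
  have hLp : 0 < L := by linarith
  have hL'1 : 1 ≤ L' := hL.trans hLL
  have hL'p : 0 < L' := by linarith
  have h1 : l' ^ 2 ≤ 10000 * L' ^ (1 / 100 : ℝ) := by
    calc l' ^ 2 ≤ (100 * L' ^ a) ^ 2 := by gcongr
      _ = 10000 * L' ^ (a * 2) := by
          rw [mul_pow, ← Real.rpow_natCast (L' ^ a) 2, ← Real.rpow_mul hL'p.le]; norm_num
      _ ≤ 10000 * L' ^ (1 / 100 : ℝ) := by
          gcongr
          · linarith
  have h2 : L' ^ (51 / 100 : ℝ) ≤ 100 * L ^ (6 / 10 : ℝ) := by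
    calc L' ^ (51 / 100 : ℝ) ≤ (100 * L ^ (1 + a)) ^ (51 / 100 : ℝ) := by gcongr
      _ = 100 ^ (51 / 100 : ℝ) * L ^ ((1 + a) * (51 / 100)) := by
          rw [Real.mul_rpow (by norm_num) (by positivity), ← Real.rpow_mul hLp.le]
      _ ≤ 100 ^ (1 : ℝ) * L ^ (6 / 10 : ℝ) := by
          gcongr
          · norm_num
          · norm_num
          · linarith
      _ = _ := by rw [Real.rpow_one]
  have e1 : L' ^ (1 / 100 : ℝ) = L' ^ (51 / 100 : ℝ) * L' ^ (-(1 / 2) : ℝ) := by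
    rw [← Real.rpow_add hL'p]; norm_num
  have e2 : L' ^ (1 / 100 : ℝ) * L' ^ (-(6 / 10) : ℝ) = L' ^ (-(9 / 100) : ℝ) * L' ^ (-(1 / 2) : ℝ) := by
    rw [← Real.rpow_add hL'p, ← Real.rpow_add hL'p]; norm_num
  have e3 : L ^ (6 / 10 : ℝ) * L⁻¹ ≤ L ^ (-(9 / 100) : ℝ) := by
    rw [← Real.rpow_neg_one, ← Real.rpow_add hLp]
    apply Real.rpow_le_rpow_of_exponent_le hL; norm_num
  have e4 : L' ^ (-(9 / 100) : ℝ) ≤ L ^ (-(9 / 100) : ℝ) :=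
    Real.rpow_le_rpow_of_nonpos hLp hLL (by norm_num)
  have hH : 0 ≤ L' ^ (-(1 / 2) : ℝ) := by positivity
  calc l' ^ 2 * (9 * L⁻¹ + 1458 * C * L' ^ (-(6 / 10) : ℝ))
      ≤ (10000 * L' ^ (1 / 100 : ℝ)) * (9 * L⁻¹ + 1458 * C * L' ^ (-(6 / 10) : ℝ)) := by gcongr
    _ = 90000 * (L' ^ (1 / 100 : ℝ) * L⁻¹) + 14580000 * C * (L' ^ (1 / 100 : ℝ) * L' ^ (-(6 / 10) : ℝ)) := by ring
    _ = (90000 * (L' ^ (51 / 100 : ℝ) * L⁻¹) + 14580000 * C * L' ^ (-(9 / 100) : ℝ)) * L' ^ (-(1 / 2) : ℝ) := by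
        rw [e2, e1]; ring
    _ ≤ (90000 * ((100 * L ^ (6 / 10 : ℝ)) * L⁻¹) + 14580000 * C * L ^ (-(9 / 100) : ℝ)) * L' ^ (-(1 / 2) : ℝ) := by
        gcongr
    _ = (9000000 * (L ^ (6 / 10 : ℝ) * L⁻¹) + 14580000 * C * L ^ (-(9 / 100) : ℝ)) * L' ^ (-(1 / 2) : ℝ) := by ring
    _ ≤ (9000000 * L ^ (-(9 / 100) : ℝ) + 14580000 * C * L ^ (-(9 / 100) : ℝ)) * L' ^ (-(1 / 2) : ℝ) := by gcongr
    _ = ((9000000 + 14580000 * C) * L ^ (-(9 / 100) : ℝ)) * L' ^ (-(1 / 2) : ℝ) := by ring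
    _ ≤ 1 * L' ^ (-(1 / 2) : ℝ) := by gcongr
    _ = _ := one_mul _

lemma ell_ge {d L0 n : ℕ} (h : 1 ≤ Lscale d L0 n) : 100 ≤ ellScale d L0 n := by
  unfold ellScale
  have : 1 ≤ ⌊(Lscale d L0 n : ℝ) ^ ((1 : ℝ) / (100 * d))⌋₊ := by
    apply Nat.le_floor
    rw [Nat.cast_one]
    exact Real.one_le_rpow (by exact_mod_cast h) (by positivity)
  omega

lemma ell_le (d L0 n : ℕ) : (ellScale d L0 n : ℝ) ≤ 100 * (Lscale d L0 n : ℝ) ^ ((1 : ℝ) / (100 * d)) := by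
  unfold ellScale
  push_cast
  gcongr
  exact Nat.floor_le (by positivity)

lemma L_ge {d L0 : ℕ} (h : 1 ≤ L0) (n : ℕ) : L0 ≤ Lscale d L0 n := by
  induction n with
  | zero => exact le_rfl
  | succ n ih =>
    rw [Lscale_succ]
    have := ell_ge (h.trans ih)
    nlinarith

theorem main_aux (d : ℕ) (hd : 7 ≤ d) (L0 : ℕ) (hL0 : 1 ≤ L0)
    (hbig : ∀ x : ℝ, (L0 : ℝ) ≤ x → (9000000 + 14580000 * (1600 : ℝ) ^ (23 / 10 : ℝ)) * x ^ (-(9 / 100) : ℝ) ≤ 1)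
    (u : ℝ) (hu : 0 ≤ u) (hu1 : u ≤ 1)
    (hu2 : (ellScale d L0 0 : ℝ) ^ 2 * (9 * (L0 : ℝ) ^ 2 * u) ≤ (L0 : ℝ) ^ (-(1 / 2 : ℝ)))
    (P : Zd d → Measure (ℕ → Zd d)) (hP : IsSRW d P)
    (Q : Measure (Zd d → Bool)) (hQ : IsVacantLaw d P u Q) (n : ℕ) : ∀ (i1 i2 : ℤ),
      (ellScale d L0 n : ℝ) ^ 2 * (Q (crossStarEvent d L0 n i1 i2)).toReal
        ≤ (Lscale d L0 n : ℝ) ^ (-(1 / 2 : ℝ)) := by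
  induction n with
  | zero =>
    intro i1 i2
    refine le_trans ?_ hu2
    gcongr
    exact base_bound hd hP hu hQ i1 i2
  | succ n ih =>
    intro i1 i2
    have hLn : L0 ≤ Lscale d L0 n := L_ge hL0 n
    have hL1 : 1 ≤ Lscale d L0 n := hL0.trans hLn
    have hl := ell_ge hL1
    have hL1r : (1 : ℝ) ≤ Lscale d L0 n := by exact_mod_cast hL1
    have hlr : (100 : ℝ) ≤ ellScale d L0 n := by exact_mod_cast hl
    have hLp : (0 : ℝ) < Lscale d L0 n := by linarith
    have hlp : (0 : ℝ) < ellScale d L0 n := by linarith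
    have hd' : (7 : ℝ) ≤ d := by exact_mod_cast hd
    have hsucc : (Lscale d L0 (n + 1) : ℝ) = ellScale d L0 n * Lscale d L0 n := by
      rw [Lscale_succ]; push_cast; rfl
    have hL'p : (0 : ℝ) < Lscale d L0 (n + 1) := by rw [hsucc]; positivity
    have hstep := step_bound hd hP hu hQ hL1 (by omega)
      ((Lscale d L0 n : ℝ) ^ (-(1 / 2 : ℝ)) / (ellScale d L0 n : ℝ) ^ 2)
      (fun j1 j2 => by rw [le_div_iff₀ (by positivity), mul_comm]; exact ih j1 j2) i1 i2
    have hC : (0 : ℝ) ≤ (1600 : ℝ) ^ (23 / 10 : ℝ) := by positivity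
    refine le_trans ?_ (arith_step (1 / (100 * d)) (Lscale d L0 n) (Lscale d L0 (n + 1)) (ellScale d L0 (n + 1))
      ((1600 : ℝ) ^ (23 / 10 : ℝ)) (by positivity) ?_ hL1r ?_ ?_ (by positivity) (ell_le d L0 (n + 1)) hC
      (hbig _ (by exact_mod_cast hLn)))
    · gcongr
      refine hstep.trans ?_
      generalize (1600 : ℝ) ^ (23 / 10 : ℝ) = C at hC ⊢
      have hsq : ((Lscale d L0 n : ℝ) ^ (-(1 / 2 : ℝ))) ^ 2 = (Lscale d L0 n : ℝ)⁻¹ := by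
        rw [← Real.rpow_natCast, ← Real.rpow_mul hLp.le, ← Real.rpow_neg_one]; norm_num
      have hpw : (Lscale d L0 (n + 1) : ℝ) ^ 4 * (Lscale d L0 (n + 1) : ℝ) ^ (-(46 / 10) : ℝ)
          = (Lscale d L0 (n + 1) : ℝ) ^ (-(6 / 10) : ℝ) := by
        rw [← Real.rpow_natCast, ← Real.rpow_add hL'p]; norm_num
      rw [div_pow, hsq]
      calc _ = 9 * (Lscale d L0 n : ℝ)⁻¹ + u * (1458 * C * ((ellScale d L0 n * Lscale d L0 n : ℝ) ^ 4 *
              (Lscale d L0 (n + 1) : ℝ) ^ (-(46 / 10) : ℝ))) := by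
            field_simp; ring
        _ = 9 * (Lscale d L0 n : ℝ)⁻¹ + u * (1458 * C * (Lscale d L0 (n + 1) : ℝ) ^ (-(6 / 10) : ℝ)) := by
            rw [← hsucc, hpw]
        _ ≤ 9 * (Lscale d L0 n : ℝ)⁻¹ + 1 * (1458 * C * (Lscale d L0 (n + 1) : ℝ) ^ (-(6 / 10) : ℝ)) := by
            gcongr
        _ = _ := by ring
    · rw [div_le_div_iff₀ (by positivity) (by norm_num)]; linarith
    · rw [hsucc]; nlinarith
    · rw [hsucc, Real.rpow_add hLp, Real.rpow_one]
      have := ell_le d L0 n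
      nlinarith
/-- **Proposition 4.1 (key renormalization estimate for occupied planar crossings).**
For `d ≥ 7` there are `c₅ > 0` and thresholds `c`, `c(L₀)` such that for `L₀ ≥ c` and
`0 ≤ u ≤ c(L₀)`, `c₅ ℓ_n² q_n(u) ≤ L_n^{−1/2}` for all `n ≥ 0`. -/
theorem planar_renormalization_estimate (d : ℕ) (hd : 7 ≤ d) :
    ∃ c₅ : ℝ, 0 < c₅ ∧
    ∃ c : ℕ, ∃ cL : ℕ → ℝ, (∀ L, 0 < cL L) ∧
    ∀ L0 : ℕ, 1 < L0 → c ≤ L0 →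
    ∀ u : ℝ, 0 ≤ u → u ≤ cL L0 →
    ∀ (P : Zd d → Measure (ℕ → Zd d)), IsSRW d P →
    ∀ Q : Measure (Zd d → Bool), IsVacantLaw d P u Q →
    ∀ (n : ℕ) (i1 i2 : ℤ),
      c₅ * (ellScale d L0 n : ℝ) ^ 2 * (Q (crossStarEvent d L0 n i1 i2)).toReal
        ≤ (Lscale d L0 n : ℝ) ^ (-(1 / 2 : ℝ)) := by
  have hlim : Filter.Tendsto (fun x : ℝ => (9000000 + 14580000 * (1600 : ℝ) ^ (23 / 10 : ℝ)) * x ^ (-(9 / 100) : ℝ))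
      Filter.atTop (nhds 0) := by
    simpa using (tendsto_rpow_neg_atTop (by norm_num : (0 : ℝ) < 9 / 100)).const_mul
      (9000000 + 14580000 * (1600 : ℝ) ^ (23 / 10 : ℝ))
  obtain ⟨X, hX⟩ := Filter.eventually_atTop.mp (hlim.eventually (eventually_le_nhds (zero_lt_one)))
  refine ⟨1, one_pos, ⌈X⌉₊, fun L => min 1 (((L : ℝ) + 1) ^ (-(1 / 2 : ℝ)) / (9 * (ellScale d L 0 : ℝ) ^ 2 * (L : ℝ) ^ 2 + 1)),
    fun L => lt_min one_pos (by positivity), ?_⟩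
  intro L0 hL0 hc u hu hucL P hP Q hQ n i1 i2
  rw [one_mul]
  have hL0r : (0 : ℝ) < L0 := by exact_mod_cast (by omega : 0 < L0)
  refine main_aux d hd L0 hL0.le (fun x hx => hX x ((Nat.le_ceil X).trans (le_trans (by exact_mod_cast hc) hx)))
    u hu (hucL.trans (min_le_left _ _)) ?_ P hP Q hQ n i1 i2
  have h1 := hucL.trans (min_le_right _ _)
  rw [le_div_iff₀ (by positivity)] at h1
  have h2 : ((L0 : ℝ) + 1) ^ (-(1 / 2 : ℝ)) ≤ (L0 : ℝ) ^ (-(1 / 2 : ℝ)) :=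
    Real.rpow_le_rpow_of_nonpos hL0r (by linarith) (by norm_num)
  nlinarith
end

section
/- (Percolation of the vacant set for small u when d ≥ 7.) Let d ≥ 7. There exists ū > 0 such that for every u with 0 < u ≤ ū and every vacant-set law Q at level u on {0,1}^{ℤ^d}: Q[the set {x ∈ ℤ^d : Y_x = 1} has an infinite nearest-neighbor connected component] = 1; equivalently, Q[0 belongs to an infinite nearest-neighbor connected component of {x : Y_x = 1}] > 0. -/
open MeasureTheory
open scoped ENNReal

/-- `x` and `y` are connected by a nearest-neighbor path inside `S`. -/
def connectedIn {d : ℕ} (S : Set (Zd d)) (x y : Zd d) : Prop :=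
  ∃ (n : ℕ) (γ : ℕ → Zd d), γ 0 = x ∧ γ n = y ∧ (∀ k ≤ n, γ k ∈ S) ∧
    ∀ k < n, adj (γ (k + 1)) (γ k)


theorem vp_cover {ι : Type*} [DecidableEq ι] (l : ℝ) (hl : 1 ≤ l) (p : Finset ι → ℝ)
    (h0 : ∀ S, 0 ≤ p S) (h1 : ∀ S, p S ≤ 1) (I : Finset (Finset ι)) :
    ∀ U : Finset ι,
    ∑ J ∈ U.powerset, (-1 : ℝ) ^ J.card * ∏ S ∈ I, (1 - p S * (if Disjoint S J then 0 else 1))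
      ≤ (l⁻¹) ^ U.card * ∏ S ∈ I, (1 + p S * (l ^ S.card - 1)) := by
  have hl0 : 0 < l := by linarith
  have hpos : ∀ (I : Finset (Finset ι)), 0 ≤ ∏ S ∈ I, (1 + p S * (l ^ S.card - 1)) := by
    intro I
    apply Finset.prod_nonneg
    intro S _
    have := one_le_pow₀ hl (n := S.card)
    have := h0 S
    nlinarith [mul_nonneg this (sub_nonneg.2 (one_le_pow₀ hl (n := S.card)))]
  induction I using Finset.induction_on with
  | empty =>
    intro U
    simp only [Finset.prod_empty, mul_one]
    have := Finset.sum_powerset_neg_one_pow_card (x := U)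
    have h2 : ∑ J ∈ U.powerset, (-1 : ℝ) ^ J.card = if U = ∅ then 1 else 0 := by
      exact_mod_cast this
    rw [h2]
    split_ifs with h
    · simp [h]
    · positivity
  | insert S I hS ih =>
    intro U
    set g : Finset ι → ℝ := fun J => (-1 : ℝ) ^ J.card *
      ∏ S ∈ I, (1 - p S * (if Disjoint S J then 0 else 1)) with hg
    have e1 : ∑ J ∈ U.powerset, (-1 : ℝ) ^ J.card *
        ∏ S ∈ insert S I, (1 - p S * (if Disjoint S J then 0 else 1))
        = (1 - p S) * ∑ J ∈ U.powerset, g J + p S * ∑ J ∈ (U \ S).powerset, g J := by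
      have e2 : (U \ S).powerset = U.powerset.filter (fun J => Disjoint S J) := by
        ext J
        simp only [Finset.mem_powerset, Finset.mem_filter, Finset.subset_sdiff]
        rw [disjoint_comm]
      rw [e2, Finset.sum_filter, Finset.mul_sum, Finset.mul_sum, ← Finset.sum_add_distrib]
      apply Finset.sum_congr rfl
      intro J _
      rw [Finset.prod_insert hS]
      simp only [hg]
      split_ifs <;> ring
    rw [e1, Finset.prod_insert hS]
    have a1 := mul_le_mul_of_nonneg_left (ih U) (sub_nonneg.2 (h1 S))
    have a2 := mul_le_mul_of_nonneg_left (ih (U \ S)) (h0 S)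
    have a3 : (l⁻¹) ^ (U \ S).card ≤ (l⁻¹) ^ U.card * l ^ S.card := by
      have : U.card ≤ S.card + (U \ S).card := by
        have := Finset.le_card_sdiff S U
        omega
      rw [inv_pow, inv_pow, ← div_eq_inv_mul, le_div_iff₀ (by positivity), ← div_eq_inv_mul,
        div_le_iff₀ (by positivity), ← pow_add]
      exact pow_le_pow_right₀ hl this
    have a4 := mul_le_mul_of_nonneg_right a3 (hpos I)
    have a5 := mul_le_mul_of_nonneg_left a4 (h0 S)
    calc _ ≤ _ := add_le_add a1 a2
      _ ≤ _ := add_le_add_right a5 _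
      _ = _ := by ring

theorem vp_cover_exp {ι : Type*} [DecidableEq ι] (l : ℝ) (hl : 1 ≤ l) (w : Finset ι → ℝ)
    (h0 : ∀ S, 0 ≤ w S) (I : Finset (Finset ι)) (U : Finset ι) :
    ∑ J ∈ U.powerset, (-1 : ℝ) ^ J.card *
        Real.exp (-∑ S ∈ I, w S * (if Disjoint S J then 0 else 1))
      ≤ (l⁻¹) ^ U.card * Real.exp (∑ S ∈ I, w S * (l ^ S.card - 1)) := by
  have hl0 : 0 < l := by linarith
  have key := vp_cover l hl (fun S => 1 - Real.exp (-w S))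
    (fun S => by simpa using h0 S) (fun S => by simpa using (Real.exp_pos _).le) I U
  refine le_trans (le_of_eq ?_) (key.trans ?_)
  · apply Finset.sum_congr rfl
    intro J _
    rw [← Finset.sum_neg_distrib, Real.exp_sum]
    congr 1
    apply Finset.prod_congr rfl
    intro S _
    split_ifs <;> simp
  · apply mul_le_mul_of_nonneg_left _ (by positivity)
    rw [Real.exp_sum]
    apply Finset.prod_le_prod
    · intro S _
      have h1 : 0 ≤ 1 - Real.exp (-w S) := by simpa using h0 S
      have := mul_nonneg h1 (sub_nonneg.2 (one_le_pow₀ hl (n := S.card)))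
      linarith
    · intro S _
      have h1 : 1 - Real.exp (-w S) ≤ w S := by
        have := Real.add_one_le_exp (-w S)
        linarith
      have := mul_le_mul_of_nonneg_right h1 (sub_nonneg.2 (one_le_pow₀ hl (n := S.card)))
      have := Real.add_one_le_exp (w S * (l ^ S.card - 1))
      linarith

theorem vp_incl_excl {Ω ι : Type*} [MeasurableSpace Ω] [DecidableEq ι] (Q : Measure Ω)
    [IsProbabilityMeasure Q] (A : ι → Set Ω) (hA : ∀ i, MeasurableSet (A i)) (U : Finset ι) :
    Q.real {ω | ∀ i ∈ U, ω ∉ A i}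
      = ∑ J ∈ U.powerset, (-1 : ℝ) ^ J.card * Q.real {ω | ∀ i ∈ J, ω ∈ A i} := by
  have m1 : ∀ J : Finset ι, MeasurableSet {ω | ∀ i ∈ J, ω ∈ A i} := by
    intro J
    have : {ω | ∀ i ∈ J, ω ∈ A i} = ⋂ i ∈ J, A i := by ext; simp
    rw [this]
    exact Finset.measurableSet_biInter _ (fun i _ => hA i)
  have m2 : MeasurableSet {ω | ∀ i ∈ U, ω ∉ A i} := by
    have : {ω | ∀ i ∈ U, ω ∉ A i} = ⋂ i ∈ U, (A i)ᶜ := by ext; simp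
    rw [this]
    exact Finset.measurableSet_biInter _ (fun i _ => (hA i).compl)
  rw [← integral_indicator_one m2]
  have : ∀ ω, ({ω | ∀ i ∈ U, ω ∉ A i}).indicator (1 : Ω → ℝ) ω
      = ∑ J ∈ U.powerset, (-1 : ℝ) ^ J.card *
        ({ω | ∀ i ∈ J, ω ∈ A i}).indicator (1 : Ω → ℝ) ω := by
    intro ω
    have hp : ∀ (J : Finset ι) (B : ι → Set Ω), ({ω | ∀ i ∈ J, ω ∈ B i}).indicator (1 : Ω → ℝ) ω
        = ∏ i ∈ J, (B i).indicator (1 : Ω → ℝ) ω := by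
      intro J B
      classical
      simp only [Set.indicator_apply, Pi.one_apply]
      rw [Finset.prod_ite_zero]
      simp
    have h3 := hp U (fun i => (A i)ᶜ)
    simp only [Set.mem_compl_iff] at h3
    rw [h3]
    have h4 : ∀ i ∈ U, (A i)ᶜ.indicator (1 : Ω → ℝ) ω = 1 + (-1) * (A i).indicator (1 : Ω → ℝ) ω := by
      intro i _
      by_cases h : ω ∈ A i <;> simp [h]
    rw [Finset.prod_congr rfl h4, Finset.prod_one_add]
    apply Finset.sum_congr rfl
    intro J _
    rw [hp, Finset.prod_mul_distrib, Finset.prod_const]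
  simp_rw [this]
  rw [integral_finsetSum]
  · apply Finset.sum_congr rfl
    intro J _
    rw [integral_const_mul, integral_indicator_one (m1 J)]
  · intro J _
    apply Integrable.const_mul
    exact (integrable_const (1:ℝ)).indicator (m1 J)


def vstep {d : ℕ} (e : Fin d × Bool) : Zd d := Pi.single e.1 (if e.2 then 1 else -1)

noncomputable def vA {d : ℕ} (f : Zd d → ℝ≥0∞) (x : Zd d) : ℝ≥0∞ :=
  (2 * d : ℝ≥0∞)⁻¹ * ∑ e : Fin d × Bool, f (x + vstep e)

def vcons {d : ℕ} (x : Zd d) (w : ℕ → Zd d) : ℕ → Zd d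
  | 0 => x
  | n + 1 => w n

theorem vstep_inj {d : ℕ} : Function.Injective (vstep (d := d)) := by
  rintro ⟨i, b⟩ ⟨j, c⟩ h
  have h1 := congrFun h i
  simp only [vstep, Pi.single_eq_same] at h1
  by_cases hij : i = j
  · subst hij
    simp only [Pi.single_eq_same] at h1
    cases b <;> cases c <;> simp_all
  · rw [Pi.single_eq_of_ne hij] at h1
    cases b <;> simp at h1

theorem vadj_step {d : ℕ} (x : Zd d) (e : Fin d × Bool) : adj (x + vstep e) x := by
  unfold adj
  rw [Finset.sum_eq_single e.1]
  · cases h : e.2 <;> simp [vstep, h]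
  · intro j _ hj
    simp [vstep, Pi.single_eq_of_ne hj]
  · simp

theorem vadj_iff {d : ℕ} (y x : Zd d) : adj y x ↔ ∃ e, y = x + vstep e := by
  constructor
  · intro h
    unfold adj at h
    have hex : ∃ i, (y i - x i).natAbs ≠ 0 := by
      by_contra hc
      push Not at hc
      simp [hc] at h
    obtain ⟨i, hi⟩ := hex
    have hle := Finset.single_le_sum (f := fun i => (y i - x i).natAbs)
      (fun _ _ => Nat.zero_le _) (Finset.mem_univ i)
    have hi1 : (y i - x i).natAbs = 1 := by omega
    have hz : ∀ j, j ≠ i → (y j - x j).natAbs = 0 := by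
      intro j hj
      rw [← Finset.add_sum_erase _ _ (Finset.mem_univ i)] at h
      have h2 : ∑ j ∈ Finset.univ.erase i, (y j - x j).natAbs = 0 := by omega
      rw [Finset.sum_eq_zero_iff] at h2
      exact h2 j (by simp [hj])
    refine ⟨(i, decide (y i - x i = 1)), ?_⟩
    ext j
    by_cases hj : j = i
    · subst hj
      by_cases h1 : y j - x j = 1
      · simp [vstep, h1]; omega
      · simp [vstep, h1]; omega
    · have := hz j hj
      simp [vstep, Pi.single_eq_of_ne hj]; omega
  · rintro ⟨e, rfl⟩
    exact vadj_step x e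

theorem vcons_meas {d : ℕ} (x : Zd d) : Measurable (vcons x) := by
  rw [measurable_pi_iff]
  intro n
  cases n with
  | zero => exact measurable_const
  | succ n => exact measurable_pi_apply n

theorem vcoord_meas {d : ℕ} (k : ℕ) (s : Set (Zd d)) :
    MeasurableSet {w : ℕ → Zd d | w k ∈ s} :=
  measurable_pi_apply k (Set.to_countable s).measurableSet

def vcyl {d : ℕ} (N : ℕ) (γ : ℕ → Zd d) : Set (ℕ → Zd d) := {w | ∀ k ≤ N, w k = γ k}

theorem vcyl_meas {d : ℕ} (N : ℕ) (γ : ℕ → Zd d) : MeasurableSet (vcyl N γ) := by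
  have : vcyl N γ = ⋂ k ∈ Set.Iic N, {w | w k = γ k} := by
    ext w; simp [vcyl]
  rw [this]
  refine MeasurableSet.biInter (Set.to_countable _) (fun k _ => ?_)
  exact vcoord_meas k {γ k}

theorem vstart {d : ℕ} {P : Zd d → Measure (ℕ → Zd d)} (hP : IsSRW d P) (x : Zd d) :
    ∀ᵐ w ∂(P x), w 0 = x := by
  have := hP.1 x
  have h := hP.2 x 0 (fun _ => x) rfl
  simp only [Nat.le_zero, forall_eq, not_lt_zero, IsEmpty.forall_iff, implies_true, if_true,
    pow_zero] at h
  exact (prob_compl_eq_zero_iff (vcoord_meas 0 {x})).2 h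

theorem vcyl_val {d : ℕ} {P : Zd d → Measure (ℕ → Zd d)} (hP : IsSRW d P) (x : Zd d) (N : ℕ)
    (γ : ℕ → Zd d) : P x (vcyl N γ) = if γ 0 = x ∧ ∀ k < N, adj (γ (k + 1)) (γ k) then
      ((2 * d : ℝ≥0∞))⁻¹ ^ N else 0 := by
  by_cases h : γ 0 = x
  · simp only [h, true_and]
    exact hP.2 x N γ h
  · simp only [h, false_and, if_false]
    refine measure_mono_null ?_ (vstart hP x)
    intro w hw h2
    exact h ((hw 0 (Nat.zero_le _)).symm.trans h2)

theorem vgen {d : ℕ} : (inferInstance : MeasurableSpace (ℕ → Zd d)) =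
    MeasurableSpace.generateFrom {s | s = ∅ ∨ ∃ N γ, s = vcyl (d := d) N γ} := by
  apply le_antisymm
  · refine iSup_le fun k => ?_
    rw [MeasurableSpace.comap_le_iff_le_map]
    intro s _
    have : ∀ y : Zd d, MeasurableSet[MeasurableSpace.generateFrom
        {s | s = ∅ ∨ ∃ N γ, s = vcyl (d := d) N γ}] {w : ℕ → Zd d | w k = y} := by
      intro y
      have e : {w : ℕ → Zd d | w k = y} = ⋃ g : {g : Fin (k+1) → Zd d // g (Fin.last k) = y},
          vcyl k (fun n => if h : n < k + 1 then g.1 ⟨n, h⟩ else 0) := by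
        ext w
        simp only [Set.mem_iUnion]
        constructor
        · intro (hw : w k = y)
          refine ⟨⟨fun i => w i, by simpa using hw⟩, ?_⟩
          intro j hj
          simp [Nat.lt_succ_of_le hj]
        · rintro ⟨g, hg⟩
          have := hg k le_rfl
          simp only [Nat.lt_succ_self, dite_true] at this
          exact this.trans g.2
      rw [e]
      exact MeasurableSet.iUnion fun g => MeasurableSpace.measurableSet_generateFrom
        (Or.inr ⟨_, _, rfl⟩)
    have e : (fun w : ℕ → Zd d => w k) ⁻¹' s = ⋃ y ∈ s, {w | w k = y} := by
      ext w; simp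
    rw [MeasurableSpace.map_def, e]
    exact MeasurableSet.biUnion (Set.to_countable s) (fun y _ => this y)
  · apply MeasurableSpace.generateFrom_le
    rintro s (rfl | ⟨N, γ, rfl⟩)
    · exact MeasurableSet.empty
    · exact vcyl_meas N γ

theorem vpi {d : ℕ} : IsPiSystem {s | s = ∅ ∨ ∃ N γ, s = vcyl (d := d) N γ} := by
  have key : ∀ (N M : ℕ) (γ δ : ℕ → Zd d), N ≤ M →
      (vcyl N γ ∩ vcyl M δ).Nonempty → vcyl N γ ∩ vcyl M δ = vcyl M δ := by
    rintro N M γ δ h ⟨w, hw1, hw2⟩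
    apply Set.inter_eq_right.2
    intro v hv k hk
    rw [hv k (hk.trans h), ← hw2 k (hk.trans h), hw1 k hk]
  rintro s (rfl | ⟨N, γ, rfl⟩) t (rfl | ⟨M, δ, rfl⟩) h
  · simp at h
  · simp at h
  · simp at h
  · rcases le_total N M with h1 | h1
    · exact Or.inr ⟨M, δ, key N M γ δ h1 h⟩
    · refine Or.inr ⟨N, γ, ?_⟩
      rw [Set.inter_comm] at h ⊢
      exact key M N δ γ h1 h

theorem vtwod {d : ℕ} (hd : 7 ≤ d) : (2 * d : ℝ≥0∞)⁻¹ * (2 * d) = 1 := by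
  apply ENNReal.inv_mul_cancel
  · have : d ≠ 0 := by omega
    simp [this]
  · exact ENNReal.mul_ne_top (by simp) (by simp)

theorem vfirst {d : ℕ} (hd : 7 ≤ d) {P : Zd d → Measure (ℕ → Zd d)} (hP : IsSRW d P) (x : Zd d) :
    P x = (2 * d : ℝ≥0∞)⁻¹ • ∑ e : Fin d × Bool, (P (x + vstep e)).map (vcons x) := by
  have := hP.1
  have hm : ∀ y, IsProbabilityMeasure ((P y).map (vcons x)) := fun y =>
    Measure.isProbabilityMeasure_map (vcons_meas x).aemeasurable
  refine ext_of_generate_finite _ vgen vpi ?_ ?_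
  · rintro s (rfl | ⟨N, γ, rfl⟩)
    · simp
    · rw [vcyl_val hP]
      simp only [Measure.smul_apply, Measure.finsetSum_apply, smul_eq_mul]
      simp_rw [Measure.map_apply (vcons_meas x) (vcyl_meas N γ)]
      by_cases h0 : γ 0 = x
      · cases N with
        | zero =>
          have : vcons x ⁻¹' vcyl 0 γ = Set.univ := by
            ext w; simp [vcyl, vcons, h0]
          simp only [this, measure_univ]
          simp only [h0, not_lt_zero, IsEmpty.forall_iff, implies_true, and_self, if_true,
            pow_zero, Finset.sum_const, Finset.card_univ, Fintype.card_prod, Fintype.card_fin,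
            Fintype.card_bool, nsmul_eq_mul, mul_one]
          rw [← vtwod hd]
          push_cast
          ring
        | succ N =>
          have : vcons x ⁻¹' vcyl (N+1) γ = vcyl N (fun n => γ (n+1)) := by
            ext w
            constructor
            · intro hw k hk
              exact hw (k+1) (by omega)
            · intro hw k hk
              cases k with
              | zero => exact h0.symm
              | succ k => exact hw k (by omega)
          simp only [this, vcyl_val hP, h0, true_and, zero_add]
          by_cases h1 : adj (γ 1) (γ 0)
          · obtain ⟨e, he⟩ := (vadj_iff _ _).1 h1
            rw [h0] at he
            rw [Finset.sum_eq_single e]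
            · have : (∀ k < N + 1, adj (γ (k + 1)) (γ k)) ↔
                  ∀ k < N, adj (γ (k + 1 + 1)) (γ (k + 1)) := by
                constructor
                · intro h k hk
                  exact h (k+1) (by omega)
                · intro h k hk
                  cases k with
                  | zero => exact h1
                  | succ k => exact h k (by omega)
              simp only [this, he, true_and]
              split_ifs
              · rw [pow_succ']
              · simp
            · intro e' _ hne
              rw [if_neg]
              rintro ⟨h3, -⟩
              rw [he] at h3
              exact hne (vstep_inj (add_left_cancel h3)).symm
            · simp
          · rw [if_neg (fun h => h1 (h 0 (by omega))), Finset.sum_eq_zero]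
            · simp
            · intro e _
              rw [if_neg]
              rintro ⟨h3, -⟩
              apply h1
              rw [h3, h0]
              exact vadj_step x e
      · have : vcons x ⁻¹' vcyl N γ = ∅ := by
          ext w
          simp only [Set.mem_preimage, Set.mem_empty_iff_false, iff_false]
          intro hw
          exact h0 (hw 0 (Nat.zero_le _)).symm
        simp [this, h0]
  · simp only [Measure.smul_apply, Measure.finsetSum_apply, measure_univ, smul_eq_mul]
    simp only [Finset.sum_const, Finset.card_univ, Fintype.card_prod, Fintype.card_fin,
            Fintype.card_bool, nsmul_eq_mul, mul_one]
    rw [← vtwod hd]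
    push_cast
    ring

theorem vlint {d : ℕ} (hd : 7 ≤ d) {P : Zd d → Measure (ℕ → Zd d)} (hP : IsSRW d P) (x : Zd d)
    (F : (ℕ → Zd d) → ℝ≥0∞) (hF : Measurable F) :
    ∫⁻ w, F w ∂(P x) = vA (fun y => ∫⁻ w, F (vcons x w) ∂(P y)) x := by
  rw [vfirst hd hP x, lintegral_smul_measure, lintegral_finsetSum_measure, vA, smul_eq_mul]
  congr 1
  apply Finset.sum_congr rfl
  intro e _
  rw [lintegral_map hF (vcons_meas x)]

theorem vmeas_step {d : ℕ} (hd : 7 ≤ d) {P : Zd d → Measure (ℕ → Zd d)} (hP : IsSRW d P) (x : Zd d)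
    (s : Set (ℕ → Zd d)) (hs : MeasurableSet s) :
    P x s = vA (fun y => P y (vcons x ⁻¹' s)) x := by
  rw [← lintegral_indicator_one hs, vlint hd hP x _ (measurable_one.indicator hs)]
  congr 1
  ext y
  rw [← lintegral_indicator_one (vcons_meas x hs)]
  rfl


theorem vA_mono {d : ℕ} {f g : Zd d → ℝ≥0∞} (h : ∀ x, f x ≤ g x) (x : Zd d) : vA f x ≤ vA g x := by
  unfold vA
  gcongr
  exact h _

theorem vA_affine {d : ℕ} (hd : 7 ≤ d) (c k : ℝ≥0∞) (f : Zd d → ℝ≥0∞) (x : Zd d) :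
    vA (fun y => c + k * f y) x = c + k * vA f x := by
  unfold vA
  rw [Finset.sum_add_distrib, ← Finset.mul_sum, mul_add]
  congr 1
  · simp only [Finset.sum_const, Finset.card_univ, Fintype.card_prod, Fintype.card_fin,
            Fintype.card_bool, nsmul_eq_mul]
    push_cast
    calc (2 * (d:ℝ≥0∞))⁻¹ * (d * 2 * c) = ((2 * (d:ℝ≥0∞))⁻¹ * (2 * d)) * c := by ring
      _ = c := by rw [vtwod hd, one_mul]
  · ring

theorem vA_tsum {d : ℕ} (hd : 7 ≤ d) (f : Zd d → ℝ≥0∞) : ∑' x, vA f x = ∑' x, f x := by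
  unfold vA
  rw [ENNReal.tsum_mul_left, Summable.tsum_finsetSum (fun _ _ => ENNReal.summable)]
  have : ∀ e : Fin d × Bool, ∑' x, f (x + vstep e) = ∑' x, f x := fun e =>
    Equiv.tsum_eq (Equiv.addRight (vstep e)) f
  simp only [this, Finset.sum_const, Finset.card_univ, Fintype.card_prod, Fintype.card_fin,
            Fintype.card_bool, nsmul_eq_mul]
  push_cast
  calc (2 * (d:ℝ≥0∞))⁻¹ * (d * 2 * ∑' x, f x) = ((2 * (d:ℝ≥0∞))⁻¹ * (2 * d)) * ∑' x, f x := by ring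
      _ = _ := by rw [vtwod hd, one_mul]

theorem vtsum_ite {α : Type*} [DecidableEq α] (K : Finset α) (f : α → ℝ≥0∞) :
    ∑' x, (if x ∈ K then f x else 0) = ∑ x ∈ K, f x := by
  rw [tsum_eq_sum (s := K)]
  · exact Finset.sum_congr rfl fun x hx => by simp [hx]
  · intro x hx; simp [hx]

def vhit {d : ℕ} (K : Finset (Zd d)) (T : ℕ) : Set (ℕ → Zd d) := {w | ∃ k < T, w k ∈ K}

theorem vhit_meas {d : ℕ} (K : Finset (Zd d)) (T : ℕ) : MeasurableSet (vhit K T) := by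
  have : vhit K T = ⋃ k ∈ Set.Iio T, {w | w k ∈ (K : Set (Zd d))} := by
    ext w; simp [vhit]
  rw [this]
  exact MeasurableSet.biUnion (Set.to_countable _) (fun k _ => vcoord_meas k _)

def vav {d : ℕ} (K : Finset (Zd d)) (T : ℕ) : Set (ℕ → Zd d) :=
  {w | ∀ k, 1 ≤ k → k ≤ T → w k ∉ K}

theorem vav_meas {d : ℕ} (K : Finset (Zd d)) (T : ℕ) : MeasurableSet (vav K T) := by
  have : vav K T = ⋂ k, {w | w k ∈ {y : Zd d | 1 ≤ k → k ≤ T → y ∉ K}} := by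
    ext w; simp [vav]
  rw [this]
  exact MeasurableSet.iInter (fun k => vcoord_meas k _)

theorem vhit_succ {d : ℕ} (hd : 7 ≤ d) {P : Zd d → Measure (ℕ → Zd d)} (hP : IsSRW d P)
    (K : Finset (Zd d)) (T : ℕ) :
    Measure.sum P (vhit K (T + 1)) = Measure.sum P (vhit K T) + ∑ y ∈ K, P y (vav K T) := by
  rw [Measure.sum_apply _ (vhit_meas _ _), Measure.sum_apply _ (vhit_meas _ _),
    ← vA_tsum hd (fun x => P x (vhit K T)), ← vtsum_ite, ← ENNReal.tsum_add]
  congr 1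
  ext x
  have h1 : vA (fun x => P x (vhit K T)) x = P x (vav K T)ᶜ := by
    rw [vmeas_step hd hP x _ (vav_meas K T).compl]
    congr 1
    ext y
    congr 1
    ext w
    simp only [vhit, vav, Set.mem_preimage, Set.mem_compl_iff, Set.mem_ofPred_eq]
    push Not
    constructor
    · rintro ⟨k, hk, h⟩
      exact ⟨k+1, by omega, by omega, h⟩
    · rintro ⟨k, hk, hk2, h⟩
      obtain ⟨j, rfl⟩ : ∃ j, k = j + 1 := ⟨k - 1, by omega⟩
      exact ⟨j, by omega, h⟩
  rw [h1]
  have h2 : ∀ w : ℕ → Zd d, w 0 = x → (w ∈ vhit K (T+1) ↔ w ∈ (vav K T)ᶜ ∨ x ∈ K) := by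
    intro w hw
    simp only [vhit, vav, Set.mem_compl_iff, Set.mem_ofPred_eq]
    push Not
    constructor
    · rintro ⟨k, hk, h⟩
      rcases Nat.eq_zero_or_pos k with rfl | h0
      · right; rwa [← hw]
      · exact Or.inl ⟨k, h0, by omega, h⟩
    · rintro (⟨k, hk, hk2, h⟩ | h)
      · exact ⟨k, by omega, h⟩
      · exact ⟨0, by omega, by rwa [hw]⟩
  have := hP.1 x
  by_cases hx : x ∈ K
  · simp only [hx, if_true]
    rw [add_comm ((P x) (vav K T)ᶜ), prob_add_prob_compl (vav_meas K T), ← measure_univ (μ := P x)]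
    apply measure_congr
    filter_upwards [vstart hP x] with w hw
    apply propext
    change w ∈ vhit K (T+1) ↔ w ∈ Set.univ
    rw [h2 w hw]
    simp [hx]
  · simp only [hx, if_false, add_zero]
    apply measure_congr
    filter_upwards [vstart hP x] with w hw
    apply propext
    change w ∈ vhit K (T+1) ↔ w ∈ (vav K T)ᶜ
    rw [h2 w hw]
    simp [hx]

theorem vhit_sum {d : ℕ} (hd : 7 ≤ d) {P : Zd d → Measure (ℕ → Zd d)} (hP : IsSRW d P)
    (K : Finset (Zd d)) (T : ℕ) :
    Measure.sum P (vhit K T) = ∑ t ∈ Finset.range T, ∑ y ∈ K, P y (vav K t) := by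
  induction T with
  | zero => simp [vhit]
  | succ T ih => rw [vhit_succ hd hP, ih, Finset.sum_range_succ]

theorem vhit_fin {d : ℕ} (hd : 7 ≤ d) {P : Zd d → Measure (ℕ → Zd d)} (hP : IsSRW d P)
    (K : Finset (Zd d)) (T : ℕ) : Measure.sum P (vhit K T) ≠ ∞ := by
  have := hP.1
  rw [vhit_sum hd hP]
  refine (ENNReal.sum_lt_top.2 fun t _ => ENNReal.sum_lt_top.2 fun y _ => measure_lt_top _ _).ne

theorem vcap_lim {d : ℕ} (hd : 7 ≤ d) {P : Zd d → Measure (ℕ → Zd d)} (hP : IsSRW d P)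
    (K : Finset (Zd d)) :
    Filter.Tendsto (fun T : ℕ => (T : ℝ)⁻¹ * (Measure.sum P (vhit K T)).toReal) Filter.atTop
      (nhds (capa d P K).toReal) := by
  have := hP.1
  have h1 : ∀ T, (Measure.sum P (vhit K T)).toReal
      = ∑ t ∈ Finset.range T, (∑ y ∈ K, P y (vav K t)).toReal := by
    intro T
    rw [vhit_sum hd hP, ENNReal.toReal_sum]
    intro t _
    exact (ENNReal.sum_lt_top.2 fun y _ => measure_lt_top _ _).ne
  simp_rw [h1]
  apply Filter.Tendsto.cesaro
  have hcap : capa d P K = ∑ y ∈ K, P y (escSet d K) := by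
    unfold capa eqm
    exact Finset.sum_congr rfl fun x hx => by simp [hx]
  rw [hcap]
  refine (ENNReal.tendsto_toReal (ENNReal.sum_lt_top.2 fun y _ => measure_lt_top _ _).ne).comp ?_
  apply tendsto_finsetSum
  intro y _
  have : escSet d K = ⋂ t, vav K t := by
    ext w
    simp only [escSet, vav, Set.mem_ofPred_eq, Set.mem_iInter]
    exact ⟨fun h t k hk _ => h k hk, fun h n hn => h n n hn le_rfl⟩
  rw [this]
  apply tendsto_measure_iInter_atTop
  · exact fun t => (vav_meas K t).nullMeasurableSet
  · intro s t hst w hw k hk hk2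
    exact hw k hk (hk2.trans hst)
  · exact ⟨0, measure_ne_top _ _⟩

noncomputable def vG {d : ℕ} (K : Finset (Zd d)) : ℕ → Zd d → ℝ≥0∞
  | 0, _ => 0
  | T + 1, x => (if x ∈ K then 1 else 0) + vA (vG K T) x

theorem vG_tsum {d : ℕ} (hd : 7 ≤ d) (K : Finset (Zd d)) (T : ℕ) :
    ∑' x, vG K T x = T * K.card := by
  induction T with
  | zero => simp [vG]
  | succ T ih =>
    simp only [vG]
    rw [ENNReal.tsum_add, vtsum_ite, vA_tsum hd, ih]
    simp
    ring

noncomputable def vH {d : ℕ} {ι : Type*} (B : ι → Finset (Zd d)) (V : Finset ι) (T : ℕ) (w : ℕ → Zd d) :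
    Finset ι := by
  classical exact V.filter (fun v => w ∈ vhit (B v) T)

theorem mem_vH {d : ℕ} {ι : Type*} (B : ι → Finset (Zd d)) (V : Finset ι) (T : ℕ) (w : ℕ → Zd d) (v : ι) :
    v ∈ vH B V T w ↔ v ∈ V ∧ w ∈ vhit (B v) T := by
  classical
  simp [vH]

theorem vH_meas {d : ℕ} {ι : Type*} (B : ι → Finset (Zd d)) (V : Finset ι) (T : ℕ) (S : Finset ι) :
    MeasurableSet {w | vH B V T w = S} := by
  classical
  by_cases hS : S ⊆ V
  · have : {w | vH B V T w = S} = ⋂ v ∈ V, (if v ∈ S then vhit (B v) T else (vhit (B v) T)ᶜ) := by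
      ext w
      simp only [Set.mem_ofPred_eq, Set.mem_iInter]
      constructor
      · rintro rfl v hv
        split_ifs with h
        · exact ((mem_vH _ _ _ _ _).1 h).2
        · intro h2
          exact h ((mem_vH _ _ _ _ _).2 ⟨hv, h2⟩)
      · intro h
        ext v
        rw [mem_vH]
        constructor
        · rintro ⟨hv, h2⟩
          have := h v hv
          by_contra h3
          rw [if_neg h3] at this
          exact this h2
        · intro hv
          have := h v (hS hv)
          rw [if_pos hv] at this
          exact ⟨hS hv, this⟩
    rw [this]
    refine Finset.measurableSet_biInter _ fun v _ => ?_
    split_ifs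
    · exact vhit_meas _ _
    · exact (vhit_meas _ _).compl
  · have : {w | vH B V T w = S} = ∅ := by
      ext w
      simp only [Set.mem_ofPred_eq, Set.mem_empty_iff_false, iff_false]
      rintro rfl
      exact hS fun v hv => ((mem_vH _ _ _ _ _).1 hv).1
    rw [this]
    exact MeasurableSet.empty

theorem vH_expand {d : ℕ} {ι : Type*} [DecidableEq ι] (B : ι → Finset (Zd d)) (V : Finset ι) (T : ℕ)
    (c : Finset ι → ℝ≥0∞) (w : ℕ → Zd d) :
    c (vH B V T w) = ∑ S ∈ V.powerset, ({w | vH B V T w = S}).indicator (fun _ => c S) w := by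
  rw [Finset.sum_eq_single (vH B V T w)]
  · rw [Set.indicator_of_mem]; rfl
  · intro S _ hS
    rw [Set.indicator_of_notMem]
    exact fun h => hS h.symm
  · intro h
    exact absurd (Finset.mem_powerset.2 fun v hv => ((mem_vH _ _ _ _ _).1 hv).1) h

theorem vHc_meas {d : ℕ} {ι : Type*} [DecidableEq ι] (B : ι → Finset (Zd d)) (V : Finset ι) (T : ℕ)
    (c : Finset ι → ℝ≥0∞) : Measurable (fun w => c (vH B V T w)) := by
  simp_rw [vH_expand B V T c]
  exact Finset.measurable_fun_sum _ fun S _ => measurable_const.indicator (vH_meas B V T S)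

theorem vH_lint {d : ℕ} {ι : Type*} [DecidableEq ι] (B : ι → Finset (Zd d)) (V : Finset ι) (T : ℕ)
    (c : Finset ι → ℝ≥0∞) (m : Measure (ℕ → Zd d)) :
    ∫⁻ w, c (vH B V T w) ∂m = ∑ S ∈ V.powerset, c S * m {w | vH B V T w = S} := by
  simp_rw [vH_expand B V T c]
  rw [lintegral_finsetSum _ fun S _ => measurable_const.indicator (vH_meas B V T S)]
  apply Finset.sum_congr rfl
  intro S _
  rw [lintegral_indicator_const (vH_meas B V T S)]

theorem vmoment {d : ℕ} (hd : 7 ≤ d) {P : Zd d → Measure (ℕ → Zd d)} (hP : IsSRW d P)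
    {ι : Type*} [DecidableEq ι] (B : ι → Finset (Zd d)) (U : Finset ι) (l : ℕ) (hl : 1 ≤ l)
    (hB : ∀ V ⊆ U, ∀ j ∈ U, j ∉ V → ∀ x ∈ B j, ∀ T, 2 * l * vG (V.biUnion B) T x ≤ 1) (T : ℕ) :
    ∀ V ⊆ U, ∀ x, ∫⁻ w, (l : ℝ≥0∞) ^ (vH B V T w).card ∂(P x) ≤
      1 + 2 * l * vG (V.biUnion B) T x := by
  have hl' : (1 : ℝ≥0∞) ≤ l := by exact_mod_cast hl
  induction T with
  | zero =>
    intro V hV x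
    have := hP.1 x
    have h : ∀ w : ℕ → Zd d, vH B V 0 w = ∅ := by
      intro w
      ext v
      simp [mem_vH, vhit]
    simp [h]
  | succ T ih =>
    intro V hV x
    rw [vlint hd hP x _ (vHc_meas B V (T+1) (fun S => (l : ℝ≥0∞) ^ S.card))]
    have hc : ∀ v w, vcons x w ∈ vhit (B v) (T+1) → x ∈ B v ∨ w ∈ vhit (B v) T := by
      rintro v w ⟨k, hk, h⟩
      cases k with
      | zero => exact Or.inl h
      | succ k => exact Or.inr ⟨k, by omega, h⟩
    by_cases hx : ∃ j ∈ V, x ∈ B j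
    · obtain ⟨j, hj, hxj⟩ := hx
      have hdisj : ∀ v ∈ V, v ≠ j → x ∉ B v := by
        intro v hv hvj hxv
        have := hB {v} (by simpa using hV hv) j (hV hj) (by simpa using hvj.symm) x hxj 1
        have h1 : x ∈ ({v} : Finset ι).biUnion B := by simpa using hxv
        simp only [vG, h1, if_true] at this
        have h2 : (2 : ℝ≥0∞) ≤ 1 := by
          calc (2 : ℝ≥0∞) = 2 * 1 * (1 + 0) := by simp
            _ ≤ _ := by gcongr; exact zero_le
            _ ≤ 1 := this
        norm_num at h2
      have hs := hB (V.erase j) ((Finset.erase_subset _ _).trans hV) j (hV hj) (by simp) x hxj (T+1)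
      have h1 : ∀ y, ∫⁻ w, (l : ℝ≥0∞) ^ (vH B V (T+1) (vcons x w)).card ∂(P y) ≤
          l + l * (2 * l) * vG ((V.erase j).biUnion B) T y := by
        intro y
        calc _ ≤ ∫⁻ w, l * (l : ℝ≥0∞) ^ (vH B (V.erase j) T w).card ∂(P y) := by
              apply lintegral_mono
              intro w
              simp only
              rw [← pow_succ']
              apply pow_le_pow_right₀ hl'
              refine (Finset.card_le_card (t := insert j (vH B (V.erase j) T w)) ?_).trans
                (Finset.card_insert_le _ _)
              intro v hv
              rw [mem_vH] at hv
              rw [Finset.mem_insert, mem_vH, Finset.mem_erase]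
              by_cases hvj : v = j
              · exact Or.inl hvj
              · right
                refine ⟨⟨hvj, hv.1⟩, ?_⟩
                rcases hc v w hv.2 with h | h
                · exact absurd h (hdisj v hv.1 hvj)
                · exact h
          _ = l * ∫⁻ w, (l : ℝ≥0∞) ^ (vH B (V.erase j) T w).card ∂(P y) := by
              rw [lintegral_const_mul _
                (vHc_meas B (V.erase j) T (fun S => (l : ℝ≥0∞) ^ S.card))]
          _ ≤ l * (1 + 2 * l * vG ((V.erase j).biUnion B) T y) := by
              gcongr
              exact ih _ ((Finset.erase_subset _ _).trans hV) y
          _ = _ := by ring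
      refine (vA_mono h1 x).trans ?_
      rw [vA_affine hd]
      have h3 : 2 * l * vA (vG ((V.erase j).biUnion B) T) x ≤ 1 := by
        refine le_trans ?_ hs
        gcongr
        simp only [vG]
        exact le_add_self
      have hxV : x ∈ V.biUnion B := Finset.mem_biUnion.2 ⟨j, hj, hxj⟩
      simp only [vG, hxV, if_true]
      calc l + l * (2 * l) * vA (vG ((V.erase j).biUnion B) T) x
          = l + l * (2 * l * vA (vG ((V.erase j).biUnion B) T) x) := by ring
        _ ≤ l + l * 1 := by gcongr
        _ = 0 + 2 * l * (1 + 0) := by ring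
        _ ≤ _ := by gcongr <;> exact zero_le
    · have hxV : x ∉ V.biUnion B := by
        simpa using hx
      simp only [vG, hxV, if_false, zero_add]
      rw [← vA_affine hd]
      apply vA_mono
      intro y
      refine le_trans ?_ (ih V hV y)
      apply lintegral_mono
      intro w
      apply pow_le_pow_right₀ hl'
      apply Finset.card_le_card
      intro v hv
      rw [mem_vH] at hv ⊢
      refine ⟨hv.1, ?_⟩
      rcases hc v w hv.2 with h | h
      · exact absurd ⟨v, hv.1, h⟩ hx
      · exact h

theorem vmoment_sum {d : ℕ} (hd : 7 ≤ d) {P : Zd d → Measure (ℕ → Zd d)} (hP : IsSRW d P)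
    {ι : Type*} [DecidableEq ι] (B : ι → Finset (Zd d)) (U : Finset ι) (l : ℕ) (hl : 1 ≤ l)
    (hB : ∀ V ⊆ U, ∀ j ∈ U, j ∉ V → ∀ x ∈ B j, ∀ T, 2 * l * vG (V.biUnion B) T x ≤ 1) (T : ℕ) :
    ∑ S ∈ U.powerset, ((l ^ S.card - 1 : ℕ) : ℝ≥0∞) * Measure.sum P {w | vH B U T w = S}
      ≤ 2 * l * (T * (U.biUnion B).card) := by
  have h1 : ∀ x, ∑ S ∈ U.powerset, ((l ^ S.card - 1 : ℕ) : ℝ≥0∞) * P x {w | vH B U T w = S}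
      ≤ 2 * l * vG (U.biUnion B) T x := by
    intro x
    have := hP.1 x
    have h2 := vmoment hd hP B U l hl hB T U le_rfl x
    rw [← vH_lint B U T (fun S => ((l ^ S.card - 1 : ℕ) : ℝ≥0∞))]
    have h3 : ∫⁻ w, (l : ℝ≥0∞) ^ (vH B U T w).card ∂(P x)
        = 1 + ∫⁻ w, ((l ^ (vH B U T w).card - 1 : ℕ) : ℝ≥0∞) ∂(P x) := by
      have : ∫⁻ w, (1 : ℝ≥0∞) ∂(P x) = 1 := by simp
      conv_rhs => rw [← this]
      rw [← lintegral_add_left measurable_const]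
      apply lintegral_congr
      intro w
      have : 1 ≤ l ^ (vH B U T w).card := Nat.one_le_pow _ _ hl
      norm_cast
      omega
    rw [h3] at h2
    exact (ENNReal.add_le_add_iff_left (by simp)).1 h2
  calc _ = ∑' x, ∑ S ∈ U.powerset, ((l ^ S.card - 1 : ℕ) : ℝ≥0∞) * P x {w | vH B U T w = S} := by
        rw [Summable.tsum_finsetSum (fun _ _ => ENNReal.summable)]
        apply Finset.sum_congr rfl
        intro S _
        rw [Measure.sum_apply _ (vH_meas B U T S), ENNReal.tsum_mul_left]
    _ ≤ ∑' x, 2 * l * vG (U.biUnion B) T x := ENNReal.tsum_le_tsum h1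
    _ = _ := by rw [ENNReal.tsum_mul_left, vG_tsum hd]

theorem vhit_decomp {d : ℕ} (P : Zd d → Measure (ℕ → Zd d))
    {ι : Type*} [DecidableEq ι] (B : ι → Finset (Zd d)) (U J : Finset ι) (hJ : J ⊆ U) (T : ℕ) :
    Measure.sum P (vhit (J.biUnion B) T) =
      ∑ S ∈ U.powerset, (if Disjoint S J then 0 else Measure.sum P {w | vH B U T w = S}) := by
  have := vH_lint B U T (fun S => if Disjoint S J then 0 else 1) (Measure.sum P)
  simp only [ite_mul, zero_mul, one_mul] at this
  rw [← this, ← lintegral_indicator_one (vhit_meas _ _)]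
  apply lintegral_congr
  intro w
  have : w ∈ vhit (J.biUnion B) T ↔ ¬ Disjoint (vH B U T w) J := by
    rw [Finset.not_disjoint_iff]
    simp only [mem_vH, vhit, Finset.mem_biUnion, Set.mem_ofPred_eq]
    constructor
    · rintro ⟨k, hk, v, hv, h⟩
      exact ⟨v, ⟨hJ hv, k, hk, h⟩, hv⟩
    · rintro ⟨v, ⟨_, k, hk, h⟩, hv⟩
      exact ⟨k, hk, v, hv, h⟩
  by_cases h : w ∈ vhit (J.biUnion B) T
  · rw [Set.indicator_of_mem h, if_neg (this.1 h)]; rfl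
  · rw [Set.indicator_of_notMem h, if_pos (by tauto)]

theorem vbad {d : ℕ} (hd : 7 ≤ d) {P : Zd d → Measure (ℕ → Zd d)} (hP : IsSRW d P)
    {ι : Type*} [DecidableEq ι] (B : ι → Finset (Zd d)) (U : Finset ι) (l : ℕ) (hl : 1 ≤ l)
    (hB : ∀ V ⊆ U, ∀ j ∈ U, j ∉ V → ∀ x ∈ B j, ∀ T, 2 * l * vG (V.biUnion B) T x ≤ 1)
    (u : ℝ) (hu : 0 < u) (Q : Measure (Zd d → Bool)) (hQ : IsVacantLaw d P u Q) :
    Q.real {ω | ∀ v ∈ U, ∃ z ∈ B v, ω z = false} ≤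
      ((l : ℝ)⁻¹) ^ U.card * Real.exp (u * (2 * l * (U.biUnion B).card)) := by
  have := hQ.1
  have hl' : (1 : ℝ) ≤ l := by exact_mod_cast hl
  have hA : ∀ v, MeasurableSet {ω : Zd d → Bool | ∀ z ∈ B v, ω z = true} := by
    intro v
    have : {ω : Zd d → Bool | ∀ z ∈ B v, ω z = true} = ⋂ z ∈ B v, {ω | ω z = true} := by
      ext; simp
    rw [this]
    exact Finset.measurableSet_biInter _ fun z _ =>
      (measurable_pi_apply z : Measurable fun ω : Zd d → Bool => ω z)
        (measurableSet_singleton true)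
  have e1 := vp_incl_excl Q (fun v => {ω : Zd d → Bool | ∀ z ∈ B v, ω z = true}) hA U
  have e2 : {ω : Zd d → Bool | ∀ v ∈ U, ∃ z ∈ B v, ω z = false}
      = {ω | ∀ i ∈ U, ω ∉ (fun v => {ω : Zd d → Bool | ∀ z ∈ B v, ω z = true}) i} := by
    ext ω; simp
  rw [e2, e1]
  have e3 : ∀ J : Finset ι, Q.real {ω | ∀ i ∈ J, ω ∈ (fun v => {ω : Zd d → Bool | ∀ z ∈ B v, ω z = true}) i}
      = Real.exp (-(u * (capa d P (J.biUnion B)).toReal)) := by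
    intro J
    have : {ω | ∀ i ∈ J, ω ∈ (fun v => {ω : Zd d → Bool | ∀ z ∈ B v, ω z = true}) i}
      = {ω : Zd d → Bool | ∀ z ∈ J.biUnion B, ω z = true} := by
      ext ω
      simp only [Set.mem_ofPred_eq, Finset.mem_biUnion]
      exact ⟨fun h z ⟨v, hv, hz⟩ => h v hv z hz, fun h v hv z hz => h z ⟨v, hv, hz⟩⟩
    rw [this, measureReal_def, hQ.2, ENNReal.toReal_ofReal (Real.exp_pos _).le]
  simp_rw [e3]
  have hlim : Filter.Tendsto (fun T : ℕ => ∑ J ∈ U.powerset, (-1 : ℝ) ^ J.card *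
      Real.exp (-(u * ((T : ℝ)⁻¹ * (Measure.sum P (vhit (J.biUnion B) T)).toReal)))) Filter.atTop
      (nhds (∑ J ∈ U.powerset, (-1 : ℝ) ^ J.card *
        Real.exp (-(u * (capa d P (J.biUnion B)).toReal)))) := by
    apply tendsto_finsetSum
    intro J _
    apply Filter.Tendsto.const_mul
    apply (Real.continuous_exp.tendsto _).comp
    apply Filter.Tendsto.neg
    exact (vcap_lim hd hP _).const_mul u
  refine le_of_tendsto hlim ?_
  filter_upwards [Filter.eventually_ge_atTop 1] with T hT
  have hT' : (0:ℝ) < T := by exact_mod_cast hT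
  set m : Finset ι → ℝ≥0∞ := fun S => Measure.sum P {w | vH B U T w = S} with hm
  have hfin : ∀ S ∈ U.powerset, ∀ J, ¬ Disjoint S J → m S ≠ ∞ := by
    intro S hS J hSJ
    refine ne_top_of_le_ne_top (vhit_fin hd hP (U.biUnion B) T) (measure_mono ?_)
    rintro w rfl
    obtain ⟨v, hv, -⟩ := Finset.not_disjoint_iff.1 hSJ
    obtain ⟨hv, k, hk, h⟩ := (mem_vH _ _ _ _ _).1 hv
    exact ⟨k, hk, Finset.mem_biUnion.2 ⟨v, hv, h⟩⟩
  have key := vp_cover_exp (l : ℝ) hl' (fun S => u * ((T:ℝ)⁻¹ * (m S).toReal))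
    (fun S => by positivity) U.powerset U
  refine le_trans (le_of_eq ?_) (key.trans ?_)
  · apply Finset.sum_congr rfl
    intro J hJ
    rw [vhit_decomp P B U J (Finset.mem_powerset.1 hJ), ENNReal.toReal_sum]
    · rw [Finset.mul_sum, Finset.mul_sum]
      congr 3
      apply Finset.sum_congr rfl
      intro S _
      split_ifs <;> simp [hm]
    · intro S hS
      split_ifs with h
      · simp
      · exact hfin S hS J h
  · apply mul_le_mul_of_nonneg_left _ (by positivity)
    apply Real.exp_le_exp.2
    have hs := vmoment_sum hd hP B U l hl hB T
    have h2 : (2 * (l : ℝ≥0∞) * (T * (U.biUnion B).card)) ≠ ∞ := by finiteness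
    have hs2 := ENNReal.toReal_mono h2 hs
    rw [ENNReal.toReal_sum] at hs2
    · simp only [ENNReal.toReal_mul, ENNReal.toReal_natCast, ENNReal.toReal_ofNat] at hs2
      have e5 : ∑ S ∈ U.powerset, u * ((T:ℝ)⁻¹ * (m S).toReal) * ((l:ℝ) ^ S.card - 1)
          = u * (T:ℝ)⁻¹ * ∑ S ∈ U.powerset, ((l ^ S.card - 1 : ℕ) : ℝ) * (m S).toReal := by
        rw [Finset.mul_sum]
        apply Finset.sum_congr rfl
        intro S _
        rw [Nat.cast_sub (Nat.one_le_pow _ _ hl)]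
        push_cast
        ring
      rw [e5]
      calc _ ≤ u * (T:ℝ)⁻¹ * (2 * l * (T * (U.biUnion B).card)) := by gcongr
        _ = _ := by field_simp
    · intro S hS
      by_cases hS0 : S = ∅
      · simp [hS0]
      · refine ENNReal.mul_ne_top (by simp) (hfin S hS S ?_)
        rwa [disjoint_self]


def vplane {d : ℕ} (x : Zd d) : Prop := ∀ i : Fin d, 2 ≤ i.val → x i = 0

noncomputable def vs {d : ℕ} (x : Zd d) : ℝ := ∑ i : Fin d, if 2 ≤ i.val then (x i : ℝ) ^ 2 else 0

theorem vs_nonneg {d : ℕ} (x : Zd d) : 0 ≤ vs x :=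
  Finset.sum_nonneg fun i _ => by split_ifs <;> positivity

theorem vs_step {d : ℕ} (x : Zd d) (e : Fin d × Bool) :
    vs (x + vstep e) = vs x + if 2 ≤ e.1.val then
      (1 + 2 * (if e.2 then 1 else -1) * (x e.1 : ℝ)) else 0 := by
  unfold vs
  rw [← sub_eq_iff_eq_add', ← Finset.sum_sub_distrib, Finset.sum_eq_single e.1]
  · by_cases h : 2 ≤ e.1.val
    · simp only [h, if_true, Pi.add_apply, vstep, Pi.single_eq_same]
      cases e.2 <;> push_cast <;> simp <;> ring
    · simp [h]
  · intro j _ hj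
    simp [vstep, Pi.single_eq_of_ne hj]
  · simp

theorem vcoordineq (r y : ℝ) (hr : 4 ≤ r) (hy : y ^ 2 ≤ r - 4) :
    (r + 1 + 2 * y)⁻¹ + (r + 1 - 2 * y)⁻¹ ≤
      2 / (r + 1) + 8 * y ^ 2 / ((r + 1) * ((r + 1) ^ 2 - 4 * (r + 1) + 20)) := by
  have h1 : 0 < r + 1 + 2 * y := by nlinarith [sq_nonneg (y + 1)]
  have h2 : 0 < r + 1 - 2 * y := by nlinarith [sq_nonneg (y - 1)]
  have hD : 0 < (r + 1) ^ 2 - 4 * (r + 1) + 20 := by nlinarith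
  have hE : (r + 1) ^ 2 - 4 * (r + 1) + 20 ≤ (r + 1) ^ 2 - 4 * y ^ 2 := by nlinarith
  have e : (r + 1 + 2 * y)⁻¹ + (r + 1 - 2 * y)⁻¹ =
      2 / (r + 1) + 8 * y ^ 2 / ((r + 1) * ((r + 1) ^ 2 - 4 * y ^ 2)) := by
    have h3 : (r + 1) ^ 2 - 4 * y ^ 2 = (r + 1 + 2 * y) * (r + 1 - 2 * y) := by ring
    have h4 : (r + 1) ≠ 0 := by linarith
    rw [h3]
    field_simp
    ring
  rw [e]
  gcongr

theorem vlyap_real {d : ℕ} (hd : 7 ≤ d) (x : Zd d) :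
    (2 * d : ℝ)⁻¹ * (∑ e : Fin d × Bool, (4 + vs (x + vstep e))⁻¹)
      + (4 * d : ℝ)⁻¹ * (if vs x = 0 then 1 else 0) ≤ (4 + vs x)⁻¹ := by
  have hd0 : (7:ℝ) ≤ d := by exact_mod_cast hd
  set s := vs x with hs
  have hs0 : 0 ≤ s := vs_nonneg x
  set D := (4 + s + 1) ^ 2 - 4 * (4 + s + 1) + 20 with hDdef
  have hD : 0 < D := by nlinarith
  have h1 : ∑ e : Fin d × Bool, (4 + vs (x + vstep e))⁻¹ ≤
      ∑ i : Fin d, (2 / (4 + s) + (if 2 ≤ i.val then (2 / (4 + s + 1) - 2 / (4 + s)) else 0)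
        + 8 / ((4 + s + 1) * D) * (if 2 ≤ i.val then (x i : ℝ) ^ 2 else 0)) := by
    rw [Fintype.sum_prod_type]
    apply Finset.sum_le_sum
    intro i _
    simp only [Fintype.sum_bool, vs_step]
    by_cases h : 2 ≤ i.val
    · simp only [h, if_true]
      have hy : (x i : ℝ) ^ 2 ≤ (4 + s) - 4 := by
        have := Finset.single_le_sum (f := fun i : Fin d => if 2 ≤ i.val then (x i : ℝ) ^ 2 else 0)
          (fun i _ => by split_ifs <;> positivity) (Finset.mem_univ i)
        simp only [h, if_true] at this
        rw [hs]
        unfold vs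
        linarith
      have := vcoordineq (4 + s) (x i) (by linarith) hy
      calc _ = (4 + s + 1 + 2 * (x i : ℝ))⁻¹ + (4 + s + 1 - 2 * (x i : ℝ))⁻¹ := by
            simp only [Bool.false_eq_true, if_false]
            congr 2 <;> ring
        _ ≤ _ := this
        _ = _ := by rw [← hDdef]; ring
    · simp only [h, if_false]
      apply le_of_eq
      rw [← hs]
      ring
  have hcount : ∑ i : Fin d, (if 2 ≤ i.val then (2 / (4 + s + 1) - 2 / (4 + s)) else 0)
      = (d - 2) * (2 / (4 + s + 1) - 2 / (4 + s)) := by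
    obtain ⟨m, rfl⟩ : ∃ m, d = m + 2 := ⟨d - 2, by omega⟩
    rw [Fin.sum_univ_succ, Fin.sum_univ_succ]
    have : ∀ i : Fin m, 2 ≤ i.succ.succ.val := by intro i; simp
    simp only [this, if_true]
    simp
    ring
  rw [Finset.sum_add_distrib, Finset.sum_add_distrib, hcount, ← Finset.mul_sum] at h1
  change _ ≤ _ + _ + _ * vs x at h1
  rw [← hs] at h1
  simp only [Finset.sum_const, Finset.card_univ, Fintype.card_fin, nsmul_eq_mul] at h1
  have h2 : 4 * s / D ≤ 5 / (4 + s) := by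
    rw [div_le_div_iff₀ hD (by linarith)]
    nlinarith
  have h3 : 8 / ((4 + s + 1) * D) * s = 2 / (4 + s + 1) * (4 * s / D) := by
    field_simp
    ring
  have h4 : 2 / (4 + s + 1) * (4 * s / D) ≤ 2 / (4 + s + 1) * (5 / (4 + s)) := by
    apply mul_le_mul_of_nonneg_left h2 (by positivity)
  have h5 : 2 / (4 + s + 1) - 2 / (4 + s) = - (2 / (4 + s + 1) * (1 / (4 + s))) := by
    field_simp
    ring
  rw [h3, h5] at h1
  by_cases hz : s = 0
  · simp only [hz, if_true] at h1 ⊢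
    norm_num at h1 ⊢
    have : (d:ℝ)⁻¹ * 2⁻¹ * (∑ e : Fin d × Bool, (4 + vs (x + vstep e))⁻¹) ≤
        (d:ℝ)⁻¹ * 2⁻¹ * (d * (1/2) - (d-2) * (1/10)) := by
      gcongr; linarith
    have h6 : (d:ℝ)⁻¹ * 2⁻¹ * (d * (1/2) - (d-2) * (1/10)) + (d:ℝ)⁻¹ * 4⁻¹ ≤ 4⁻¹ := by
      have : (d:ℝ)⁻¹ * 2⁻¹ * (d * (1/2) - (d-2) * (1/10)) + (d:ℝ)⁻¹ * 4⁻¹ =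
         4⁻¹ - (d:ℝ)⁻¹ * ((d - 2) / 20 - 1/4) := by field_simp; ring
      rw [this]
      have : 0 ≤ (d:ℝ)⁻¹ * ((d - 2) / 20 - 1/4) := by
        apply mul_nonneg (by positivity); linarith
      linarith
    linarith
  · simp only [hz, if_false, mul_zero, add_zero]
    have h7 : 0 ≤ 2 / (4 + s + 1) * (1 / (4 + s)) := by positivity
    have h8 : ∑ e : Fin d × Bool, (4 + vs (x + vstep e))⁻¹ ≤ d * (2 / (4 + s)) := by
      have : 2 / (4 + s + 1) * (5 / (4 + s)) = 5 * (2 / (4 + s + 1) * (1 / (4 + s))) := by ring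
      nlinarith
    calc _ ≤ (2 * d : ℝ)⁻¹ * (d * (2 / (4 + s))) := by gcongr
      _ = _ := by field_simp

theorem vs_plane {d : ℕ} (x : Zd d) (h : vplane x) : vs x = 0 := by
  unfold vs
  apply Finset.sum_eq_zero
  intro i _
  split_ifs with h2
  · simp [h i h2]
  · rfl

open Classical in
noncomputable def vpl {d : ℕ} (x : Zd d) : ℝ≥0∞ := if vplane x then 1 else 0

noncomputable def vf {d : ℕ} (x : Zd d) : ℝ≥0∞ := ENNReal.ofReal (4 + vs x)⁻¹

theorem vlyap {d : ℕ} (hd : 7 ≤ d) (x : Zd d) :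
    vA vf x + ENNReal.ofReal (4 * d : ℝ)⁻¹ * vpl x ≤ vf x := by
  have hd0 : (0:ℝ) < d := by exact_mod_cast (by omega : 0 < d)
  have hn : ∀ y : Zd d, 0 ≤ (4 + vs y)⁻¹ := fun y => inv_nonneg.2 (by linarith [vs_nonneg y])
  have h1 : vA vf x = ENNReal.ofReal ((2 * d : ℝ)⁻¹ *
      (∑ e : Fin d × Bool, (4 + vs (x + vstep e))⁻¹)) := by
    unfold vA vf
    rw [ENNReal.ofReal_mul (by positivity), ENNReal.ofReal_sum_of_nonneg (fun e _ => hn _),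
      ENNReal.ofReal_inv_of_pos (by positivity), ENNReal.ofReal_mul (by norm_num)]
    simp
  have h2 : vpl x ≤ ENNReal.ofReal (if vs x = 0 then 1 else 0) := by
    unfold vpl
    split_ifs with h h3
    · simp
    · exact absurd (vs_plane x h) h3
    · simp
    · simp
  calc _ ≤ ENNReal.ofReal ((2 * d : ℝ)⁻¹ *
      (∑ e : Fin d × Bool, (4 + vs (x + vstep e))⁻¹)) +
        ENNReal.ofReal (4 * d : ℝ)⁻¹ * ENNReal.ofReal (if vs x = 0 then 1 else 0) := by
        rw [h1]; gcongr
    _ = ENNReal.ofReal ((2 * d : ℝ)⁻¹ * (∑ e : Fin d × Bool, (4 + vs (x + vstep e))⁻¹)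
      + (4 * d : ℝ)⁻¹ * (if vs x = 0 then 1 else 0)) := by
        rw [← ENNReal.ofReal_mul (by positivity), ← ENNReal.ofReal_add]
        · exact mul_nonneg (by positivity) (Finset.sum_nonneg fun e _ => hn _)
        · split_ifs <;> positivity
    _ ≤ _ := ENNReal.ofReal_le_ofReal (vlyap_real hd x)

noncomputable def vq {d : ℕ} (g : Zd d → ℝ≥0∞) : ℕ → Zd d → ℝ≥0∞
  | 0 => g
  | t + 1 => vA (vq g t)

theorem vA_sum {d : ℕ} (s : Finset ℕ) (f : ℕ → Zd d → ℝ≥0∞) (x : Zd d) :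
    vA (fun y => ∑ t ∈ s, f t y) x = ∑ t ∈ s, vA (f t) x := by
  unfold vA
  rw [Finset.sum_comm, Finset.mul_sum]

theorem vq_pl_bound {d : ℕ} (hd : 7 ≤ d) (T : ℕ) : ∀ x : Zd d,
    ENNReal.ofReal (4 * d : ℝ)⁻¹ * ∑ t ∈ Finset.range T, vq vpl t x ≤ vf x := by
  induction T with
  | zero => intro x; simp
  | succ T ih =>
    intro x
    refine le_trans ?_ (vlyap hd x)
    rw [Finset.sum_range_succ', mul_add]
    gcongr
    · refine le_trans (le_of_eq ?_) (vA_mono ih x)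
      have := vA_affine hd 0 (ENNReal.ofReal (4 * d : ℝ)⁻¹)
        (fun y : Zd d => ∑ t ∈ Finset.range T, vq vpl t y) x
      simp only [zero_add] at this
      rw [this, vA_sum]
      rfl
    · exact le_rfl

theorem vq_pl_summable {d : ℕ} (hd : 7 ≤ d) : ∑' t, vq (d := d) vpl t 0 ≠ ∞ := by
  have hd0 : (0:ℝ) < d := by exact_mod_cast (by omega : 0 < d)
  have h1 : ∑' t, vq (d := d) vpl t 0 ≤ (ENNReal.ofReal (4 * d : ℝ)⁻¹)⁻¹ * vf (0 : Zd d) := by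
    rw [ENNReal.tsum_eq_iSup_nat]
    apply iSup_le
    intro T
    have h := vq_pl_bound hd T (0 : Zd d)
    have h0 : ENNReal.ofReal (4 * d : ℝ)⁻¹ ≠ 0 := by
      rw [Ne, ENNReal.ofReal_eq_zero, not_le]; positivity
    rw [← ENNReal.div_eq_inv_mul, ENNReal.le_div_iff_mul_le (Or.inl h0) (Or.inl ENNReal.ofReal_ne_top),
      mul_comm]
    exact h
  refine ne_top_of_le_ne_top (ENNReal.mul_ne_top ?_ ?_) h1
  · rw [ENNReal.inv_ne_top, Ne, ENNReal.ofReal_eq_zero, not_le]; positivity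
  · exact ENNReal.ofReal_ne_top

theorem vq_pl_trans {d : ℕ} (z : Zd d) (hz : vplane z) (t : ℕ) :
    ∀ x : Zd d, vq vpl t (z + x) = vq vpl t x := by
  induction t with
  | zero =>
    intro x
    change vpl (z + x) = vpl x
    unfold vpl
    have : vplane (z + x) ↔ vplane x := by
      unfold vplane
      refine forall_congr' fun i => forall_congr' fun hi => ?_
      simp [hz i hi]
    by_cases h : vplane x
    · rw [if_pos h, if_pos (this.2 h)]
    · rw [if_neg h, if_neg (fun h2 => h (this.1 h2))]
  | succ t ih =>
    intro x
    simp only [vq, vA]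
    congr 1
    apply Finset.sum_congr rfl
    intro e _
    rw [add_assoc, ih]

theorem vG_eq {d : ℕ} (K : Finset (Zd d)) (T : ℕ) : ∀ x,
    vG K T x = ∑ t ∈ Finset.range T, vq (fun x => if x ∈ K then 1 else 0) t x := by
  induction T with
  | zero => intro x; simp [vG]
  | succ T ih =>
    intro x
    rw [Finset.sum_range_succ', vG, add_comm]
    congr 1
    rw [show vG K T = fun y => ∑ t ∈ Finset.range T, vq (fun x => if x ∈ K then 1 else 0) t y from
      funext ih, vA_sum]
    rfl

theorem vq_mono {d : ℕ} {f g : Zd d → ℝ≥0∞} (h : ∀ x, f x ≤ g x) (t : ℕ) :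
    ∀ x, vq f t x ≤ vq g t x := by
  induction t with
  | zero => exact h
  | succ t ih => exact fun x => vA_mono ih x

theorem vq_far {d : ℕ} (K : Finset (Zd d)) (t : ℕ) : ∀ (n : ℕ) (x : Zd d),
    (∀ y ∈ K, ∃ i, (n : ℤ) ≤ |y i - x i|) → t < n → vq (fun x => if x ∈ K then 1 else 0) t x = 0 := by
  induction t with
  | zero =>
    intro n x h hn
    simp only [vq]
    rw [if_neg]
    intro hx
    obtain ⟨i, hi⟩ := h x hx
    simp at hi
    omega
  | succ t ih =>
    intro n x h hn
    simp only [vq, vA]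
    rw [Finset.sum_eq_zero, mul_zero]
    intro e _
    apply ih (n - 1) _ _ (by omega)
    intro y hy
    obtain ⟨i, hi⟩ := h y hy
    refine ⟨i, ?_⟩
    have h1 : |vstep e i| ≤ 1 := by
      by_cases hie : i = e.1
      · subst hie
        cases h : e.2 <;> simp [vstep, h]
      · simp [vstep, Pi.single_eq_of_ne hie]
    rw [Pi.add_apply]
    have h2 := abs_sub_abs_le_abs_sub (y i - x i) (vstep e i)
    have h3 : y i - x i - vstep e i = y i - (x i + vstep e i) := by ring
    rw [h3] at h2
    omega

theorem vG_tail {d : ℕ} (K : Finset (Zd d)) (hK : ∀ y ∈ K, vplane y) (x : Zd d)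
    (hx : vplane x) (L : ℕ) (h : ∀ y ∈ K, ∃ i, (L : ℤ) ≤ |y i - x i|) (T : ℕ) :
    vG K T x ≤ ∑' k, vq (d := d) vpl (k + L) 0 := by
  have h0 : ∀ t, vq (fun x => if x ∈ K then 1 else 0) t x ≤ vq (d := d) vpl t 0 := by
    intro t
    have := vq_pl_trans x hx t 0
    rw [add_zero] at this
    rw [← this]
    apply vq_mono
    intro y
    unfold vpl
    split_ifs with h1 h2
    · exact le_rfl
    · exact absurd (hK y h1) h2
    · simp
    · simp
  rw [vG_eq]
  calc _ ≤ ∑ t ∈ Finset.range (L + T), vq (fun x => if x ∈ K then 1 else 0) t x :=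
        Finset.sum_le_sum_of_subset (Finset.range_mono (by omega))
    _ = ∑ k ∈ Finset.range T, vq (fun x => if x ∈ K then 1 else 0) (L + k) x := by
        rw [Finset.sum_range_add, Finset.sum_eq_zero, zero_add]
        intro t ht
        exact vq_far K t L x h (Finset.mem_range.1 ht)
    _ ≤ ∑ k ∈ Finset.range T, vq (d := d) vpl (k + L) 0 := by
        apply Finset.sum_le_sum
        intro k _
        rw [add_comm]
        exact h0 _
    _ ≤ _ := ENNReal.sum_le_tsum _

def vemb (d : ℕ) (v : ℤ × ℤ) : Zd d := fun i => if i.val = 0 then v.1 else if i.val = 1 then v.2 else 0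

def vB (d L : ℕ) (v : ℤ × ℤ) : Finset (Zd d) :=
  (Finset.range L ×ˢ Finset.range L).image
    (fun p : ℕ × ℕ => vemb d (L * v.1 + p.1, L * v.2 + p.2))

theorem vB_card (d L : ℕ) (v : ℤ × ℤ) : (vB d L v).card ≤ L * L := by
  refine Finset.card_image_le.trans ?_
  simp

theorem vB_mem (d L : ℕ) (v : ℤ × ℤ) (x : Zd d) : x ∈ vB d L v ↔
    ∃ a b : ℕ, a < L ∧ b < L ∧ x = vemb d (L * v.1 + a, L * v.2 + b) := by
  simp only [vB, Finset.mem_image, Finset.mem_product, Finset.mem_range, Prod.exists]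
  constructor
  · rintro ⟨a, b, ⟨ha, hb⟩, rfl⟩
    exact ⟨a, b, ha, hb, rfl⟩
  · rintro ⟨a, b, ha, hb, rfl⟩
    exact ⟨a, b, ⟨ha, hb⟩, rfl⟩

theorem vemb_plane (d : ℕ) (v : ℤ × ℤ) : vplane (vemb d v) := by
  intro i hi
  have h0 : i.val ≠ 0 := by omega
  have h1 : i.val ≠ 1 := by omega
  simp [vemb, h0, h1]

theorem vsep1 (L : ℕ) (p q : ℤ) (a b : ℕ) (ha : a < L) (hb : b < L) (hpar : p % 2 = q % 2)
    (hne : p ≠ q) : (L : ℤ) ≤ |(L * q + b) - (L * p + a)| := by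
  have h : q ≤ p - 2 ∨ p + 2 ≤ q := by omega
  rcases h with h | h
  · have : (L:ℤ) * q ≤ L * (p - 2) := mul_le_mul_of_nonneg_left h (by positivity)
    rw [le_abs]; right
    have e : (L:ℤ) * (p - 2) = L * p - 2 * L := by ring
    omega
  · have : (L:ℤ) * (p + 2) ≤ L * q := mul_le_mul_of_nonneg_left h (by positivity)
    rw [le_abs]; left
    have e : (L:ℤ) * (p + 2) = L * p + 2 * L := by ring
    omega

theorem vboxes {d : ℕ} (hd : 7 ≤ d) (l : ℕ) (hl : 1 ≤ l) : ∃ L : ℕ, 1 ≤ L ∧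
    ∀ U : Finset (ℤ × ℤ), (∀ v ∈ U, ∀ w ∈ U, v.1 % 2 = w.1 % 2 ∧ v.2 % 2 = w.2 % 2) →
    ∀ V ⊆ U, ∀ j ∈ U, j ∉ V → ∀ x ∈ vB d L j, ∀ T,
      2 * (l : ℝ≥0∞) * vG (V.biUnion (vB d L)) T x ≤ 1 := by
  have h1 := ENNReal.tendsto_sum_nat_add (vq (d := d) vpl · 0) (vq_pl_summable hd)
  have hpos : (0 : ℝ≥0∞) < (2 * (l : ℝ≥0∞))⁻¹ := by
    rw [ENNReal.inv_pos]; finiteness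
  obtain ⟨L, hL, hL1⟩ := ((h1.eventually (gt_mem_nhds hpos)).and
    (Filter.eventually_ge_atTop 1)).exists
  refine ⟨L, hL1, ?_⟩
  intro U hU V hV j hj hjV x hx T
  have key : vG (V.biUnion (vB d L)) T x ≤ (2 * (l : ℝ≥0∞))⁻¹ := by
    refine le_trans (vG_tail _ ?_ x ?_ L ?_ T) hL.le
    · intro y hy
      obtain ⟨v, _, hy⟩ := Finset.mem_biUnion.1 hy
      obtain ⟨a, b, _, _, rfl⟩ := (vB_mem _ _ _ _).1 hy
      exact vemb_plane _ _
    · obtain ⟨a, b, _, _, rfl⟩ := (vB_mem _ _ _ _).1 hx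
      exact vemb_plane _ _
    · intro y hy
      obtain ⟨v, hv, hy⟩ := Finset.mem_biUnion.1 hy
      obtain ⟨a, b, ha, hb, rfl⟩ := (vB_mem _ _ _ _).1 hx
      obtain ⟨a', b', ha', hb', rfl⟩ := (vB_mem _ _ _ _).1 hy
      have hp := hU j hj v (hV hv)
      have hne : j ≠ v := by rintro rfl; exact hjV hv
      by_cases h : j.1 = v.1
      · have h2 : j.2 ≠ v.2 := fun h2 => hne (Prod.ext h h2)
        refine ⟨⟨1, by omega⟩, ?_⟩
        simp only [vemb, one_ne_zero, if_false, if_true]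
        exact vsep1 L _ _ b b' hb hb' hp.2 h2
      · refine ⟨⟨0, by omega⟩, ?_⟩
        simp only [vemb, if_true]
        exact vsep1 L _ _ a a' ha ha' hp.1 h
  calc _ ≤ 2 * (l : ℝ≥0∞) * (2 * (l : ℝ≥0∞))⁻¹ := by gcongr
    _ ≤ 1 := ENNReal.mul_inv_le_one _


def vnb (a b : ℤ × ℤ) : Prop :=
  (a.1 = b.1 ∧ (a.2 = b.2 + 1 ∨ b.2 = a.2 + 1)) ∨ (a.2 = b.2 ∧ (a.1 = b.1 + 1 ∨ b.1 = a.1 + 1))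

def vst (a b : ℤ × ℤ) : Prop := |a.1 - b.1| ≤ 1 ∧ |a.2 - b.2| ≤ 1

theorem vnb_symm {a b : ℤ × ℤ} (h : vnb a b) : vnb b a := by
  unfold vnb at *; omega

abbrev vR (X : Set (ℤ × ℤ)) : ℤ × ℤ → ℤ × ℤ → Prop :=
  Relation.ReflTransGen (fun a b => vnb a b ∧ b ∈ X)

theorem vR_mem {X : Set (ℤ × ℤ)} {a b : ℤ × ℤ} (ha : a ∈ X) (h : vR X a b) : b ∈ X := by
  induction h with
  | refl => exact ha
  | tail _ h _ => exact h.2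

theorem vR_symm {X : Set (ℤ × ℤ)} {a b : ℤ × ℤ} (ha : a ∈ X) (h : vR X a b) : vR X b a := by
  induction h with
  | refl => exact .refl
  | tail h1 h2 ih => exact .head ⟨vnb_symm h2.1, vR_mem ha h1⟩ ih

theorem vR_line {X : Set (ℤ × ℤ)} (γ : ℕ → ℤ × ℤ) (n : ℕ) (h1 : ∀ i, vnb (γ i) (γ (i + 1)))
    (h2 : ∀ i ≤ n, γ i ∈ X) : vR X (γ 0) (γ n) := by
  induction n with
  | zero => exact .refl
  | succ n ih => exact .tail (ih fun i hi => h2 i (by omega)) ⟨h1 n, h2 _ le_rfl⟩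

theorem vprim {G : Type*} [AddCommGroup G] (g : ℤ → G) (c : G) :
    ∃ Φ : ℤ → G, Φ 0 = c ∧ ∀ n, Φ (n + 1) = Φ n + g n := by
  refine ⟨fun n => match n with
    | Int.ofNat n => c + ∑ i ∈ Finset.range n, g i
    | Int.negSucc n => c - ∑ i ∈ Finset.range (n + 1), g (-(i + 1 : ℤ)), ?_, ?_⟩
  · change c + ∑ i ∈ Finset.range 0, g i = c
    simp
  · intro n
    match n with
    | Int.ofNat n =>
      change c + ∑ i ∈ Finset.range (n + 1), g i = c + ∑ i ∈ Finset.range n, g i + g n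
      rw [Finset.sum_range_succ, add_assoc]
    | Int.negSucc 0 =>
      change c + ∑ i ∈ Finset.range 0, g i = c - ∑ i ∈ Finset.range (0 + 1), g (-(i + 1 : ℤ)) + g (-1)
      simp
    | Int.negSucc (n + 1) =>
      change c - ∑ i ∈ Finset.range (n + 1), g (-(i + 1 : ℤ)) =
        c - ∑ i ∈ Finset.range (n + 1 + 1), g (-(i + 1 : ℤ)) + g (Int.negSucc (n + 1))
      rw [Finset.sum_range_succ _ (n + 1)]
      have : Int.negSucc (n + 1) = -(((n + 1 : ℕ) : ℤ) + 1) := by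
        rw [Int.negSucc_eq]
      rw [this]
      abel

theorem vpot {G : Type*} [AddCommGroup G] (fh fv : ℤ → ℤ → G)
    (h : ∀ x y, fh x y + fv (x + 1) y = fv x y + fh x (y + 1)) :
    ∃ φ : ℤ → ℤ → G, (∀ x y, φ (x + 1) y = φ x y + fh x y) ∧ ∀ x y, φ x (y + 1) = φ x y + fv x y := by
  obtain ⟨A, -, hA⟩ := vprim (fun x => fh x 0) 0
  choose B hB0 hB using fun x => vprim (fv x) (A x)
  refine ⟨B, ?_, hB⟩
  intro x y
  induction y using Int.induction_on with
  | zero => rw [hB0, hB0, hA]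
  | succ y ih =>
    rw [hB, hB, ih, add_assoc, h, add_assoc]
  | pred y ih =>
    have e1 := hB (x + 1) (-(y:ℤ) - 1)
    have e2 := hB x (-(y:ℤ) - 1)
    have e3 := h x (-(y:ℤ) - 1)
    rw [sub_add_cancel] at e1 e2 e3
    have : B (x + 1) (-(y:ℤ) - 1) + fv (x + 1) (-(y:ℤ) - 1)
        = (B x (-(y:ℤ) - 1) + fh x (-(y:ℤ) - 1)) + fv (x + 1) (-(y:ℤ) - 1) := by
      rw [← e1, ih, e2, add_assoc, add_assoc, e3]
    exact add_right_cancel this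

def vedge (Da Db Ra Rb : Bool) : ZMod 2 := if (Ra && !Db) ^^ (Rb && !Da) then 1 else 0

set_option maxRecDepth 100000 in
theorem vplaq : ∀ D0 D1 D2 D3 R0 R1 R2 R3 : Bool,
    (R0 → D0) → (R1 → D1) → (R2 → D2) → (R3 → D3) →
    ((R0 || R1 || R2 || R3) →
      ((D0 && !D1) → R0) ∧ ((D0 && !D3) → R0) ∧ ((D1 && !D0) → R1) ∧ ((D1 && !D2) → R1) ∧
      ((D2 && !D1) → R2) ∧ ((D2 && !D3) → R2) ∧ ((D3 && !D0) → R3) ∧ ((D3 && !D2) → R3)) →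
    vedge D0 D1 R0 R1 + vedge D1 D2 R1 R2 = vedge D0 D3 R0 R3 + vedge D3 D2 R3 R2 := by
  intro D0 D1 D2 D3 R0 R1 R2 R3
  cases D0 <;> cases D1 <;> cases D2 <;> cases D3 <;> cases R0 <;> cases R1 <;> cases R2 <;>
    cases R3 <;> simp [vedge] <;> try decide

theorem vcontour (D R : Set (ℤ × ℤ)) (hRD : R ⊆ D)
    (hR : ∀ b ∈ R, ∀ b' ∈ D, (∃ a, a ∉ D ∧ vnb a b') → vst b b' → b' ∈ R)
    {a0 a1 b0 b1 : ℤ × ℤ} (ha0 : a0 ∉ D) (hb1 : b1 ∈ D)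
    (h0 : vnb a0 b0) (h1 : vnb a1 b1) (hb0 : b0 ∈ R) (ha : vR Dᶜ a0 a1) (hb : vR D b0 b1) :
    b1 ∈ R := by
  classical
  set f : ℤ × ℤ → ℤ × ℤ → ZMod 2 := fun a b =>
    vedge (decide (a ∈ D)) (decide (b ∈ D)) (decide (a ∈ R)) (decide (b ∈ R)) with hf
  have fsymm : ∀ a b, f a b = f b a := by
    intro a b
    simp only [hf, vedge]
    rw [Bool.xor_comm]
  obtain ⟨φ, hx, hy⟩ := vpot (fun x y => f (x, y) (x + 1, y)) (fun x y => f (x, y) (x, y + 1)) (by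
    intro x y
    have hs : ∀ b ∈ R, ∀ b' ∈ D, ∀ a, a ∉ D → vnb a b' → vst b b' → b' ∈ R :=
      fun b hb b' hb' a ha1 ha2 => hR b hb b' hb' ⟨a, ha1, ha2⟩
    apply vplaq
    · simpa using @hRD (x, y)
    · simpa using @hRD (x + 1, y)
    · simpa using @hRD (x + 1, y + 1)
    · simpa using @hRD (x, y + 1)
    · intro h
      simp only [Bool.or_eq_true, decide_eq_true_eq] at h
      obtain ⟨b, hbR, hbst⟩ : ∃ b ∈ R, vst b (x, y) ∧ vst b (x + 1, y) ∧ vst b (x + 1, y + 1) ∧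
          vst b (x, y + 1) := by
        rcases h with ((h | h) | h) | h
        · exact ⟨_, h, by simp [vst]⟩
        · exact ⟨_, h, by simp [vst]⟩
        · exact ⟨_, h, by simp [vst]⟩
        · exact ⟨_, h, by simp [vst]⟩
      obtain ⟨s0, s1, s2, s3⟩ := hbst
      simp only [Bool.and_eq_true, Bool.not_eq_true', decide_eq_true_eq, decide_eq_false_iff_not]
      refine ⟨fun h => hs b hbR _ h.1 _ h.2 ?_ s0, fun h => hs b hbR _ h.1 _ h.2 ?_ s0,
        fun h => hs b hbR _ h.1 _ h.2 ?_ s1, fun h => hs b hbR _ h.1 _ h.2 ?_ s1,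
        fun h => hs b hbR _ h.1 _ h.2 ?_ s2, fun h => hs b hbR _ h.1 _ h.2 ?_ s2,
        fun h => hs b hbR _ h.1 _ h.2 ?_ s3, fun h => hs b hbR _ h.1 _ h.2 ?_ s3⟩ <;>
      simp [vnb])
  have hφ : ∀ a b, vnb a b → φ b.1 b.2 = φ a.1 a.2 + f a b := by
    have two : ∀ z : ZMod 2, z + z = 0 := by decide
    rintro ⟨a, a'⟩ ⟨b, b'⟩ h
    simp only [vnb] at h
    rcases h with ⟨rfl, rfl | rfl⟩ | ⟨rfl, rfl | rfl⟩
    · simp only [hy]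
      rw [fsymm, add_assoc, two, add_zero]
    · exact hy _ _
    · simp only [hx]
      rw [fsymm, add_assoc, two, add_zero]
    · exact hx _ _
  have hc1 : ∀ b, vR Dᶜ a0 b → φ b.1 b.2 = φ a0.1 a0.2 := by
    intro b h
    induction h with
    | refl => rfl
    | @tail b c h1 h2 ih =>
      have hbD : b ∉ D := vR_mem (X := Dᶜ) ha0 h1
      have hcD : c ∉ D := h2.2
      have hbR : b ∉ R := fun h => hbD (hRD h)
      have hcR : c ∉ R := fun h => hcD (hRD h)
      rw [hφ b c h2.1, ih]
      simp [hf, vedge, hbR, hcR]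
  have hc2 : ∀ b, vR D b0 b → φ b.1 b.2 = φ b0.1 b0.2 := by
    intro b h
    induction h with
    | refl => rfl
    | @tail b c h1 h2 ih =>
      have hbD : b ∈ D := vR_mem (hRD hb0) h1
      have hcD : c ∈ D := h2.2
      rw [hφ b c h2.1, ih]
      simp [hf, vedge, hbD, hcD]
  have e0 := hφ _ _ h0
  have e1 := hφ _ _ h1
  rw [hc1 a1 ha, hc2 b1 hb, e0] at e1
  have e2 := add_left_cancel e1
  by_contra hcon
  have ha1 : a1 ∉ D := vR_mem (X := Dᶜ) ha0 ha
  have r0 : a0 ∉ R := fun h => ha0 (hRD h)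
  have r1 : a1 ∉ R := fun h => ha1 (hRD h)
  simp [hf, vedge, hb0, ha0, r0, r1, hcon] at e2

theorem vextract (X : Set (ℤ × ℤ)) (k k' : ℕ) (b0 : ((k : ℤ), (0 : ℤ)) ∈ X) 
    (h : Relation.ReflTransGen (fun b b' => vst b b' ∧ b' ∈ X) ((k : ℤ), (0:ℤ)) (-(k' : ℤ), 0)) :
    ∃ γ : ℕ → ℤ × ℤ, γ 0 = ((k : ℤ), 0) ∧ (∀ i < k, γ i ∈ X) ∧ (∀ i < k, vst (γ i) (γ (i + 1))) ∧
      Set.InjOn γ {i | i < k} := by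
  classical
  let G : SimpleGraph (ℤ × ℤ) :=
    { Adj := fun a b => a ≠ b ∧ vst a b ∧ a ∈ X ∧ b ∈ X
      symm := ⟨fun a b h => ⟨h.1.symm, by
        have := h.2.1
        unfold vst at *
        rw [abs_sub_comm b.1, abs_sub_comm b.2]
        exact this, h.2.2.2, h.2.2.1⟩⟩
      loopless := ⟨fun a h => h.1 rfl⟩ }
  have hreach : ∀ c, Relation.ReflTransGen (fun b b' => vst b b' ∧ b' ∈ X) ((k : ℤ), (0:ℤ)) c →
      c ∈ X ∧ G.Reachable ((k : ℤ), (0:ℤ)) c := by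
    intro c hc
    induction hc with
    | refl => exact ⟨b0, SimpleGraph.Reachable.refl _⟩
    | @tail b c _ h2 ih =>
      refine ⟨h2.2, ?_⟩
      by_cases hbc : b = c
      · rw [← hbc]; exact ih.2
      · exact ih.2.trans (SimpleGraph.Adj.reachable (G := G) ⟨hbc, h2.1, ih.1, h2.2⟩)
  obtain ⟨w⟩ := (hreach _ h).2
  set p := w.toPath with hp
  have hlen : ∀ (a b : ℤ × ℤ) (q : G.Walk a b), |a.1 - b.1| ≤ q.length := by
    intro a b q
    induction q with
    | nil => simp
    | @cons a b c hab q ih =>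
      rw [SimpleGraph.Walk.length_cons]
      have h1 : |a.1 - b.1| ≤ 1 := hab.2.1.1
      have h2 := abs_sub_le a.1 b.1 c.1
      push_cast
      omega
  have hl := hlen _ _ p.1
  have hk : k ≤ p.1.length := by
    simp only [sub_neg_eq_add] at hl
    rw [abs_of_nonneg (by positivity)] at hl
    omega
  have hadj : ∀ i < k, G.Adj (p.1.getVert i) (p.1.getVert (i + 1)) := fun i hi =>
    p.1.adj_getVert_succ (by omega)
  refine ⟨p.1.getVert, by simp, fun i hi => (hadj i hi).2.2.1, fun i hi => (hadj i hi).2.1, ?_⟩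
  intro i hi j hj hij
  have hi' : i < k := hi
  have hj' : j < k := hj
  exact p.2.getVert_injOn (by change i ≤ _; omega) (by change j ≤ _; omega) hij

theorem vpeierls (Gd : Set (ℤ × ℤ)) (n : ℕ)
    (hfin : {y | vR (Gd ∪ {z | z.2 = 0 ∧ |z.1| ≤ n}) (0, 0) y}.Finite) :
    ∃ k : ℕ, n < k ∧ ∃ γ : ℕ → ℤ × ℤ, γ 0 = ((k : ℤ), 0) ∧ (∀ i < k, γ i ∉ Gd) ∧
      (∀ i < k, vst (γ i) (γ (i + 1))) ∧ Set.InjOn γ {i | i < k} := by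
  set S : Set (ℤ × ℤ) := Gd ∪ {z | z.2 = 0 ∧ |z.1| ≤ n} with hS
  set C : Set (ℤ × ℤ) := {y | vR S (0, 0) y} with hC
  have hCS : ∀ a b, a ∈ C → vnb a b → b ∈ S → b ∈ C := fun a b ha hab hb => .tail ha ⟨hab, hb⟩
  have hseg1 : ∀ i : ℕ, i ≤ n → ((i : ℤ), (0 : ℤ)) ∈ C := by
    intro i hi
    have := vR_line (X := S) (fun i : ℕ => ((i : ℤ), (0 : ℤ))) i (by intro i; simp [vnb])
      (by intro j hj; right; simp; omega)
    change vR S (0, 0) _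
    simpa using this
  have hseg2 : ∀ i : ℕ, i ≤ n → (-(i : ℤ), (0 : ℤ)) ∈ C := by
    intro i hi
    have := vR_line (X := S) (fun i : ℕ => (-(i : ℤ), (0 : ℤ))) i (by intro i; simp [vnb])
      (by intro j hj; right; simp; omega)
    change vR S (0, 0) _
    simpa using this
  obtain ⟨M, hM⟩ : ∃ M : ℕ, ∀ y ∈ C, |y.1| < M ∧ |y.2| < M := by
    obtain ⟨M1, h1⟩ := (hfin.image (fun y => y.1.natAbs + y.2.natAbs)).bddAbove
    refine ⟨M1 + 1, fun y hy => ?_⟩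
    have := h1 ⟨y, hy, rfl⟩
    simp only at this
    rw [abs_lt, abs_lt]
    push_cast
    omega
  set D : Set (ℤ × ℤ) := {y | vR Cᶜ ((M : ℤ), 0) y} with hD
  have hM0 : ((M : ℤ), (0:ℤ)) ∈ Cᶜ := by
    intro h
    have := (hM _ h).1
    simp at this
  have hDC : ∀ y ∈ D, y ∉ C := fun y hy => vR_mem hM0 hy
  have hDext : ∀ a b, a ∈ D → vnb a b → b ∉ D → b ∈ C := by
    intro a b ha hab hb
    by_contra hbC
    exact hb (.tail ha ⟨hab, hbC⟩)
  have hMD : ((M : ℤ), (0:ℤ)) ∈ D := .refl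
  have hMD' : (-(M : ℤ), (0:ℤ)) ∈ D := by
    have l1 := vR_line (X := Cᶜ) (fun i : ℕ => ((M : ℤ), (i : ℤ))) M (by intro i; simp [vnb])
      (by intro j hj h; have := (hM _ h).1; simp at this)
    have l2 := vR_line (X := Cᶜ) (fun i : ℕ => ((M : ℤ) - i, (M : ℤ))) (2 * M)
      (by intro i; simp [vnb]; omega)
      (by intro j hj h; have := (hM _ h).2; simp at this)
    have l3 := vR_line (X := Cᶜ) (fun i : ℕ => (-(M : ℤ), (M : ℤ) - i)) M
      (by intro i; simp [vnb]; omega)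
      (by intro j hj h; have := (hM _ h).1; simp at this)
    simp only [Nat.cast_zero, sub_zero, sub_self] at l1 l2 l3
    have e : (M : ℤ) - ((2 * M : ℕ) : ℤ) = -M := by push_cast; ring
    rw [e] at l2
    exact (l1.trans l2).trans l3
  have hex : ∀ g : ℕ → ℤ × ℤ, (∀ i ≤ n, g i ∈ C) → g M ∈ D → (∀ i, vnb (g (i + 1)) (g i)) →
      ∃ k, n < k ∧ g k ∈ D ∧ g (k - 1) ∈ C := by
    classical
    intro g hg hgM hgn
    have hnM : n < M := by
      by_contra hc
      exact hDC _ hgM (hg M (by omega))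
    have hx : ∃ k, n < k ∧ g k ∈ D := ⟨M, hnM, hgM⟩
    refine ⟨Nat.find hx, (Nat.find_spec hx).1, (Nat.find_spec hx).2, ?_⟩
    have h1 := Nat.find_spec hx
    by_cases h2 : Nat.find hx - 1 ≤ n
    · exact hg _ h2
    · have h3 := Nat.find_min hx (m := Nat.find hx - 1) (by omega)
      have h4 : g (Nat.find hx - 1) ∉ D := fun h => h3 ⟨by omega, h⟩
      have h5 := hgn (Nat.find hx - 1)
      rw [Nat.sub_add_cancel (by omega)] at h5
      exact hDext _ _ h1.2 h5 h4
  obtain ⟨k, hnk, hkD, hkC⟩ := hex (fun i : ℕ => ((i : ℤ), 0)) hseg1 hMD (by intro i; simp [vnb])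
  obtain ⟨k', hnk', hkD', hkC'⟩ := hex (fun i : ℕ => (-(i : ℤ), 0)) hseg2 hMD'
    (by intro i; simp [vnb])
  refine ⟨k, hnk, ?_⟩
  set Bd : Set (ℤ × ℤ) := {b | b ∈ D ∧ ∃ a, a ∉ D ∧ vnb a b} with hBd
  have hBdG : ∀ b ∈ Bd, b ∉ Gd := by
    rintro b ⟨hb, a, ha, hab⟩ hG
    have haC := hDext b a hb (vnb_symm hab) ha
    exact hDC b hb (hCS a b haC hab (Or.inl hG))
  have hCC : ∀ y ∈ C, vR C (0, 0) y := by
    intro y hy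
    have hy' : vR S (0, 0) y := hy
    clear hy
    induction hy' with
    | refl => exact .refl
    | tail h1 h2 ih => exact .tail ih ⟨h2.1, .tail h1 h2⟩
  have hCD : ∀ a b, vR C a b → vR Dᶜ a b := by
    intro a b h
    exact h.lift id fun x y hxy => ⟨hxy.1, fun hyD => hDC y hyD hxy.2⟩
  have hDD : ∀ y ∈ D, vR D ((M : ℤ), 0) y := by
    intro y hy
    have hy' : vR Cᶜ ((M : ℤ), 0) y := hy
    clear hy
    induction hy' with
    | refl => exact .refl
    | tail h1 h2 ih => exact .tail ih ⟨h2.1, .tail h1 h2⟩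
  have n0 : vnb (((k - 1 : ℕ) : ℤ), (0:ℤ)) ((k : ℤ), 0) := by
    simp [vnb]; omega
  have n1 : vnb (-((k' - 1 : ℕ) : ℤ), (0:ℤ)) (-(k' : ℤ), 0) := by
    simp [vnb]; omega
  have h00 : ((0:ℤ), (0:ℤ)) ∈ C := .refl
  have hkBd : ((k : ℤ), (0:ℤ)) ∈ Bd := ⟨hkD, _, fun h => hDC _ h hkC, n0⟩
  have hmain : (-(k' : ℤ), (0:ℤ)) ∈ {b | b ∈ Bd ∧
      Relation.ReflTransGen (fun b b' => vst b b' ∧ b' ∈ Bd) ((k : ℤ), (0:ℤ)) b} := by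
    refine vcontour D _ (fun b hb => hb.1.1) ?_ (fun h => hDC _ h hkC) hkD' n0 n1 ⟨hkBd, .refl⟩
      (hCD _ _ ((vR_symm h00 (hCC _ hkC)).trans (hCC _ hkC')))
      ((vR_symm hMD (hDD _ hkD)).trans (hDD _ hkD'))
    intro b hb b' hb' ha hst
    exact ⟨⟨hb', ha⟩, .tail hb.2 ⟨hst, hb', ha⟩⟩
  refine vextract Gdᶜ k k' (hBdG _ hkBd) (hmain.2.lift id fun x y hxy => ⟨hxy.1, hBdG _ hxy.2⟩)


def vgood (d L : ℕ) (ω : Zd d → Bool) : Set (ℤ × ℤ) := {v | ∀ z ∈ vB d L v, ω z = true}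

theorem vcon_tail {d : ℕ} {S : Set (Zd d)} {x y z : Zd d} (h : connectedIn S x y) (ha : adj z y)
    (hz : z ∈ S) : connectedIn S x z := by
  obtain ⟨n, γ, h0, hn, hS, hadj⟩ := h
  refine ⟨n + 1, fun k => if k ≤ n then γ k else z, by simpa using h0, by simp, ?_, ?_⟩
  · intro k _
    by_cases hk : k ≤ n
    · simp only [hk, if_true]; exact hS k hk
    · simp only [hk, if_false]; exact hz
  · intro k hk
    by_cases hk' : k < n
    · simp only [show k + 1 ≤ n by omega, show k ≤ n by omega, if_true]
      exact hadj k hk'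
    · have : k = n := by omega
      subst this
      simpa [hn] using ha

theorem vemb_adj {d : ℕ} (hd : 7 ≤ d) {a b : ℤ × ℤ} (h : vnb a b) : adj (vemb d a) (vemb d b) := by
  obtain ⟨m, rfl⟩ : ∃ m, d = m + 2 := ⟨d - 2, by omega⟩
  unfold adj
  rw [Fin.sum_univ_succ, Fin.sum_univ_succ]
  simp [vemb, Fin.val_succ]
  unfold vnb at h
  omega

theorem vemb_inj {d : ℕ} (hd : 7 ≤ d) {a b : ℤ × ℤ} (h : vemb d a = vemb d b) : a = b := by
  have h0 := congrFun h ⟨0, by omega⟩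
  have h1 := congrFun h ⟨1, by omega⟩
  simp [vemb] at h0 h1
  exact Prod.ext h0 h1

theorem vcon_line {d : ℕ} (hd : 7 ≤ d) {S : Set (Zd d)} {x : Zd d} (q : ℕ → ℤ × ℤ) (n : ℕ)
    (h0 : connectedIn S x (vemb d (q 0))) (hq : ∀ i, vnb (q (i + 1)) (q i))
    (hS : ∀ i ≤ n, vemb d (q i) ∈ S) : connectedIn S x (vemb d (q n)) := by
  induction n with
  | zero => exact h0
  | succ n ih =>
    exact vcon_tail (ih fun i hi => hS i (by omega)) (vemb_adj hd (hq n)) (hS _ le_rfl)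

theorem vgood_pt {d L : ℕ} {ω : Zd d → Bool} {v : ℤ × ℤ} (hv : v ∈ vgood d L ω) (p : ℤ × ℤ)
    (h1 : L * v.1 ≤ p.1) (h2 : p.1 < L * v.1 + L) (h3 : L * v.2 ≤ p.2) (h4 : p.2 < L * v.2 + L) :
    vemb d p ∈ {z | ω z = true} := by
  refine hv _ ((vB_mem d L v _).2 ⟨(p.1 - L * v.1).toNat, (p.2 - L * v.2).toNat, ?_, ?_, ?_⟩)
  · omega
  · omega
  · congr 1
    ext
    · simp only; omega
    · simp only; omega

theorem vgood_step {d L : ℕ} (hd : 7 ≤ d) (hL : 1 ≤ L) {ω : Zd d → Bool} {v w : ℤ × ℤ} {x : Zd d}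
    (hv : v ∈ vgood d L ω) (hw : w ∈ vgood d L ω) (h : vnb v w)
    (hx : connectedIn {z | ω z = true} x (vemb d (L * v.1, L * v.2))) :
    connectedIn {z | ω z = true} x (vemb d (L * w.1, L * w.2)) := by
  obtain ⟨v1, v2⟩ := v
  obtain ⟨w1, w2⟩ := w
  simp only [vnb] at h
  rcases h with ⟨rfl, rfl | rfl⟩ | ⟨rfl, rfl | rfl⟩
  · have := vcon_line hd (S := {z | ω z = true}) (x := x)
      (fun i : ℕ => ((L * v1 : ℤ), (L * (w2 + 1) - i : ℤ))) L (by simpa using hx)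
      (by intro i; simp [vnb]; omega) (by
        intro i hi
        by_cases h0 : i = 0
        · refine vgood_pt hv _ ?_ ?_ ?_ ?_ <;> simp [h0] <;> omega
        · refine vgood_pt hw _ ?_ ?_ ?_ ?_ <;> simp [mul_add] <;> omega)
    simpa [mul_add] using this
  · have := vcon_line hd (S := {z | ω z = true}) (x := x)
      (fun i : ℕ => ((L * v1 : ℤ), (L * v2 + i : ℤ))) L (by simpa using hx)
      (by intro i; simp [vnb]; omega) (by
        intro i hi
        by_cases h0 : i = L
        · refine vgood_pt hw _ ?_ ?_ ?_ ?_ <;> simp [h0, mul_add] <;> omega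
        · refine vgood_pt hv _ ?_ ?_ ?_ ?_ <;> simp <;> omega)
    simpa [mul_add] using this
  · have := vcon_line hd (S := {z | ω z = true}) (x := x)
      (fun i : ℕ => ((L * (w1 + 1) - i : ℤ), (L * v2 : ℤ))) L (by simpa using hx)
      (by intro i; simp [vnb]; omega) (by
        intro i hi
        by_cases h0 : i = 0
        · refine vgood_pt hv _ ?_ ?_ ?_ ?_ <;> simp [h0] <;> omega
        · refine vgood_pt hw _ ?_ ?_ ?_ ?_ <;> simp [mul_add] <;> omega)
    simpa [mul_add] using this
  · have := vcon_line hd (S := {z | ω z = true}) (x := x)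
      (fun i : ℕ => ((L * v1 + i : ℤ), (L * v2 : ℤ))) L (by simpa using hx)
      (by intro i; simp [vnb]; omega) (by
        intro i hi
        by_cases h0 : i = L
        · refine vgood_pt hw _ ?_ ?_ ?_ ?_ <;> simp [h0, mul_add] <;> omega
        · refine vgood_pt hv _ ?_ ?_ ?_ ?_ <;> simp <;> omega)
    simpa [mul_add] using this

theorem vgood_inf {d L : ℕ} (hd : 7 ≤ d) (hL : 1 ≤ L) {ω : Zd d → Bool} {v : ℤ × ℤ}
    (hv : v ∈ vgood d L ω) (hinf : {y | vR (vgood d L ω) v y}.Infinite) :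
    {y : Zd d | connectedIn {z | ω z = true} (vemb d (L * v.1, L * v.2)) y}.Infinite := by
  have hinj : Function.Injective (fun w : ℤ × ℤ => vemb d (L * w.1, L * w.2)) := by
    intro a b h
    have := vemb_inj hd h
    simp only [Prod.mk.injEq] at this
    have hL' : (L : ℤ) ≠ 0 := by omega
    exact Prod.ext (mul_left_cancel₀ hL' this.1) (mul_left_cancel₀ hL' this.2)
  refine (hinf.image hinj.injOn).mono ?_
  rintro _ ⟨w, hw, rfl⟩
  have hw' : vR (vgood d L ω) v w := hw
  clear hw
  induction hw' with
  | refl =>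
    refine ⟨0, fun _ => vemb d (L * v.1, L * v.2), rfl, rfl, ?_, by simp⟩
    intro k _
    exact vgood_pt hv _ (by simp) (by simp; omega) (by simp) (by simp; omega)
  | tail h1 h2 ih => exact vgood_step hd hL (vR_mem hv h1) h2.2 h2.1 ih

theorem vR_inf (Gd : Set (ℤ × ℤ)) (n : ℕ)
    (hinf : {y | vR (Gd ∪ {z | z.2 = 0 ∧ |z.1| ≤ n}) (0, 0) y}.Infinite) :
    ∃ x ∈ Gd, {y | vR Gd x y}.Infinite := by
  by_contra hcon
  push Not at hcon
  apply hinf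
  set F : Set (ℤ × ℤ) := Set.Icc (-((n:ℤ) + 1), -1) ((n : ℤ) + 1, 1) with hF
  have hFfin : F.Finite := Set.finite_Icc _ _
  have : (F ∪ ⋃ x ∈ F ∩ Gd, {y | vR Gd x y}).Finite :=
    hFfin.union ((hFfin.subset Set.inter_subset_left).biUnion fun x hx => by
      simpa using hcon x hx.2)
  refine this.subset ?_
  intro y hy
  have hy' : vR (Gd ∪ {z | z.2 = 0 ∧ |z.1| ≤ n}) (0, 0) y := hy
  clear hy
  have hFm : ∀ p : ℤ × ℤ, p ∈ F ↔ (-((n:ℤ) + 1) ≤ p.1 ∧ p.1 ≤ n + 1 ∧ -1 ≤ p.2 ∧ p.2 ≤ 1) := by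
    intro p
    simp only [hF, Set.mem_Icc, Prod.le_def]
    tauto
  have key : (y.2 = 0 ∧ |y.1| ≤ n) ∨ ∃ x ∈ F ∩ Gd, vR Gd x y := by
    induction hy' with
    | refl => left; simp
    | @tail b c h1 h2 ih =>
      rcases h2.2 with hc | hc
      · right
        rcases ih with hb | ⟨x, hx, hxb⟩
        · refine ⟨c, ⟨?_, hc⟩, .refl⟩
          rw [hFm]
          have := h2.1
          rw [abs_le] at hb
          unfold vnb at this
          omega
        · exact ⟨x, hx, .tail hxb ⟨h2.1, hc⟩⟩
      · left; exact hc
  rcases key with h | ⟨x, hx, h⟩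
  · left
    rw [hFm]
    rw [abs_le] at h
    omega
  · right
    exact Set.mem_biUnion hx h

theorem vprob {d : ℕ} (hd : 7 ≤ d) {P : Zd d → Measure (ℕ → Zd d)} (hP : IsSRW d P) :
    ∃ L : ℕ, 1 ≤ L ∧ ∃ ubar : ℝ, 0 < ubar ∧ ∀ u : ℝ, 0 < u → u ≤ ubar →
      ∀ Q : Measure (Zd d → Bool), IsVacantLaw d P u Q → ∀ U : Finset (ℤ × ℤ),
        Q {ω | ∀ v ∈ U, v ∉ vgood d L ω} ≤ (36⁻¹ : ℝ≥0∞) ^ U.card := by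
  classical
  obtain ⟨L, hL, hbox⟩ := vboxes hd (3 * 36 ^ 4) (by norm_num)
  have hLr : (1 : ℝ) ≤ L := by exact_mod_cast hL
  refine ⟨L, hL, 1 / (2 * (3 * 36 ^ 4) * (L * L)), by positivity, ?_⟩
  intro u hu hu' Q hQ U
  have := hQ.1
  obtain ⟨c, -, hc⟩ := Finset.exists_le_card_fiber_of_nsmul_le_card_of_maps_to
    (s := U) (t := (Finset.Ico (0:ℤ) 2) ×ˢ (Finset.Ico (0:ℤ) 2)) (f := fun v => (v.1 % 2, v.2 % 2))
    (b := (U.card : ℝ) / 4) (by intro v _; simp; omega) (by simp) (by simp; linarith)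
  set V := U.filter (fun v => (v.1 % 2, v.2 % 2) = c) with hV
  have hpar : ∀ v ∈ V, ∀ w ∈ V, v.1 % 2 = w.1 % 2 ∧ v.2 % 2 = w.2 % 2 := by
    intro v hv w hw
    have h1 := (Finset.mem_filter.1 hv).2
    have h2 := (Finset.mem_filter.1 hw).2
    rw [← h2] at h1
    simpa using h1
  have hcard : U.card ≤ 4 * V.card := by
    have : (U.card : ℝ) ≤ 4 * V.card := by linarith
    exact_mod_cast this
  have hb := vbad hd hP (vB d L) V (3 * 36 ^ 4) (by norm_num) (hbox V hpar) u hu Q hQ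
  have hsub : {ω : Zd d → Bool | ∀ v ∈ U, v ∉ vgood d L ω} ⊆
      {ω | ∀ v ∈ V, ∃ z ∈ vB d L v, ω z = false} := by
    intro ω hω v hv
    have := hω v (Finset.mem_filter.1 hv).1
    simpa [vgood] using this
  have hbi : ((V.biUnion (vB d L)).card : ℝ) ≤ V.card * (L * L) := by
    have := Finset.card_biUnion_le_card_mul V (vB d L) (L * L) (fun v _ => vB_card d L v)
    exact_mod_cast this
  have hexp : Real.exp (u * (2 * ((3 * 36 ^ 4 : ℕ) : ℝ) * (V.biUnion (vB d L)).card)) ≤ 3 ^ V.card := by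
    have h1 : u * (2 * ((3 * 36 ^ 4 : ℕ) : ℝ) * (V.biUnion (vB d L)).card) ≤ V.card := by
      calc u * (2 * ((3 * 36 ^ 4 : ℕ) : ℝ) * (V.biUnion (vB d L)).card)
          ≤ (1 / (2 * (3 * 36 ^ 4) * (L * L))) * (2 * ((3 * 36 ^ 4 : ℕ) : ℝ) * (V.card * (L * L))) := by
            gcongr
        _ = V.card := by
            push_cast
            field_simp
            norm_num
    calc _ ≤ Real.exp (V.card) := Real.exp_le_exp.2 h1
      _ = Real.exp 1 ^ V.card := by rw [← Real.exp_nat_mul, mul_one]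
      _ ≤ 3 ^ V.card := by
          gcongr
          exact Real.exp_one_lt_three.le
  have hfin : Q.real {ω | ∀ v ∈ V, ∃ z ∈ vB d L v, ω z = false} ≤ (36⁻¹ : ℝ) ^ U.card := by
    refine hb.trans ?_
    calc _ ≤ (((3 * 36 ^ 4 : ℕ) : ℝ)⁻¹) ^ V.card * 3 ^ V.card := by gcongr
      _ = (36⁻¹ : ℝ) ^ (4 * V.card) := by
          rw [← mul_pow, pow_mul]
          congr 1
          norm_num
      _ ≤ (36⁻¹ : ℝ) ^ U.card := pow_le_pow_of_le_one (by norm_num) (by norm_num) hcard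
  refine (measure_mono hsub).trans ?_
  rw [← ENNReal.ofReal_toReal (measure_ne_top Q _)]
  refine (ENNReal.ofReal_le_ofReal hfin).trans ?_
  rw [ENNReal.ofReal_pow (by norm_num), ENNReal.ofReal_inv_of_pos (by norm_num)]
  simp

def vE (d L k : ℕ) : Set (Zd d → Bool) := {ω | ∃ γ : ℕ → ℤ × ℤ, γ 0 = ((k : ℤ), 0) ∧
  (∀ i < k, γ i ∉ vgood d L ω) ∧ (∀ i < k, vst (γ i) (γ (i + 1))) ∧ Set.InjOn γ {i | i < k}}

theorem vE_le {d L : ℕ} (Q : Measure (Zd d → Bool)) 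
    (h : ∀ U : Finset (ℤ × ℤ), Q {ω | ∀ v ∈ U, v ∉ vgood d L ω} ≤ (36⁻¹ : ℝ≥0∞) ^ U.card) (k : ℕ) :
    Q (vE d L k) ≤ (4⁻¹ : ℝ≥0∞) ^ k := by
  classical
  set ext : (Fin k → ℤ × ℤ) → ℕ → ℤ × ℤ := fun w j => if h : j < k then w ⟨j, h⟩ else 0 with hext
  set gam : (Fin k → ℤ × ℤ) → ℕ → ℤ × ℤ := fun w i =>
    ((k : ℤ), (0:ℤ)) + ∑ j ∈ Finset.range i, ext w j with hgam
  set W : Finset (Fin k → ℤ × ℤ) :=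
    Fintype.piFinset (fun _ => Finset.Icc ((-1 : ℤ), (-1 : ℤ)) (1, 1)) with hW
  have hWc : W.card = 9 ^ k := by
    rw [hW, Fintype.card_piFinset]
    simp only [Finset.prod_const, Finset.card_univ, Fintype.card_fin]
    congr 1
  have hsub : vE d L k ⊆ ⋃ w ∈ W, {ω | Set.InjOn (gam w) {i | i < k} ∧
      ∀ i < k, gam w i ∉ vgood d L ω} := by
    rintro ω ⟨γ, h0, hg, hs, hi⟩
    set w : Fin k → ℤ × ℤ := fun j => γ (j + 1) - γ j with hw
    have hge : ∀ i < k, gam w i = γ i := by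
      intro i hik
      simp only [hgam]
      rw [← h0]
      have : ∑ j ∈ Finset.range i, ext w j = ∑ j ∈ Finset.range i, (γ (j + 1) - γ j) := by
        refine Finset.sum_congr rfl fun j hj => ?_
        have : j < k := by have := Finset.mem_range.1 hj; omega
        simp [hext, hw, this]
      rw [this, Finset.sum_range_sub]
      abel
    refine Set.mem_biUnion (x := w) ?_ ⟨?_, ?_⟩
    · rw [hW, Finset.mem_coe, Fintype.mem_piFinset]
      intro j
      have := hs j j.2
      simp only [vst, abs_le] at this
      simp only [hw, Finset.mem_Icc, Prod.le_def, Prod.fst_sub, Prod.snd_sub]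
      omega
    · intro i hi1 j hj1 hij
      rw [hge i hi1, hge j hj1] at hij
      exact hi hi1 hj1 hij
    · intro i hik
      rw [hge i hik]
      exact hg i hik
  refine (measure_mono hsub).trans ((measure_biUnion_finset_le _ _).trans ?_)
  have hone : ∀ w ∈ W, Q {ω | Set.InjOn (gam w) {i | i < k} ∧
      ∀ i < k, gam w i ∉ vgood d L ω} ≤ (36⁻¹ : ℝ≥0∞) ^ k := by
    intro w _
    by_cases hinj : Set.InjOn (gam w) {i | i < k}
    · have hc : ((Finset.range k).image (gam w)).card = k := by
        rw [Finset.card_image_of_injOn, Finset.card_range]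
        intro i hi j hj hij
        exact hinj (by simpa using hi) (by simpa using hj) hij
      have := h ((Finset.range k).image (gam w))
      rw [hc] at this
      refine (measure_mono ?_).trans this
      intro ω hω v hv
      obtain ⟨i, hi, rfl⟩ := Finset.mem_image.1 hv
      exact hω.2 i (Finset.mem_range.1 hi)
    · simp [hinj]
  refine (Finset.sum_le_sum hone).trans ?_
  rw [Finset.sum_const, hWc, nsmul_eq_mul]
  push_cast
  rw [← mul_pow]
  have : (9 : ℝ≥0∞) * 36⁻¹ = 4⁻¹ := by
    rw [show (36 : ℝ≥0∞) = 9 * 4 by norm_num, ENNReal.mul_inv (by simp) (by simp), ← mul_assoc,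
      ENNReal.mul_inv_cancel (by simp) (by simp), one_mul]
  rw [this]

theorem vE_sum {d L : ℕ} (Q : Measure (Zd d → Bool)) 
    (h : ∀ U : Finset (ℤ × ℤ), Q {ω | ∀ v ∈ U, v ∉ vgood d L ω} ≤ (36⁻¹ : ℝ≥0∞) ^ U.card) (n : ℕ) :
    Q (⋃ k, vE d L (n + 1 + k)) ≤ (4⁻¹ : ℝ≥0∞) ^ (n + 1) * 2 := by
  refine (measure_iUnion_le _).trans ((ENNReal.tsum_le_tsum fun k => vE_le Q h _).trans ?_)
  simp_rw [pow_add _ (n + 1)]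
  rw [ENNReal.tsum_mul_left, ENNReal.tsum_geometric]
  gcongr
  rw [ENNReal.inv_le_iff_inv_le]
  refine ENNReal.le_sub_of_add_le_right (by simp) ?_
  calc (2⁻¹ : ℝ≥0∞) + 4⁻¹ ≤ 2⁻¹ + 2⁻¹ := by
        gcongr
        norm_num
    _ = 1 := ENNReal.inv_two_add_inv_two

theorem vfinal (d : ℕ) (hd : 7 ≤ d) (P : Zd d → Measure (ℕ → Zd d)) (hP : IsSRW d P) :
    ∃ ubar : ℝ, 0 < ubar ∧
      ∀ u : ℝ, 0 < u → u ≤ ubar →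
      ∀ Q : Measure (Zd d → Bool), IsVacantLaw d P u Q →
        Q {ω | ∃ x : Zd d, {y : Zd d | connectedIn {z | ω z = true} x y}.Infinite} = 1
        ∧ 0 < Q {ω | {y : Zd d | connectedIn {z | ω z = true} (0 : Zd d) y}.Infinite} := by
  obtain ⟨L, hL, ubar, hub, hmain⟩ := vprob hd hP
  refine ⟨ubar, hub, fun u hu hu' Q hQ => ?_⟩
  have := hQ.1
  have hQU := hmain u hu hu' Q hQ
  have hE := vE_sum Q hQU
  have hpei : ∀ (n : ℕ) (ω : Zd d → Bool), ω ∉ ⋃ k, vE d L (n + 1 + k) →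
      {y | vR (vgood d L ω ∪ {z | z.2 = 0 ∧ |z.1| ≤ n}) (0, 0) y}.Infinite := by
    intro n ω hω hfin
    obtain ⟨k, hk, hγ⟩ := vpeierls _ n hfin
    apply hω
    rw [Set.mem_iUnion]
    refine ⟨k - (n + 1), ?_⟩
    rw [show n + 1 + (k - (n + 1)) = k by omega]
    exact hγ
  constructor
  · set A : Set (Zd d → Bool) :=
      {ω | ∃ x : Zd d, {y : Zd d | connectedIn {z | ω z = true} x y}.Infinite} with hA
    refine le_antisymm prob_le_one ?_
    have hn : ∀ n : ℕ, 1 ≤ Q A + (4⁻¹ : ℝ≥0∞) ^ (n + 1) * 2 := by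
      intro n
      rw [← measure_univ (μ := Q)]
      refine le_trans ?_ (add_le_add le_rfl (hE n))
      refine le_trans (measure_mono ?_) (measure_union_le _ _)
      intro ω _
      by_cases hω : ω ∈ ⋃ k, vE d L (n + 1 + k)
      · right; exact hω
      · left
        obtain ⟨x, hx, hinf⟩ := vR_inf _ n (hpei n ω hω)
        exact ⟨_, vgood_inf hd hL hx hinf⟩
    have ht : Filter.Tendsto (fun n : ℕ => Q A + (4⁻¹ : ℝ≥0∞) ^ (n + 1) * 2) Filter.atTop
        (nhds (Q A + 0 * 2)) := by
      refine Filter.Tendsto.add tendsto_const_nhds (ENNReal.Tendsto.mul_const ?_ (by simp))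
      exact (ENNReal.tendsto_pow_atTop_nhds_zero_of_lt_one (by simp)).comp
        (Filter.tendsto_add_atTop_nat 1)
    have := ge_of_tendsto' ht hn
    simpa using this
  · set A : Set (Zd d → Bool) :=
      {ω | {y : Zd d | connectedIn {z | ω z = true} (0 : Zd d) y}.Infinite} with hA
    have h1 : 1 ≤ Q A + (36⁻¹ + (4⁻¹ : ℝ≥0∞) ^ (0 + 1) * 2) := by
      rw [← measure_univ (μ := Q)]
      refine le_trans ?_ (add_le_add le_rfl (add_le_add (hQU {(0, 0)} |>.trans_eq (by simp)) (hE 0)))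
      refine le_trans (measure_mono ?_) ((measure_union_le _ _).trans
        (add_le_add le_rfl (measure_union_le _ _)))
      intro ω _
      by_cases hω : ω ∈ ⋃ k, vE d L (0 + 1 + k)
      · right; right; exact hω
      · by_cases h0 : ((0:ℤ), (0:ℤ)) ∈ vgood d L ω
        · left
          have hi := hpei 0 ω hω
          have e : vgood d L ω ∪ {z | z.2 = 0 ∧ |z.1| ≤ ((0 : ℕ) : ℤ)} = vgood d L ω := by
            apply Set.union_eq_left.2
            rintro ⟨a, b⟩ ⟨h1, h2⟩
            simp only [Nat.cast_zero, abs_nonpos_iff] at h1 h2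
            rw [h1, h2]
            exact h0
          rw [e] at hi
          have := vgood_inf hd hL h0 hi
          have e2 : vemb d ((L : ℤ) * ((0:ℤ), (0:ℤ)).1, (L : ℤ) * ((0:ℤ), (0:ℤ)).2) = 0 := by
            ext i
            simp [vemb]
          rw [e2] at this
          exact this
        · right; left
          simpa using h0
    rw [pos_iff_ne_zero]
    intro h0
    rw [h0, zero_add] at h1
    have h2 : (36⁻¹ + (4⁻¹ : ℝ≥0∞) ^ (0 + 1) * 2) < 1 := by
      have : (36⁻¹ + (4⁻¹ : ℝ≥0∞) ^ (0 + 1) * 2) = ENNReal.ofReal (36⁻¹ + 4⁻¹ * 2) := by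
        rw [ENNReal.ofReal_add (by norm_num) (by norm_num), ENNReal.ofReal_mul (by norm_num),
          ENNReal.ofReal_inv_of_pos (by norm_num), ENNReal.ofReal_inv_of_pos (by norm_num)]
        simp
      rw [this, ENNReal.ofReal_lt_one]
      norm_num
    exact absurd h1 (not_le.2 h2)

/-- **Theorem 4.3: percolation of the vacant set for small `u` when `d ≥ 7`.**
There is `ū > 0` such that for every `0 < u ≤ ū` and every vacant-set law `Q` at level
`u`, the vacant set percolates with probability one; equivalently the origin lies in an
infinite vacant cluster with positive probability. -/
theorem percolation_small_u
    (d : ℕ) (hd : 7 ≤ d) (P : Zd d → Measure (ℕ → Zd d)) (hP : IsSRW d P) :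
    ∃ ubar : ℝ, 0 < ubar ∧
      ∀ u : ℝ, 0 < u → u ≤ ubar →
      ∀ Q : Measure (Zd d → Bool), IsVacantLaw d P u Q →
        Q {ω | ∃ x : Zd d, {y : Zd d | connectedIn {z | ω z = true} x y}.Infinite} = 1
        ∧ 0 < Q {ω | {y : Zd d | connectedIn {z | ω z = true} (0 : Zd d) y}.Infinite} := by
  exact vfinal d hd P hP
end
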